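/- Suppose r_X − r_Y ≠ 0. Then the lower tail probability F(x) = P(S_n ≤ x) admits the asymptotic expansion, as x → −∞: F(x) ∼ ((1−ρ)C_n/(2√(2π))) ((1−ρ)/(|r_X−r_Y|√n))^{(n−1)/2} exp((n/8)((1−ρ)/(1+ρ))(r_X+r_Y)²) · (|x|/s)^{(n−3)/4} exp((|r_X−r_Y|/(1−ρ))√(n|x|/s) + x/(s(1−ρ))) · Σ_{p=0}^∞ γ_p(r_X,−r_Y,−ρ,n) s^{p/2} |x|^{−p/2}; that is, for every integer N ≥ 0, F(x) equals the prefactor times (Σ_{p=0}^N γ_p(r_X,−r_Y,−ρ,n) s^{p/2} |x|^{−p/2} + o(|x|^{−N/2})) as x → −∞. -/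

import Mathlib

noncomputable section
open MeasureTheory Filter Asymptotics Topology Finset


/-- Ascending factorial (Pochhammer symbol) `(v)_j = v (v+1) ⋯ (v+j−1)`. -/
def poch (v : ℝ) (j : ℕ) : ℝ := ∏ t ∈ Finset.range j, (v + t)

/-- Generalized binomial coefficient `binom(α, k) = α (α−1) ⋯ (α−k+1)/k!`. -/
def genBinom (α : ℝ) (k : ℕ) : ℝ := (∏ t ∈ Finset.range k, (α - t)) / (Nat.factorial k)

/-- Confluent hypergeometric function of the first kind `M(a,b,x)`. -/
def hypM (a b x : ℝ) : ℝ := ∑' j : ℕ, poch a j / poch b j * x ^ j / (Nat.factorial j)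

/-- `compS q m` is the sum over compositions `r` of `q` into `m` positive parts of
`∏ binom(1/2, r_t)`. -/
def compS (q m : ℕ) : ℝ :=
  if m ≤ q then
    ∑ r ∈ Finset.Nat.antidiagonalTuple m (q - m), ∏ t, genBinom (1 / 2) (1 + r t)
  else 0

/-- `puiseuxG a b i j` is the coefficient of `u^i y^(j/2)` in the Puiseux series expansion of
`(1+uy)^a exp(b y^(−1/2) (√(1+uy) − 1))` about `y = 0`. -/
def puiseuxG (a b : ℝ) (i j : ℕ) : ℝ :=
  if j ≤ 2 * i then
    ∑ p ∈ Finset.range (j - i + 1),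
      genBinom a p * b ^ (2 * i - j) / (Nat.factorial (2 * i - j)) * compS (i - p) (2 * i - j)
  else 0

/-- The coefficient `h_{j,ℓ}(r_X, r_Y, ρ, n)`. -/
def hCoef (rX rY ρ : ℝ) (n : ℕ) (j ℓ : ℕ) : ℝ :=
  poch ((3 - (n : ℝ)) / 2) (ℓ - j) * poch (((n : ℝ) - 1) / 2) (ℓ - j) /
      ((Nat.factorial (ℓ - j)) * 2 ^ (ℓ - j) * (n : ℝ) ^ (((ℓ - j : ℕ) : ℝ) / 2)) *
    ((1 + ρ) / |rX + rY|) ^ (ℓ - j) *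
    ∑ i ∈ Finset.Icc ((j + 1) / 2) j,
      poch ((n : ℝ) / 2) i * ((1 - ρ ^ 2) / 2) ^ i *
        hypM ((n : ℝ) / 2 + i) ((n : ℝ) / 2) ((n : ℝ) / 8 * ((1 + ρ) / (1 - ρ)) * (rX - rY) ^ 2) *
        puiseuxG (((n : ℝ) - 3) / 4 - ((ℓ - j : ℕ) : ℝ) / 2)
          (|rX + rY| / (1 + ρ) * Real.sqrt n) i j

/-- The coefficient `c_ℓ(r_X, r_Y, ρ, n)`. -/
def cCoef (rX rY ρ : ℝ) (n : ℕ) (ℓ : ℕ) : ℝ :=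
  if ℓ = 0 then 1
  else Real.exp (-((n : ℝ) / 8 * ((1 + ρ) / (1 - ρ)) * (rX - rY) ^ 2)) *
    ∑ j ∈ Finset.range (ℓ + 1), hCoef rX rY ρ n j ℓ

/-- The coefficient `d_k(r_X, ρ, n)`. -/
def dCoef (rX ρ : ℝ) (n : ℕ) (k : ℕ) : ℝ :=
  if k = 0 then 1
  else (-1 : ℝ) ^ k * poch (1 - (n : ℝ) / 2) k * poch ((n : ℝ) / 2) k / (Nat.factorial k) *
    ((1 - ρ ^ 2) / 2) ^ k *
    ∑ j ∈ Finset.range (k + 1),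
      ((n : ℝ) / 2) ^ j / poch ((n : ℝ) / 2) j * (Nat.choose k j) *
        ((1 + ρ) / (1 - ρ)) ^ j * rX ^ (2 * j)

/-- The coefficient `γ_p(r_X, r_Y, ρ, n)`. -/
def gammaCoef (rX rY ρ : ℝ) (n : ℕ) (p : ℕ) : ℝ :=
  if p = 0 then 1
  else
    ∑ i ∈ Finset.range (p + 1), ∑ j ∈ Finset.range (p + 1),
      ∑ k ∈ Finset.range (p + 1), ∑ ℓ ∈ Finset.range (p + 1),
        if i + 2 * j + k + ℓ = p then
          (-1 : ℝ) ^ (j + i) * cCoef rX rY ρ n ℓ * genBinom (((n : ℝ) - 1) / 2 - ℓ) k *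
            genBinom (((n : ℝ) - 3) / 2 - ℓ - k - 2 * j) i *
            poch (((ℓ : ℝ) + k) / 2 - ((n : ℝ) - 3) / 4) j * (1 + ρ) ^ j *
            (|rX + rY| * Real.sqrt n / 2) ^ (k + i)
        else 0

/-- The coefficient `δ_k(r_X, ρ, n)`. -/
def deltaCoef (rX ρ : ℝ) (n : ℕ) (k : ℕ) : ℝ :=
  if k = 0 then 1
  else
    ∑ j ∈ Finset.range (k + 1),
      (-1 : ℝ) ^ (k - j) * dCoef rX ρ n j * poch ((k : ℝ) + 1 - (n : ℝ) / 2) (k - j) *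
        (1 + ρ) ^ (k - j)

/-- Joint density of a bivariate normal random vector with means `(μX, μY)`,
variances `(σX², σY²)` and correlation coefficient `ρ`. -/
def biNormPDF (μX μY σX σY ρ : ℝ) (v : ℝ × ℝ) : ℝ :=
  (2 * Real.pi * σX * σY * Real.sqrt (1 - ρ ^ 2))⁻¹ *
    Real.exp (-(2 * (1 - ρ ^ 2))⁻¹ *
      (((v.1 - μX) / σX) ^ 2 - 2 * ρ * ((v.1 - μX) / σX) * ((v.2 - μY) / σY) +
        ((v.2 - μY) / σY) ^ 2))

/-- The law of `S_n = ∑_{i=1}^n X_i Y_i`, where `(X_i, Y_i)` are independent bivariate normal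
random vectors with means `(μX, μY)`, variances `(σX², σY²)` and correlation coefficient `ρ`. -/
def prodLaw (μX μY σX σY ρ : ℝ) (n : ℕ) : Measure ℝ :=
  Measure.map (fun v : Fin n → ℝ × ℝ => ∑ i, (v i).1 * (v i).2)
    (Measure.pi fun _ : Fin n =>
      (volume : Measure (ℝ × ℝ)).withDensity fun v => ENNReal.ofReal (biNormPDF μX μY σX σY ρ v))

/-- `HasExp f c` says that `f v ∼ ∑ c k v⁻ᵏ` as `v → ∞`. -/
def HasExp (f : ℝ → ℝ) (c : ℕ → ℝ) : Prop :=
  ∀ N : ℕ, (fun v => f v - ∑ k ∈ range N, c k * v⁻¹ ^ k) =O[atTop] fun v => v⁻¹ ^ N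

lemma HasExp.congr' {f g : ℝ → ℝ} {c : ℕ → ℝ} (hf : HasExp f c) (h : f =ᶠ[atTop] g) :
    HasExp g c := fun N => (hf N).congr' (h.mono fun v hv => by simp [hv]) EventuallyEq.rfl

lemma isBigO_inv_pow_of_le {M N : ℕ} (h : N ≤ M) :
    (fun v : ℝ => v⁻¹ ^ M) =O[atTop] fun v => v⁻¹ ^ N := by
  refine IsBigO.of_bound 1 ?_
  filter_upwards [eventually_ge_atTop 1] with v hv
  have hv' : v⁻¹ ≤ 1 := inv_le_one_of_one_le₀ hv
  have h0 : 0 ≤ v⁻¹ := by positivity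
  rw [Real.norm_of_nonneg (by positivity), Real.norm_of_nonneg (by positivity), one_mul]
  exact pow_le_pow_of_le_one h0 hv' h

lemma HasExp.isBigO_one {f : ℝ → ℝ} {c : ℕ → ℝ} (hf : HasExp f c) :
    f =O[atTop] fun _ => (1 : ℝ) := by
  simpa using hf 0

lemma HasExp.const_mul {f : ℝ → ℝ} {c : ℕ → ℝ} (a : ℝ) (hf : HasExp f c) :
    HasExp (fun v => a * f v) (fun k => a * c k) := by
  intro N
  refine ((hf N).const_mul_left a).congr_left fun v => ?_
  rw [mul_sub, Finset.mul_sum]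
  simp [mul_assoc]

/-- Substituting expansions of the `g k` into `f ∼ ∑ v^(-w k) g k`. -/
lemma HasExp.of_shift {f : ℝ → ℝ} {g : ℕ → ℝ → ℝ} {c : ℕ → ℕ → ℝ} {w : ℕ} (hw : 1 ≤ w)
    (hf : ∀ K : ℕ, (fun v => f v - ∑ k ∈ range K, v⁻¹ ^ (w * k) * g k v)
      =O[atTop] fun v => v⁻¹ ^ K)
    (hg : ∀ k, HasExp (g k) (c k)) :
    HasExp f fun p => ∑ k ∈ range (p + 1), if w * k ≤ p then c k (p - w * k) else 0 := by
  intro N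
  have h1 : ∀ k ∈ range N, (fun v => v⁻¹ ^ (w * k) *
      (g k v - ∑ q ∈ range (N - w * k), c k q * v⁻¹ ^ q)) =O[atTop] fun v => v⁻¹ ^ N := by
    intro k _
    refine ((isBigO_refl (fun v : ℝ => v⁻¹ ^ (w * k)) atTop).mul (hg k (N - w * k))).trans ?_
    simp only [← pow_add]
    exact isBigO_inv_pow_of_le (by omega)
  refine ((hf N).add (IsBigO.sum h1)).congr_left fun v => ?_
  have h2 : ∑ k ∈ range N, v⁻¹ ^ (w * k) * ∑ q ∈ range (N - w * k), c k q * v⁻¹ ^ q =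
      ∑ p ∈ range N, (∑ k ∈ range (p + 1), if w * k ≤ p then c k (p - w * k) else 0) *
        v⁻¹ ^ p := by
    have h3 : ∀ k ∈ range N, v⁻¹ ^ (w * k) * ∑ q ∈ range (N - w * k), c k q * v⁻¹ ^ q =
        ∑ p ∈ range N, (if w * k ≤ p then c k (p - w * k) else 0) * v⁻¹ ^ p := by
      intro k _
      rw [Finset.mul_sum]
      have : ∑ p ∈ range N, (if w * k ≤ p then c k (p - w * k) else 0) * v⁻¹ ^ p =
          ∑ p ∈ range N with w * k ≤ p, c k (p - w * k) * v⁻¹ ^ p := by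
        rw [Finset.sum_filter]; exact Finset.sum_congr rfl fun p _ => by split_ifs <;> simp
      rw [this]
      refine Finset.sum_bij' (fun q _ => q + w * k) (fun p _ => p - w * k) ?_ ?_ ?_ ?_ ?_
      · intro q hq; simp at hq ⊢; omega
      · intro p hp; simp at hp ⊢; omega
      · intro q _; simp
      · intro p hp; simp at hp ⊢; omega
      · intro q _; simp [pow_add]; ring
    rw [Finset.sum_congr rfl h3, Finset.sum_comm]
    refine Finset.sum_congr rfl fun p hp => ?_
    rw [← Finset.sum_mul]
    congr 1
    symm
    refine Finset.sum_subset (fun k hk => by simp at hk hp ⊢; omega) fun k _ hk => ?_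
    rw [if_neg]
    simp only [Finset.mem_range, not_lt] at hk
    have := Nat.mul_le_mul_right k hw
    omega
  rw [Finset.sum_apply]
  simp only [mul_sub, Finset.sum_sub_distrib]
  rw [h2]; ring

lemma HasExp.mul {f g : ℝ → ℝ} {a b : ℕ → ℝ} (hf : HasExp f a) (hg : HasExp g b) :
    HasExp (fun v => f v * g v) fun p => ∑ k ∈ range (p + 1), a k * b (p - k) := by
  have := HasExp.of_shift (f := fun v => f v * g v) (g := fun k v => a k * g v)
    (c := fun k q => a k * b q) le_rfl (fun K => ?_) fun k => hg.const_mul _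
  · convert this using 2 with p
    refine Finset.sum_congr rfl fun k hk => ?_
    rw [if_pos (by simp at hk; omega), one_mul]
  · refine ((hf K).mul hg.isBigO_one).congr (fun v => ?_) fun v => by simp
    rw [sub_mul, Finset.sum_mul]
    congr 1
    exact Finset.sum_congr rfl fun k _ => by ring

lemma hasExp_one : HasExp (fun _ => 1) fun k => if k = 0 then 1 else 0 := by
  intro N
  rcases Nat.eq_zero_or_pos N with rfl | hN
  · simpa using isBigO_refl (fun _ : ℝ => (1 : ℝ)) atTop
  · refine (isBigO_zero _ _).congr_left fun v => ?_
    rw [Finset.sum_eq_single_of_mem 0 (Finset.mem_range.2 hN) fun b _ hb => by simp [hb]]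
    simp

lemma ringChoose_eq_genBinom (a : ℝ) (k : ℕ) : Ring.choose a k = genBinom a k := by
  have h : (descPochhammer ℤ k).smeval a = ∏ t ∈ range k, (a - t) := by
    induction k with
    | zero => simp
    | succ k ih =>
      rw [descPochhammer_succ_right, Polynomial.smeval_mul, ih, Finset.prod_range_succ]
      simp [Polynomial.smeval_sub, Polynomial.smeval_natCast]
  rw [Ring.choose_eq_smul, genBinom, h]
  simp [div_eq_inv_mul]

/-- Binomial expansion with `O`-remainder at zero. -/
lemma isBigO_one_add_rpow_sub (a : ℝ) (N : ℕ) :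
    (fun x : ℝ => (1 + x) ^ a - ∑ k ∈ range N, genBinom a k * x ^ k)
      =O[𝓝 0] fun x => x ^ N := by
  have h := (Real.one_add_rpow_hasFPowerSeriesAt_zero (a := a)).isBigO_sub_partialSum_pow N
  have h' := (h.trans (isBigO_of_le (g := fun x : ℝ => x ^ N) _ (fun x => by simp)))
  refine h'.congr_left fun x => ?_
  simp [FormalMultilinearSeries.partialSum, binomialSeries,
    FormalMultilinearSeries.coeff_ofScalars, ringChoose_eq_genBinom, mul_comm]

lemma hasExp_one_add_div_rpow (a c : ℝ) :
    HasExp (fun v => (1 + c * v⁻¹) ^ a) fun k => genBinom a k * c ^ k := by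
  intro N
  have ht : Tendsto (fun v : ℝ => c * v⁻¹) atTop (𝓝 0) := by
    simpa using tendsto_inv_atTop_zero.const_mul c
  refine (((isBigO_one_add_rpow_sub a N).comp_tendsto ht).trans ?_).congr_left fun v => ?_
  · simp only [Function.comp_def, mul_pow]
    exact (isBigO_refl _ _).const_mul_left _
  · simp [mul_pow, mul_assoc]

/-- The tail integral `∫_V^∞ v^m exp(b v - v²/κ) dv`. -/
def gaussTail (b κ m V : ℝ) : ℝ := ∫ v in Set.Ioi V, v ^ m * Real.exp (b * v - v ^ 2 / κ)

lemma integrableOn_gaussTail (b : ℝ) {κ : ℝ} (hκ : 0 < κ) (m : ℝ) {V : ℝ} (hV : 0 < V) :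
    IntegrableOn (fun v => v ^ m * Real.exp (b * v - v ^ 2 / κ)) (Set.Ioi V) := by
  refine integrable_of_isBigO_exp_neg (b := 1) one_pos ?_ ?_
  · refine ContinuousOn.mul (fun v hv => ?_) (by fun_prop)
    exact (Real.continuousAt_rpow_const v m (Or.inl (hV.trans_le hv).ne')).continuousWithinAt
  · have h1 : (fun v : ℝ => v ^ m) =O[atTop] Real.exp := by
      simpa using (isLittleO_rpow_exp_pos_mul_atTop m one_pos).isBigO
    refine (h1.mul (isBigO_refl _ _)).trans (IsBigO.of_bound 1 ?_)
    filter_upwards [eventually_ge_atTop (κ * (b + 2)), eventually_ge_atTop 0] with v hv hv0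
    rw [← Real.exp_add, Real.norm_of_nonneg (Real.exp_pos _).le,
      Real.norm_of_nonneg (Real.exp_pos _).le, one_mul, Real.exp_le_exp]
    have : (b + 2) * v ≤ v ^ 2 / κ := by
      rw [le_div_iff₀ hκ]; nlinarith
    linarith

lemma gaussTail_nonneg (b κ m : ℝ) {V : ℝ} (hV : 0 ≤ V) : 0 ≤ gaussTail b κ m V :=
  setIntegral_nonneg measurableSet_Ioi fun v hv => by
    have : 0 < v := hV.trans_lt hv
    positivity

/-- Integrating an expansion against `v^m exp(b v - v²/κ)`. -/
lemma isBigO_integral_sub (b : ℝ) {κ : ℝ} (hκ : 0 < κ) (m : ℝ) {F : ℝ → ℝ} (hFm : Measurable F)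
    {a : ℕ → ℝ} {K : ℕ}
    (hF : (fun v => F v - ∑ k ∈ range K, a k * v⁻¹ ^ k) =O[atTop] fun v => v⁻¹ ^ K) :
    (fun V => (∫ v in Set.Ioi V, v ^ m * Real.exp (b * v - v ^ 2 / κ) * F v) -
      ∑ k ∈ range K, a k * gaussTail b κ (m - k) V) =O[atTop] gaussTail b κ (m - K) := by
  obtain ⟨C, hC⟩ := hF.bound
  obtain ⟨V0, hV0⟩ := eventually_atTop.1 hC
  refine IsBigO.of_bound C ?_
  filter_upwards [eventually_ge_atTop V0, eventually_gt_atTop 0] with V hV hVpos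
  have hrw : ∀ k : ℕ, ∀ v ∈ Set.Ioi V, v ^ m * Real.exp (b * v - v ^ 2 / κ) * v⁻¹ ^ k =
      v ^ (m - k) * Real.exp (b * v - v ^ 2 / κ) := by
    intro k v hv
    have hv0 : 0 < v := hVpos.trans hv
    rw [Real.rpow_sub hv0, Real.rpow_natCast, inv_pow]; ring
  set E : ℝ → ℝ := fun v => v ^ m * Real.exp (b * v - v ^ 2 / κ) with hE
  have hEm : Measurable E := by fun_prop
  have hbd : ∀ v ∈ Set.Ioi V, ‖E v * (F v - ∑ k ∈ range K, a k * v⁻¹ ^ k)‖ ≤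
      C * (v ^ (m - K) * Real.exp (b * v - v ^ 2 / κ)) := by
    intro v hv
    have hv0 : 0 < v := hVpos.trans hv
    have h := hV0 v (hV.trans (le_of_lt hv))
    rw [Real.norm_of_nonneg (by positivity : (0:ℝ) ≤ v⁻¹ ^ K)] at h
    rw [norm_mul, Real.norm_of_nonneg (by simp only [hE]; positivity : 0 ≤ E v),
      ← hrw K v hv]
    calc E v * _ ≤ E v * (C * v⁻¹ ^ K) := by
          gcongr
      _ = _ := by simp only [hE]; ring
  have hi1 : IntegrableOn (fun v => E v * (F v - ∑ k ∈ range K, a k * v⁻¹ ^ k)) (Set.Ioi V) := by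
    refine Integrable.mono' ((integrableOn_gaussTail b hκ (m - K) hVpos).const_mul C) ?_ ?_
    · exact (hEm.mul (hFm.sub (by fun_prop))).aestronglyMeasurable
    · exact (ae_restrict_iff' measurableSet_Ioi).2 (ae_of_all _ hbd)
  have hi2 : ∀ k ∈ range K, IntegrableOn (fun v => a k * (E v * v⁻¹ ^ k)) (Set.Ioi V) := by
    intro k _
    refine Integrable.const_mul ?_ _
    exact (integrableOn_gaussTail b hκ (m - k) hVpos).congr_fun
      (fun v hv => (hrw k v hv).symm) measurableSet_Ioi
  have hsplit : (∫ v in Set.Ioi V, E v * F v) = (∫ v in Set.Ioi V, E v *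
      (F v - ∑ k ∈ range K, a k * v⁻¹ ^ k)) + ∑ k ∈ range K, a k * gaussTail b κ (m - k) V := by
    have : ∀ k ∈ range K, a k * gaussTail b κ (m - k) V =
        ∫ v in Set.Ioi V, a k * (E v * v⁻¹ ^ k) := by
      intro k _
      rw [integral_const_mul, gaussTail]
      congr 1
      exact setIntegral_congr_fun measurableSet_Ioi fun v hv => (hrw k v hv).symm
    rw [Finset.sum_congr rfl this, ← integral_finsetSum _ hi2, ← integral_add hi1
      (integrable_finsetSum _ hi2)]
    refine integral_congr_ae (ae_of_all _ fun v => ?_)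
    simp only [mul_sub, Finset.mul_sum]
    rw [Finset.sum_congr rfl fun k _ => by rw [mul_left_comm]]
    ring
  rw [hsplit, add_sub_cancel_right, Real.norm_of_nonneg (gaussTail_nonneg _ _ _ hVpos.le),
    gaussTail, ← integral_const_mul]
  exact norm_integral_le_of_norm_le ((integrableOn_gaussTail b hκ (m - K) hVpos).const_mul C)
    ((ae_restrict_iff' measurableSet_Ioi).2 (ae_of_all _ hbd))

/-- The normalised tail integral. -/
def nTail (b κ m V : ℝ) : ℝ :=
  gaussTail b κ m V / (κ / 2 * V ^ (m - 1) * Real.exp (b * V - V ^ 2 / κ))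

lemma gaussTail_eq (b m : ℝ) {κ V : ℝ} (hκ : 0 < κ) (hV : 0 < V) :
    gaussTail b κ m V = κ / 2 * V ^ (m - 1) * Real.exp (b * V - V ^ 2 / κ) * nTail b κ m V := by
  rw [nTail, mul_div_cancel₀]
  positivity

lemma gaussTail_zero_rec {κ : ℝ} (hκ : 0 < κ) (m : ℝ) {V : ℝ} (hV : 0 < V) :
    gaussTail 0 κ m V = κ / 2 * V ^ (m - 1) * Real.exp (-(V ^ 2 / κ)) +
      κ / 2 * (m - 1) * gaussTail 0 κ (m - 2) V := by
  have hd : ∀ v ∈ Set.Ioi V, HasDerivAt (fun v => -(κ / 2) * v ^ (m - 1) *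
      Real.exp (0 * v - v ^ 2 / κ)) (v ^ m * Real.exp (0 * v - v ^ 2 / κ) -
        κ / 2 * (m - 1) * (v ^ (m - 2) * Real.exp (0 * v - v ^ 2 / κ))) v := by
    intro v hv
    have hv0 : 0 < v := hV.trans hv
    have h1 := (Real.hasDerivAt_rpow_const (p := m - 1) (Or.inl hv0.ne')).const_mul (-(κ / 2))
    have h2 : HasDerivAt (fun v : ℝ => 0 * v - v ^ 2 / κ) (-(2 * v / κ)) v := by
      have := ((hasDerivAt_id v).const_mul 0).sub (((hasDerivAt_id v).pow 2).div_const κ)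
      refine this.congr_deriv ?_
      simp
    refine (h1.mul h2.exp).congr_deriv ?_
    have e1 : v ^ (m - 1 - 1) = v ^ (m - 2) := by ring_nf
    have e2 : v ^ (m - 1) * v = v ^ m := by
      rw [← Real.rpow_add_one hv0.ne']; ring_nf
    rw [e1, ← e2]
    field_simp
    ring
  have hi := (integrableOn_gaussTail 0 hκ m hV).sub
    ((integrableOn_gaussTail 0 hκ (m - 2) hV).const_mul (κ / 2 * (m - 1)))
  have hlim : Tendsto (fun v => -(κ / 2) * v ^ (m - 1) * Real.exp (0 * v - v ^ 2 / κ)) atTop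
      (𝓝 0) := by
    have h1 : (fun v : ℝ => v ^ (m - 1)) =o[atTop] Real.exp := by
      simpa using (isLittleO_rpow_exp_pos_mul_atTop (m - 1) one_pos)
    have h2 : (fun v : ℝ => Real.exp (0 * v - v ^ 2 / κ)) =O[atTop] fun v => Real.exp (-v) := by
      refine IsBigO.of_bound 1 ?_
      filter_upwards [eventually_ge_atTop κ] with v hv
      rw [Real.norm_of_nonneg (Real.exp_pos _).le,
        Real.norm_of_nonneg (Real.exp_pos _).le, one_mul, Real.exp_le_exp]
      have : v ≤ v ^ 2 / κ := by rw [le_div_iff₀ hκ]; nlinarith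
      linarith
    have h3 := (h1.mul_isBigO h2).const_mul_left (-(κ / 2))
    simp only [← Real.exp_add, add_neg_cancel, Real.exp_zero, ← mul_assoc] at h3
    exact (isLittleO_one_iff ℝ).1 h3
  have hc : ContinuousWithinAt (fun v => -(κ / 2) * v ^ (m - 1) * Real.exp (0 * v - v ^ 2 / κ))
      (Set.Ici V) V := by
    have := Real.continuousAt_rpow_const V (m - 1) (Or.inl hV.ne')
    refine ContinuousAt.continuousWithinAt ?_
    exact (this.const_mul _).mul (by fun_prop)
  have := integral_Ioi_of_hasDerivAt_of_tendsto hc hd hi hlim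
  rw [integral_sub (integrableOn_gaussTail 0 hκ m hV)
    ((integrableOn_gaussTail 0 hκ (m - 2) hV).const_mul (κ / 2 * (m - 1))),
    integral_const_mul] at this
  simp only [gaussTail]
  have e : (0 * V - V ^ 2 / κ) = -(V ^ 2 / κ) := by ring
  rw [e] at this
  linarith

lemma nTail_zero_rec {κ : ℝ} (hκ : 0 < κ) (m : ℝ) {V : ℝ} (hV : 0 < V) :
    nTail 0 κ m V = 1 + -κ * ((1 - m) / 2) * V⁻¹ ^ 2 * nTail 0 κ (m - 2) V := by
  have e : (0 * V - V ^ 2 / κ) = -(V ^ 2 / κ) := by ring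
  have e2 : V ^ (m - 1) = V ^ (m - 2 - 1) * V ^ 2 := by
    rw [← Real.rpow_natCast V 2, ← Real.rpow_add hV]; congr 1; push_cast; ring
  have hp : 0 < V ^ (m - 2 - 1) := by positivity
  have hE := Real.exp_pos (-(V ^ 2 / κ))
  rw [nTail, gaussTail_zero_rec hκ m hV, gaussTail_eq 0 (m - 2) hκ hV, e, e2]
  field_simp
  ring

lemma nTail_nonneg (b m : ℝ) {κ V : ℝ} (hκ : 0 < κ) (hV : 0 < V) : 0 ≤ nTail b κ m V :=
  div_nonneg (gaussTail_nonneg _ _ _ hV.le) (by positivity)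

lemma nTail_zero_isBigO {κ : ℝ} (hκ : 0 < κ) (m : ℝ) :
    nTail 0 κ m =O[atTop] fun _ => (1 : ℝ) := by
  obtain ⟨k, hk⟩ := exists_nat_ge ((m - 1) / 2)
  induction k generalizing m with
  | zero =>
    refine IsBigO.of_bound 1 ?_
    filter_upwards [eventually_gt_atTop 0] with V hV
    rw [Real.norm_of_nonneg (nTail_nonneg 0 m hκ hV), norm_one, one_mul,
      nTail_zero_rec hκ m hV]
    have h1 : 0 ≤ (1 - m) / 2 := by simp at hk; linarith
    have h2 : 0 ≤ nTail 0 κ (m - 2) V := nTail_nonneg 0 _ hκ hV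
    have : 0 ≤ κ * ((1 - m) / 2) * V⁻¹ ^ 2 * nTail 0 κ (m - 2) V := by positivity
    linarith
  | succ k ih =>
    have h := ih (m - 2) (by push_cast at hk; linarith)
    have h2 : (fun V => 1 + -κ * ((1 - m) / 2) * V⁻¹ ^ 2 * nTail 0 κ (m - 2) V) =O[atTop]
        fun _ => (1 : ℝ) := by
      refine (isBigO_refl _ _).add ?_
      have := ((isBigO_inv_pow_of_le (Nat.zero_le 2)).const_mul_left
        (-κ * ((1 - m) / 2))).mul h
      simpa using this
    refine h2.congr' ?_ EventuallyEq.rfl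
    filter_upwards [eventually_gt_atTop 0] with V hV
    rw [nTail_zero_rec hκ m hV]

lemma poch_succ_left (v : ℝ) (j : ℕ) : poch v (j + 1) = v * poch (v + 1) j := by
  simp only [poch, Finset.prod_range_succ']
  rw [mul_comm]
  congr 1
  · simp
  · refine Finset.prod_congr rfl fun t _ => by push_cast; ring

lemma poch_succ (v : ℝ) (j : ℕ) : poch v (j + 1) = poch v j * (v + j) := by
  simp only [poch, Finset.prod_range_succ]

lemma nTail_zero_sum {κ : ℝ} (hκ : 0 < κ) (m : ℝ) {V : ℝ} (hV : 0 < V) (J : ℕ) :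
    nTail 0 κ m V = ∑ j ∈ range J, (-κ) ^ j * poch ((1 - m) / 2) j * V⁻¹ ^ (2 * j) +
      (-κ) ^ J * poch ((1 - m) / 2) J * V⁻¹ ^ (2 * J) * nTail 0 κ (m - 2 * J) V := by
  induction J with
  | zero => simp [poch]
  | succ J ih =>
    rw [ih, nTail_zero_rec hκ (m - 2 * J) hV, Finset.sum_range_succ, poch_succ]
    have : m - 2 * J - 2 = m - 2 * (J + 1 : ℕ) := by push_cast; ring
    rw [this]
    push_cast
    ring

/-- The coefficients in the expansion of the shifted tail integral without linear term. -/
def shiftCoef (κ m δ : ℝ) (p : ℕ) : ℝ :=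
  ∑ j ∈ range (p + 1), if 2 * j ≤ p then
    (-κ) ^ j * poch ((1 - m) / 2) j * (genBinom (m - 1 - 2 * j) (p - 2 * j) *
      (-δ) ^ (p - 2 * j)) else 0

/-- Expansion of the shifted tail integral without linear term. -/
lemma hasExp_nTail_zero_shift {κ : ℝ} (hκ : 0 < κ) (m δ : ℝ) :
    HasExp (fun V => (1 + -δ * V⁻¹) ^ (m - 1) * nTail 0 κ m (V - δ)) (shiftCoef κ m δ) := by
  refine HasExp.of_shift (w := 2) (g := fun j V => (-κ) ^ j * poch ((1 - m) / 2) j *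
    (1 + -δ * V⁻¹) ^ (m - 1 - 2 * j)) (c := fun j q => (-κ) ^ j * poch ((1 - m) / 2) j *
      (genBinom (m - 1 - 2 * j) q * (-δ) ^ q)) (by norm_num) (fun K => ?_)
    fun j => (hasExp_one_add_div_rpow _ _).const_mul _
  have hsh : Tendsto (fun V : ℝ => V - δ) atTop atTop := tendsto_atTop_add_const_right _ (-δ) tendsto_id
  have hb : (fun V => (-κ) ^ K * poch ((1 - m) / 2) K * V⁻¹ ^ (2 * K) * ((1 + -δ * V⁻¹) ^
      (m - 1 - 2 * K) * nTail 0 κ (m - 2 * K) (V - δ))) =O[atTop] fun V : ℝ => V⁻¹ ^ K := by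
    have h1 := ((hasExp_one_add_div_rpow (m - 1 - 2 * K) (-δ)).isBigO_one).mul
      ((nTail_zero_isBigO hκ (m - 2 * K)).comp_tendsto hsh)
    have h2 := ((isBigO_inv_pow_of_le (show K ≤ 2 * K by omega)).const_mul_left
      ((-κ) ^ K * poch ((1 - m) / 2) K)).mul h1
    simpa [Function.comp_def] using h2
  refine hb.congr' ?_ EventuallyEq.rfl
  filter_upwards [eventually_gt_atTop 0, eventually_gt_atTop δ] with V hV hVδ
  have hpos : 0 < 1 + -δ * V⁻¹ := by
    have : 1 + -δ * V⁻¹ = (V - δ) * V⁻¹ := by field_simp; ring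
    rw [this]; exact mul_pos (by linarith) (by positivity)
  have hWV : (V - δ) = V * (1 + -δ * V⁻¹) := by field_simp; ring
  have hk : ∀ j : ℕ, (1 + -δ * V⁻¹) ^ (m - 1) * (V - δ)⁻¹ ^ (2 * j) =
      V⁻¹ ^ (2 * j) * (1 + -δ * V⁻¹) ^ (m - 1 - 2 * j) := by
    intro j
    have : (m - 1 - 2 * j) = (m - 1) - (2 * j : ℕ) := by push_cast; ring
    rw [this, Real.rpow_sub hpos (m - 1), Real.rpow_natCast, hWV, mul_inv, mul_pow, inv_pow, inv_pow]
    ring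
  rw [nTail_zero_sum hκ m (sub_pos.2 hVδ) K, mul_add, Finset.mul_sum]
  have e1 : ∀ j ∈ range K, (1 + -δ * V⁻¹) ^ (m - 1) * ((-κ) ^ j * poch ((1 - m) / 2) j *
      (V - δ)⁻¹ ^ (2 * j)) = V⁻¹ ^ (2 * j) * ((-κ) ^ j * poch ((1 - m) / 2) j *
        (1 + -δ * V⁻¹) ^ (m - 1 - 2 * j)) := by
    intro j _
    linear_combination ((-κ) ^ j * poch ((1 - m) / 2) j) * hk j
  rw [Finset.sum_congr rfl e1]
  linear_combination (-(-κ) ^ K * poch ((1 - m) / 2) K * nTail 0 κ (m - 2 * K) (V - δ)) * hk K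

/-- The coefficients in the expansion of the normalised tail integral. -/
def tailCoef (b κ m : ℝ) (p : ℕ) : ℝ :=
  ∑ k ∈ range (p + 1), if 1 * k ≤ p then
    genBinom m k * (b * κ / 2) ^ k * shiftCoef κ (m - k) (b * κ / 2) (p - 1 * k) else 0

lemma gaussTail_shift (b : ℝ) {κ : ℝ} (hκ : 0 < κ) (m : ℝ) {V : ℝ} (hV : b * κ / 2 < V)
    (hV0 : 0 < V) :
    gaussTail b κ m V = Real.exp ((b * κ / 2) ^ 2 / κ) * ∫ w in Set.Ioi (V - b * κ / 2),
      w ^ m * Real.exp (0 * w - w ^ 2 / κ) * (1 + b * κ / 2 * w⁻¹) ^ m := by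
  set δ := b * κ / 2 with hδ
  have hb : b = 2 * δ / κ := by rw [hδ]; field_simp
  have h1 := (measurePreserving_add_right volume δ).setIntegral_preimage_emb
    (measurableEmbedding_addRight δ) (fun v => v ^ m * Real.exp (b * v - v ^ 2 / κ)) (Set.Ioi V)
  rw [Set.preimage_add_const_Ioi] at h1
  rw [gaussTail, ← h1, ← integral_const_mul]
  refine setIntegral_congr_fun measurableSet_Ioi fun w hw => ?_
  have hw0 : 0 < w := (sub_pos.2 hV).trans hw
  have hwδ : 0 < w + δ := by
    have : V - δ < w := hw
    linarith
  have e1 : 1 + δ * w⁻¹ = (w + δ) / w := by field_simp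
  have e2 : b * (w + δ) - (w + δ) ^ 2 / κ = δ ^ 2 / κ + (0 * w - w ^ 2 / κ) := by
    rw [hb]; field_simp; ring
  have hp : 0 < w ^ m := by positivity
  rw [e1, Real.div_rpow hwδ.le hw0.le, e2, Real.exp_add]
  field_simp

lemma hasExp_nTail (b : ℝ) {κ : ℝ} (hκ : 0 < κ) (m : ℝ) :
    HasExp (nTail b κ m) (tailCoef b κ m) := by
  set δ := b * κ / 2 with hδ
  have hb : b = 2 * δ / κ := by rw [hδ]; field_simp
  have hsh : Tendsto (fun V : ℝ => V - δ) atTop atTop :=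
    tendsto_atTop_add_const_right _ (-δ) tendsto_id
  refine HasExp.of_shift (w := 1) (g := fun k V => genBinom m k * δ ^ k *
    ((1 + -δ * V⁻¹) ^ (m - k - 1) * nTail 0 κ (m - k) (V - δ)))
    (c := fun k q => genBinom m k * δ ^ k * shiftCoef κ (m - k) δ q) le_rfl (fun K => ?_)
    fun k => (hasExp_nTail_zero_shift hκ (m - k) δ).const_mul _
  have hmeas : Measurable fun w : ℝ => (1 + δ * w⁻¹) ^ m := by fun_prop
  have h1 := (isBigO_integral_sub 0 hκ m hmeas (hasExp_one_add_div_rpow m δ K)).comp_tendsto hsh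
  have h2 := h1.mul (isBigO_refl (fun V => (κ / 2 * V ^ (m - 1) *
    Real.exp (0 * (V - δ) - (V - δ) ^ 2 / κ))⁻¹) atTop)
  have hk : ∀ V, 0 < V → δ < V → ∀ k : ℕ, gaussTail 0 κ (m - k) (V - δ) *
      (κ / 2 * V ^ (m - 1) * Real.exp (0 * (V - δ) - (V - δ) ^ 2 / κ))⁻¹ =
      V⁻¹ ^ (1 * k) * ((1 + -δ * V⁻¹) ^ (m - k - 1) * nTail 0 κ (m - k) (V - δ)) := by
    intro V hV hVδ k
    have hW : 0 < V - δ := sub_pos.2 hVδ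
    have e1 : 1 + -δ * V⁻¹ = (V - δ) / V := by field_simp; ring
    have e2 : V ^ (m - 1) = V ^ (m - k - 1) * V ^ k := by
      rw [← Real.rpow_natCast V k, ← Real.rpow_add hV]; congr 1; ring
    have hp : 0 < V ^ (m - k - 1) := by positivity
    rw [gaussTail_eq 0 (m - k) hκ hW, e1, Real.div_rpow hW.le hV.le, e2, one_mul, inv_pow]
    have hE := Real.exp_pos (0 * (V - δ) - (V - δ) ^ 2 / κ)
    generalize Real.exp (0 * (V - δ) - (V - δ) ^ 2 / κ) = E at *
    field_simp
  have h3 : (fun V => gaussTail 0 κ (m - K) (V - δ) * (κ / 2 * V ^ (m - 1) *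
      Real.exp (0 * (V - δ) - (V - δ) ^ 2 / κ))⁻¹) =O[atTop] fun V => V⁻¹ ^ K := by
    have h4 := (isBigO_refl (fun V : ℝ => V⁻¹ ^ K) atTop).mul
      ((hasExp_nTail_zero_shift hκ (m - K) δ).isBigO_one)
    simp only [mul_one] at h4
    refine h4.congr' ?_ EventuallyEq.rfl
    filter_upwards [eventually_gt_atTop 0, eventually_gt_atTop δ] with V hV hVδ
    rw [hk V hV hVδ K, one_mul]
  refine (h2.trans h3).congr' ?_ EventuallyEq.rfl
  filter_upwards [eventually_gt_atTop 0, eventually_gt_atTop δ] with V hV hVδ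
  simp only [Function.comp_def]
  rw [sub_mul, Finset.sum_mul]
  congr 1
  · rw [nTail, gaussTail_shift b hκ m hVδ hV, ← hδ]
    have e2 : b * V - V ^ 2 / κ = δ ^ 2 / κ + (0 * (V - δ) - (V - δ) ^ 2 / κ) := by
      rw [hb]; field_simp; ring
    rw [e2, Real.exp_add]
    have hE := Real.exp_pos (δ ^ 2 / κ)
    have hE' := Real.exp_pos (0 * (V - δ) - (V - δ) ^ 2 / κ)
    generalize Real.exp (0 * (V - δ) - (V - δ) ^ 2 / κ) = E at *
    generalize Real.exp (δ ^ 2 / κ) = E' at *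
    have hp : 0 < V ^ (m - 1) := by positivity
    field_simp
  · refine Finset.sum_congr rfl fun k _ => ?_
    rw [mul_assoc, hk V hV hVδ k]
    ring

/-- Expansion of the tail integral of a function that has itself an expansion. -/
lemma hasExp_integral (b : ℝ) {κ : ℝ} (hκ : 0 < κ) (m : ℝ) {F : ℝ → ℝ} (hFm : Measurable F)
    {c : ℕ → ℝ} (hF : HasExp F c) :
    HasExp (fun V => (∫ v in Set.Ioi V, v ^ m * Real.exp (b * v - v ^ 2 / κ) * F v) /
      (κ / 2 * V ^ (m - 1) * Real.exp (b * V - V ^ 2 / κ))) fun p =>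
      ∑ l ∈ range (p + 1), if 1 * l ≤ p then c l * tailCoef b κ (m - l) (p - 1 * l) else 0 := by
  refine HasExp.of_shift (w := 1) (g := fun k V => c k * nTail b κ (m - k) V)
    (c := fun k q => c k * tailCoef b κ (m - k) q) le_rfl (fun K => ?_)
    fun k => (hasExp_nTail b hκ (m - k)).const_mul _
  have h2 := (isBigO_integral_sub b hκ m hFm (hF K)).mul (isBigO_refl (fun V => (κ / 2 *
    V ^ (m - 1) * Real.exp (b * V - V ^ 2 / κ))⁻¹) atTop)
  have hk : ∀ V, 0 < V → ∀ k : ℕ, gaussTail b κ (m - k) V *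
      (κ / 2 * V ^ (m - 1) * Real.exp (b * V - V ^ 2 / κ))⁻¹ =
      V⁻¹ ^ (1 * k) * nTail b κ (m - k) V := by
    intro V hV k
    have e2 : V ^ (m - 1) = V ^ (m - k - 1) * V ^ k := by
      rw [← Real.rpow_natCast V k, ← Real.rpow_add hV]; congr 1; ring
    have hp : 0 < V ^ (m - k - 1) := by positivity
    rw [gaussTail_eq b (m - k) hκ hV, e2, one_mul, inv_pow]
    have hE := Real.exp_pos (b * V - V ^ 2 / κ)
    generalize Real.exp (b * V - V ^ 2 / κ) = E at *
    field_simp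
  have h3 : (fun V => gaussTail b κ (m - K) V * (κ / 2 * V ^ (m - 1) *
      Real.exp (b * V - V ^ 2 / κ))⁻¹) =O[atTop] fun V => V⁻¹ ^ K := by
    have h4 := (isBigO_refl (fun V : ℝ => V⁻¹ ^ K) atTop).mul
      ((hasExp_nTail b hκ (m - K)).isBigO_one)
    simp only [mul_one] at h4
    refine h4.congr' ?_ EventuallyEq.rfl
    filter_upwards [eventually_gt_atTop 0] with V hV
    rw [hk V hV K, one_mul]
  refine (h2.trans h3).congr' ?_ EventuallyEq.rfl
  filter_upwards [eventually_gt_atTop 0] with V hV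
  rw [sub_mul, Finset.sum_mul, div_eq_mul_inv (∫ v in Set.Ioi V, _)]
  congr 1
  refine Finset.sum_congr rfl fun k _ => ?_
  rw [mul_assoc, hk V hV k]
  ring

/-- The function `(√(1+τ) - 1)/τ`, written without division by `τ`. -/
def sqrtQuot (τ : ℝ) : ℝ := (1 + Real.sqrt (1 + τ))⁻¹

lemma sqrtQuot_pos (τ : ℝ) : 0 < sqrtQuot τ := by
  have := Real.sqrt_nonneg (1 + τ)
  unfold sqrtQuot; positivity

lemma sqrtQuot_le_one (τ : ℝ) : sqrtQuot τ ≤ 1 := by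
  have := Real.sqrt_nonneg (1 + τ)
  exact inv_le_one_of_one_le₀ (by linarith)

@[fun_prop]
lemma measurable_sqrtQuot : Measurable sqrtQuot := by unfold sqrtQuot; fun_prop

/-- The sum over `r : Fin m → ℕ` with total `k` of `∏ binom(1/2, 1 + r_t)`. -/
def compT (m k : ℕ) : ℝ :=
  ∑ r ∈ Finset.Nat.antidiagonalTuple m k, ∏ t, genBinom (1 / 2) (1 + r t)

lemma compT_succ (m k : ℕ) :
    compT (m + 1) k = ∑ i ∈ range (k + 1), genBinom (1 / 2) (1 + i) * compT m (k - i) := by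
  rw [← Finset.Nat.sum_antidiagonal_eq_sum_range_succ
    (f := fun i j => genBinom (1 / 2) (1 + i) * compT m j)]
  simp only [compT, Finset.mul_sum]
  rw [Finset.sum_sigma']
  symm
  refine Finset.sum_bij' (fun x _ => Fin.cons x.1.1 x.2) (fun r _ => ⟨(r 0, k - r 0), Fin.tail r⟩)
    ?_ ?_ ?_ ?_ ?_
  · rintro ⟨⟨i, j⟩, r⟩ h
    simp only [Finset.mem_sigma, HasAntidiagonal.mem_antidiagonal,
      Finset.Nat.mem_antidiagonalTuple] at h ⊢
    rw [Fin.sum_univ_succ]; simp [h.2, h.1]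
  · intro r h
    simp only [Finset.mem_sigma, HasAntidiagonal.mem_antidiagonal,
      Finset.Nat.mem_antidiagonalTuple] at h ⊢
    rw [Fin.sum_univ_succ] at h
    simp only [Fin.tail]
    omega
  · rintro ⟨⟨i, j⟩, r⟩ h
    simp only [Finset.mem_sigma, HasAntidiagonal.mem_antidiagonal] at h
    have : k - i = j := by omega
    simp [this]
  · intro r _; simp
  · rintro ⟨⟨i, j⟩, r⟩ _
    rw [Fin.prod_univ_succ]; simp

lemma hasExp_sqrtQuot : HasExp (fun v => sqrtQuot v⁻¹) fun k => genBinom (1 / 2) (1 + k) := by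
  intro N
  have h := hasExp_one_add_div_rpow (1 / 2) 1 (N + 1)
  have h2 := (isBigO_refl (fun v : ℝ => v) atTop).mul h
  refine h2.congr' ?_ ?_
  · filter_upwards [eventually_gt_atTop 0] with v hv
    rw [Finset.sum_range_succ', ← Real.sqrt_eq_rpow, sqrtQuot]
    have hs : Real.sqrt (1 + v⁻¹) ^ 2 = 1 + v⁻¹ := Real.sq_sqrt (by positivity)
    have hs0 := Real.sqrt_nonneg (1 + v⁻¹)
    have e0 : genBinom (1 / 2) 0 = 1 := by simp [genBinom]
    have e1 : v * ∑ k ∈ range N, genBinom (1 / 2) (k + 1) * 1 ^ (k + 1) * v⁻¹ ^ (k + 1) =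
        ∑ k ∈ range N, genBinom (1 / 2) (1 + k) * v⁻¹ ^ k := by
      rw [Finset.mul_sum]
      refine Finset.sum_congr rfl fun k _ => ?_
      rw [pow_succ v⁻¹, add_comm 1 k]; field_simp; ring
    rw [e0, mul_sub, mul_add, e1, one_mul]
    have e2 : v * (Real.sqrt (1 + v⁻¹) - 1) = (1 + Real.sqrt (1 + v⁻¹))⁻¹ := by
      refine eq_inv_of_mul_eq_one_left ?_
      linear_combination v * hs + mul_inv_cancel₀ hv.ne'
    rw [← e2]; simp; ring
  · filter_upwards [eventually_gt_atTop 0] with v hv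
    rw [pow_succ]; field_simp

lemma hasExp_sqrtQuot_pow (m : ℕ) : HasExp (fun v => sqrtQuot v⁻¹ ^ m) (compT m) := by
  induction m with
  | zero =>
    have e : compT 0 = fun k => if k = 0 then 1 else 0 := by
      ext k; cases k <;> simp [compT]
    simpa [e] using hasExp_one
  | succ m ih =>
    convert hasExp_sqrtQuot.mul ih using 2 with v k
    · rw [pow_succ']
    · exact compT_succ m k

/-- Coefficients of `(1+τ)^a ((√(1+τ)-1)/τ)^m`. -/
def quotCoef (a : ℝ) (m k : ℕ) : ℝ := ∑ p ∈ range (k + 1), genBinom a p * compT m (k - p)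

lemma hasExp_quot (a : ℝ) (m : ℕ) :
    HasExp (fun v => (1 + v⁻¹) ^ a * sqrtQuot v⁻¹ ^ m) (quotCoef a m) := by
  have h := (hasExp_one_add_div_rpow a 1).mul (hasExp_sqrtQuot_pow m)
  simp only [one_mul, one_pow, mul_one] at h
  exact h

lemma one_add_rpow_le {τ a : ℝ} {A : ℕ} (hτ : 0 ≤ τ) (hA : a ≤ A) : (1 + τ) ^ a ≤ (1 + τ) ^ A := by
  rw [← Real.rpow_natCast]
  exact Real.rpow_le_rpow_of_exponent_le (by linarith) hA

lemma exists_quot_bound (a : ℝ) (m Q : ℕ) {A : ℕ} (hA : a ≤ A) :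
    ∃ C, 0 ≤ C ∧ ∀ τ : ℝ, 0 < τ → |(1 + τ) ^ a * sqrtQuot τ ^ m -
      ∑ k ∈ range Q, quotCoef a m k * τ ^ k| ≤ C * τ ^ Q * (1 + τ) ^ A := by
  obtain ⟨C, hC0, hC⟩ := (hasExp_quot a m Q).exists_nonneg
  obtain ⟨V, hV⟩ := eventually_atTop.1 hC.bound
  set W := max V 1 with hW
  have hW1 : 1 ≤ W := le_max_right _ _
  have hW0 : 0 < W := by linarith
  refine ⟨C + W ^ Q + ∑ k ∈ range Q, |quotCoef a m k| * W ^ Q, by positivity, fun τ hτ => ?_⟩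
  have h1A : 1 ≤ (1 + τ) ^ A := one_le_pow₀ (by linarith)
  have hS0 : 0 ≤ ∑ k ∈ range Q, |quotCoef a m k| * W ^ Q :=
    Finset.sum_nonneg fun k _ => by positivity
  have hτQ : 0 ≤ τ ^ Q := by positivity
  by_cases h : W ≤ τ⁻¹
  · have := hV τ⁻¹ ((le_max_left _ _).trans h)
    simp only [inv_inv] at this
    rw [Real.norm_eq_abs, Real.norm_of_nonneg hτQ] at this
    refine this.trans ?_
    calc C * τ ^ Q ≤ C * τ ^ Q * (1 + τ) ^ A := le_mul_of_one_le_right (by positivity) h1A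
      _ ≤ _ := by gcongr; linarith [pow_pos hW0 Q]
  · have hWτ : 1 ≤ W * τ := by
      have : τ⁻¹ < W := not_le.1 h
      have := mul_lt_mul_of_pos_right this hτ
      rw [inv_mul_cancel₀ hτ.ne'] at this
      exact this.le
    have hWQ : 1 ≤ W ^ Q * τ ^ Q := by rw [← mul_pow]; exact one_le_pow₀ hWτ
    have b1 : |(1 + τ) ^ a * sqrtQuot τ ^ m| ≤ W ^ Q * τ ^ Q * (1 + τ) ^ A := by
      have hs := sqrtQuot_pos τ
      rw [abs_of_nonneg (by positivity)]
      calc (1 + τ) ^ a * sqrtQuot τ ^ m ≤ (1 + τ) ^ A * 1 := by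
            gcongr
            · exact one_add_rpow_le hτ.le hA
            · exact pow_le_one₀ hs.le (sqrtQuot_le_one τ)
        _ ≤ _ := by rw [mul_comm]; gcongr
    have b2 : |∑ k ∈ range Q, quotCoef a m k * τ ^ k| ≤
        (∑ k ∈ range Q, |quotCoef a m k| * W ^ Q) * τ ^ Q * (1 + τ) ^ A := by
      refine (Finset.abs_sum_le_sum_abs _ _).trans ?_
      rw [Finset.sum_mul, Finset.sum_mul]
      refine Finset.sum_le_sum fun k hk => ?_
      rw [abs_mul, abs_of_nonneg (by positivity : 0 ≤ τ ^ k)]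
      have : τ ^ k ≤ W ^ Q * τ ^ Q := by
        have hkQ : k ≤ Q := (Finset.mem_range.1 hk).le
        calc τ ^ k ≤ (W ^ k * τ ^ k) := le_mul_of_one_le_left (by positivity) (one_le_pow₀ hW1)
          _ = (W * τ) ^ k := (mul_pow _ _ _).symm
          _ ≤ (W * τ) ^ Q := pow_le_pow_right₀ hWτ hkQ
          _ = _ := mul_pow _ _ _
      calc |quotCoef a m k| * τ ^ k ≤ |quotCoef a m k| * (W ^ Q * τ ^ Q) := by gcongr
        _ ≤ |quotCoef a m k| * (W ^ Q * τ ^ Q) * (1 + τ) ^ A :=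
            le_mul_of_one_le_right (by positivity) h1A
        _ = _ := by ring
    refine (abs_sub _ _).trans ((add_le_add b1 b2).trans ?_)
    have : 0 ≤ C * τ ^ Q * (1 + τ) ^ A := by positivity
    linarith

lemma puiseuxG_eq {a b : ℝ} {i p : ℕ} (h1 : p ≤ 2 * i) (h2 : i ≤ p) :
    puiseuxG a b i p = b ^ (2 * i - p) / (2 * i - p).factorial * quotCoef a (2 * i - p) (p - i) := by
  rw [puiseuxG, if_pos h1, quotCoef, Finset.mul_sum]
  refine Finset.sum_congr rfl fun q hq => ?_
  have hq' := Finset.mem_range.1 hq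
  rw [compS, if_pos (by omega), compT, show i - q - (2 * i - p) = p - i - q by omega]
  ring

lemma sum_quotCoef_eq_sum_puiseuxG (a b : ℝ) (M : ℕ → ℝ) (p : ℕ) :
    (∑ m ∈ range (p + 1), if 1 * m ≤ p then b ^ m / m.factorial *
      ∑ k ∈ range (p - 1 * m + 1), (if 2 * k ≤ p - 1 * m then
        quotCoef a m k * M (m + k) * (if p - 1 * m - 2 * k = 0 then 1 else 0) else 0) else 0) =
      ∑ i ∈ Icc ((p + 1) / 2) p, puiseuxG a b i p * M i := by
  have e1 : (∑ m ∈ range (p + 1), if 1 * m ≤ p then b ^ m / m.factorial *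
      ∑ k ∈ range (p - 1 * m + 1), (if 2 * k ≤ p - 1 * m then
        quotCoef a m k * M (m + k) * (if p - 1 * m - 2 * k = 0 then 1 else 0) else 0) else 0) =
      ∑ x ∈ ((range (p + 1)) ×ˢ (range (p + 1))).filter (fun x => x.1 + 2 * x.2 = p),
        b ^ x.1 / x.1.factorial * quotCoef a x.1 x.2 * M (x.1 + x.2) := by
    rw [Finset.sum_filter, Finset.sum_product]
    refine Finset.sum_congr rfl fun m hm => ?_
    have hm' := Finset.mem_range.1 hm
    rw [if_pos (by omega), Finset.mul_sum]
    have hsub : range (p - 1 * m + 1) ⊆ range (p + 1) := Finset.range_subset_range.2 (by omega)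
    refine (Finset.sum_subset hsub ?_).trans (Finset.sum_congr rfl fun k hk => ?_)
    · intro k _ hk
      have : ¬ k < p - 1 * m + 1 := fun h => hk (Finset.mem_range.2 h)
      rw [if_neg (by omega), mul_zero]
    · by_cases h : m + 2 * k = p
      · rw [if_pos (by omega), if_pos (by omega), if_pos h]; ring
      · rw [if_neg h]
        split_ifs with h1 h2
        · omega
        · ring
        · ring
  rw [e1]
  refine Finset.sum_nbij' (fun x => x.1 + x.2) (fun i => (2 * i - p, p - i)) ?_ ?_ ?_ ?_ ?_
  · rintro ⟨m, k⟩ h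
    simp only [Finset.mem_filter, Finset.mem_product, Finset.mem_range, Finset.mem_Icc] at h ⊢
    omega
  · intro i h
    simp only [Finset.mem_filter, Finset.mem_product, Finset.mem_range, Finset.mem_Icc] at h ⊢
    omega
  · rintro ⟨m, k⟩ h
    simp only [Finset.mem_filter, Finset.mem_product, Finset.mem_range, Prod.mk.injEq] at h ⊢
    omega
  · intro i h
    simp only [Finset.mem_Icc] at h ⊢
    omega
  · rintro ⟨m, k⟩ h
    simp only [Finset.mem_filter, Finset.mem_product, Finset.mem_range] at h ⊢
    rw [puiseuxG_eq (by omega) (by omega), show 2 * (m + k) - p = m by omega,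
      show p - (m + k) = k by omega]

section Laplace

variable {Ω : Type*} [MeasurableSpace Ω] {χ : Measure Ω} {wt u : Ω → ℝ} {b : ℝ}

lemma integrable_and_abs_integral_le {F G : Ω → ℝ} {C : ℝ} (hF : Measurable F)
    (hG : Integrable G χ) (h : ∀ᵐ q ∂χ, |F q| ≤ C * G q) :
    Integrable F χ ∧ |∫ q, F q ∂χ| ≤ C * ∫ q, G q ∂χ := by
  refine ⟨(hG.const_mul C).mono' hF.aestronglyMeasurable h, ?_⟩
  rw [← integral_const_mul]
  exact norm_integral_le_of_norm_le (f := F) (hG.const_mul C) h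

lemma one_add_mul_inv_sq_rpow_le {x v a : ℝ} {A : ℕ} (hA : a ≤ A) (hx : 0 ≤ x) (hv : 1 ≤ v) :
    (1 + x * v⁻¹ ^ 2) ^ a ≤ (1 + x) ^ A := by
  have hv' : v⁻¹ ^ 2 ≤ 1 := pow_le_one₀ (by positivity) (inv_le_one_of_one_le₀ hv)
  refine (one_add_rpow_le (by positivity) hA).trans ?_
  gcongr
  exact mul_le_of_le_one_right hx hv'

/-- The moment integrals `∫ wt u^m (1+u v⁻²)^a sqrtQuot(u v⁻²)^m`. -/
def quotMoment (χ : Measure Ω) (wt u : Ω → ℝ) (a : ℝ) (m : ℕ) (v : ℝ) : ℝ :=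
  ∫ q, wt q * (u q ^ m * ((1 + u q * v⁻¹ ^ 2) ^ a * sqrtQuot (u q * v⁻¹ ^ 2) ^ m)) ∂χ

variable (hb : 0 ≤ b) (hwm : Measurable wt) (hum : Measurable u) (hw : ∀ q, 0 ≤ wt q)
  (hu : ∀ᵐ q ∂χ, 0 < u q)
  (hint : ∀ i : ℕ, Integrable (fun q => wt q * (1 + u q) ^ i * Real.exp (b * Real.sqrt (u q))) χ)
include hb hwm hum hw hu hint

lemma integrable_moment (i : ℕ) : Integrable (fun q => wt q * u q ^ i) χ := by
  refine (integrable_and_abs_integral_le (C := 1) (by fun_prop) (hint i) ?_).1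
  filter_upwards [hu] with q hq
  have := hw q
  rw [abs_of_nonneg (by positivity), one_mul]
  calc wt q * u q ^ i ≤ wt q * (1 + u q) ^ i := by gcongr; linarith
    _ ≤ _ := le_mul_of_one_le_right (by positivity) (Real.one_le_exp (by positivity))

lemma integrable_quotMoment (a : ℝ) (m : ℕ) {v : ℝ} (hv : 1 ≤ v) :
    Integrable (fun q => wt q * (u q ^ m *
      ((1 + u q * v⁻¹ ^ 2) ^ a * sqrtQuot (u q * v⁻¹ ^ 2) ^ m))) χ := by
  obtain ⟨A, hA⟩ := exists_nat_ge a
  refine (integrable_and_abs_integral_le (C := 1) (by fun_prop) (hint (m + A)) ?_).1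
  filter_upwards [hu] with q hq
  have h0 := hw q
  have hs := sqrtQuot_pos (u q * v⁻¹ ^ 2)
  have h1 : 0 ≤ (1 + u q * v⁻¹ ^ 2) ^ a := by positivity
  rw [abs_of_nonneg (by positivity), one_mul]
  calc wt q * (u q ^ m * ((1 + u q * v⁻¹ ^ 2) ^ a * sqrtQuot (u q * v⁻¹ ^ 2) ^ m))
      ≤ wt q * ((1 + u q) ^ m * ((1 + u q) ^ A * 1)) := by
        gcongr
        · linarith
        · exact one_add_mul_inv_sq_rpow_le hA hq.le hv
        · exact pow_le_one₀ hs.le (sqrtQuot_le_one _)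
    _ = wt q * (1 + u q) ^ (m + A) := by ring
    _ ≤ _ := le_mul_of_one_le_right (by positivity) (Real.one_le_exp (by positivity))

lemma hasExp_quotMoment (a : ℝ) (m : ℕ) :
    HasExp (quotMoment χ wt u a m) fun p => ∑ k ∈ range (p + 1),
      if 2 * k ≤ p then quotCoef a m k * (∫ q, wt q * u q ^ (m + k) ∂χ) *
        (if p - 2 * k = 0 then 1 else 0) else 0 := by
  obtain ⟨A, hA⟩ := exists_nat_ge a
  refine HasExp.of_shift (w := 2)
    (g := fun k _ => quotCoef a m k * (∫ q, wt q * u q ^ (m + k) ∂χ) * 1)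
    (c := fun k p => quotCoef a m k * (∫ q, wt q * u q ^ (m + k) ∂χ) * (if p = 0 then 1 else 0))
    (by norm_num) (fun K => ?_) (fun k => hasExp_one.const_mul _)
  obtain ⟨C, hC0, hC⟩ := exists_quot_bound a m K hA
  refine IsBigO.trans ?_ (isBigO_inv_pow_of_le (Nat.le_mul_of_pos_left K two_pos))
  refine IsBigO.of_bound (C * ∫ q, wt q * (1 + u q) ^ (m + K + A) *
    Real.exp (b * Real.sqrt (u q)) ∂χ) ?_
  filter_upwards [eventually_ge_atTop 1] with v hv
  have hv0 : 0 ≤ v⁻¹ := by positivity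
  rw [Real.norm_eq_abs, Real.norm_of_nonneg (by positivity)]
  have e : quotMoment χ wt u a m v - ∑ k ∈ range K, v⁻¹ ^ (2 * k) *
      (quotCoef a m k * (∫ q, wt q * u q ^ (m + k) ∂χ) * 1) =
      ∫ q, (wt q * (u q ^ m * ((1 + u q * v⁻¹ ^ 2) ^ a * sqrtQuot (u q * v⁻¹ ^ 2) ^ m)) -
        ∑ k ∈ range K, v⁻¹ ^ (2 * k) * quotCoef a m k * (wt q * u q ^ (m + k))) ∂χ := by
    have hi := integrable_moment hb hwm hum hw hu hint
    rw [integral_sub (integrable_quotMoment hb hwm hum hw hu hint a m hv)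
      (integrable_finsetSum _ fun k _ => (hi (m + k)).const_mul _),
      integral_finsetSum _ fun k _ => (hi (m + k)).const_mul _]
    simp only [integral_const_mul, quotMoment]
    congr 1
    exact Finset.sum_congr rfl fun k _ => by ring
  rw [e]
  have key := (integrable_and_abs_integral_le (χ := χ) (C := C * v⁻¹ ^ (2 * K))
    (F := fun q => wt q * (u q ^ m *
      ((1 + u q * v⁻¹ ^ 2) ^ a * sqrtQuot (u q * v⁻¹ ^ 2) ^ m)) -
        ∑ k ∈ range K, v⁻¹ ^ (2 * k) * quotCoef a m k * (wt q * u q ^ (m + k)))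
    (by fun_prop) (hint (m + K + A)) ?_).2
  · refine key.trans (le_of_eq (by ring))
  · filter_upwards [hu] with q hq
    have h0 := hw q
    have hτ : 0 < u q * v⁻¹ ^ 2 := by positivity
    have hb1 : (1 + u q * v⁻¹ ^ 2) ^ A ≤ (1 + u q) ^ A := by
      have := one_add_mul_inv_sq_rpow_le (a := A) (A := A) le_rfl hq.le hv
      rwa [Real.rpow_natCast] at this
    have e2 : wt q * (u q ^ m * ((1 + u q * v⁻¹ ^ 2) ^ a * sqrtQuot (u q * v⁻¹ ^ 2) ^ m)) -
        ∑ k ∈ range K, v⁻¹ ^ (2 * k) * quotCoef a m k * (wt q * u q ^ (m + k)) =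
        wt q * u q ^ m * ((1 + u q * v⁻¹ ^ 2) ^ a * sqrtQuot (u q * v⁻¹ ^ 2) ^ m -
          ∑ k ∈ range K, quotCoef a m k * (u q * v⁻¹ ^ 2) ^ k) := by
      rw [mul_sub, Finset.mul_sum, mul_assoc]
      congr 1
      exact Finset.sum_congr rfl fun k _ => by rw [pow_add, mul_pow, pow_mul]; ring
    rw [e2, abs_mul, abs_of_nonneg (by positivity)]
    calc _ ≤ wt q * (1 + u q) ^ m *
          (C * ((1 + u q) * v⁻¹ ^ 2) ^ K * (1 + u q) ^ A) := by
          gcongr ?_ * ?_ * ?_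
          · exact pow_le_pow_left₀ hq.le (by linarith) _
          · refine (hC _ hτ).trans ?_
            gcongr
            linarith
      _ = C * v⁻¹ ^ (2 * K) * (wt q * (1 + u q) ^ (m + K + A)) := by
          rw [mul_pow, ← pow_mul]; ring
      _ ≤ _ := by
          refine mul_le_mul_of_nonneg_left ?_ (by positivity)
          exact le_mul_of_one_le_right (by positivity) (Real.one_le_exp (by positivity))

lemma hasExp_expMoment_aux (a : ℝ) :
    HasExp (fun v => ∫ q, wt q * ((1 + u q * v⁻¹ ^ 2) ^ a *
      Real.exp (b * (u q * v⁻¹ * sqrtQuot (u q * v⁻¹ ^ 2)))) ∂χ)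
      fun p => ∑ m ∈ range (p + 1), if 1 * m ≤ p then b ^ m / m.factorial *
        ∑ k ∈ range (p - 1 * m + 1), (if 2 * k ≤ p - 1 * m then
          quotCoef a m k * (∫ q, wt q * u q ^ (m + k) ∂χ) *
          (if p - 1 * m - 2 * k = 0 then 1 else 0) else 0) else 0 := by
  obtain ⟨A, hA⟩ := exists_nat_ge a
  have hm := hasExp_quotMoment hb hwm hum hw hu hint a
  refine HasExp.of_shift (w := 1)
    (g := fun m v => b ^ m / m.factorial * quotMoment χ wt u a m v)
    (c := fun m p => b ^ m / m.factorial * ∑ k ∈ range (p + 1), (if 2 * k ≤ p then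
          quotCoef a m k * (∫ q, wt q * u q ^ (m + k) ∂χ) *
          (if p - 2 * k = 0 then 1 else 0) else 0))
    le_rfl (fun K => ?_) (fun m => (hm m).const_mul _)
  refine IsBigO.of_bound (b ^ K * ∫ q, wt q * (1 + u q) ^ (A + K) *
    Real.exp (b * Real.sqrt (u q)) ∂χ) ?_
  filter_upwards [eventually_ge_atTop 1] with v hv
  have hv0 : 0 ≤ v⁻¹ := by positivity
  have hv1 : v⁻¹ ≤ 1 := inv_le_one_of_one_le₀ hv
  have hvv : v * v⁻¹ = 1 := mul_inv_cancel₀ (by positivity)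
  have hx : ∀ᵐ q ∂χ, b * (u q * v⁻¹ * sqrtQuot (u q * v⁻¹ ^ 2)) ≤ b * Real.sqrt (u q) := by
    filter_upwards [hu] with q hq
    gcongr
    rw [sqrtQuot, ← div_eq_mul_inv, div_le_iff₀ (by positivity)]
    have h1 : Real.sqrt (u q) * v⁻¹ ≤ Real.sqrt (1 + u q * v⁻¹ ^ 2) := by
      refine Real.le_sqrt_of_sq_le ?_
      rw [mul_pow, Real.sq_sqrt hq.le]; linarith
    have h2 : u q * v⁻¹ = Real.sqrt (u q) * (Real.sqrt (u q) * v⁻¹) := by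
      rw [← mul_assoc, Real.mul_self_sqrt hq.le]
    rw [h2]
    gcongr
    linarith
  have hE : Integrable (fun q => wt q * ((1 + u q * v⁻¹ ^ 2) ^ a *
      Real.exp (b * (u q * v⁻¹ * sqrtQuot (u q * v⁻¹ ^ 2))))) χ := by
    refine (integrable_and_abs_integral_le (C := 1) (by fun_prop) (hint A) ?_).1
    filter_upwards [hu, hx] with q hq hxq
    have h0 := hw q
    rw [abs_of_nonneg (by positivity), one_mul, mul_assoc (wt q)]
    refine mul_le_mul_of_nonneg_left ?_ h0
    gcongr
    exact one_add_mul_inv_sq_rpow_le hA hq.le hv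
  have hi := fun m => integrable_quotMoment hb hwm hum hw hu hint a m hv
  rw [Real.norm_eq_abs, Real.norm_of_nonneg (by positivity)]
  have e : (∫ q, wt q * ((1 + u q * v⁻¹ ^ 2) ^ a *
      Real.exp (b * (u q * v⁻¹ * sqrtQuot (u q * v⁻¹ ^ 2)))) ∂χ) -
      ∑ m ∈ range K, v⁻¹ ^ (1 * m) * (b ^ m / m.factorial * quotMoment χ wt u a m v) =
      ∫ q, (wt q * ((1 + u q * v⁻¹ ^ 2) ^ a *
        Real.exp (b * (u q * v⁻¹ * sqrtQuot (u q * v⁻¹ ^ 2)))) -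
        ∑ m ∈ range K, v⁻¹ ^ m * (b ^ m / m.factorial) * (wt q * (u q ^ m *
          ((1 + u q * v⁻¹ ^ 2) ^ a * sqrtQuot (u q * v⁻¹ ^ 2) ^ m)))) ∂χ := by
    rw [integral_sub hE (integrable_finsetSum _ fun m _ => (hi m).const_mul _),
      integral_finsetSum _ fun m _ => (hi m).const_mul _]
    simp only [integral_const_mul, quotMoment]
    congr 1
    exact Finset.sum_congr rfl fun k _ => by rw [one_mul]; ring
  rw [e]
  have key := (integrable_and_abs_integral_le (χ := χ) (C := b ^ K * v⁻¹ ^ K)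
    (F := fun q => wt q * ((1 + u q * v⁻¹ ^ 2) ^ a *
        Real.exp (b * (u q * v⁻¹ * sqrtQuot (u q * v⁻¹ ^ 2)))) -
        ∑ m ∈ range K, v⁻¹ ^ m * (b ^ m / m.factorial) * (wt q * (u q ^ m *
          ((1 + u q * v⁻¹ ^ 2) ^ a * sqrtQuot (u q * v⁻¹ ^ 2) ^ m))))
    (by fun_prop) (hint (A + K)) ?_).2
  · refine key.trans (le_of_eq (by ring))
  · filter_upwards [hu, hx] with q hq hxq
    have h0 := hw q
    have hs := sqrtQuot_pos (u q * v⁻¹ ^ 2)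
    set x := b * (u q * v⁻¹ * sqrtQuot (u q * v⁻¹ ^ 2)) with hxdef
    have hx0 : 0 ≤ x := by positivity
    have hxu : x ≤ b * (1 + u q) * v⁻¹ := by
      calc x ≤ b * ((1 + u q) * v⁻¹ * 1) := by
            rw [hxdef]; gcongr
            · linarith
            · exact sqrtQuot_le_one _
        _ = _ := by ring
    have hexp : |Real.exp x - ∑ m ∈ range K, x ^ m / m.factorial| ≤
        x ^ K * Real.exp (b * Real.sqrt (u q)) := by
      have := Complex.norm_exp_sub_sum_le_norm_mul_exp (x : ℂ) K
      have e3 : Complex.exp (x : ℂ) - ∑ m ∈ range K, (x : ℂ) ^ m / m.factorial =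
          ((Real.exp x - ∑ m ∈ range K, x ^ m / m.factorial : ℝ) : ℂ) := by push_cast; rfl
      rw [e3, Complex.norm_real, Complex.norm_real, Real.norm_eq_abs,
        Real.norm_of_nonneg hx0] at this
      refine this.trans ?_
      gcongr
    have e2 : wt q * ((1 + u q * v⁻¹ ^ 2) ^ a * Real.exp x) -
        ∑ m ∈ range K, v⁻¹ ^ m * (b ^ m / m.factorial) * (wt q * (u q ^ m *
          ((1 + u q * v⁻¹ ^ 2) ^ a * sqrtQuot (u q * v⁻¹ ^ 2) ^ m))) =
        wt q * (1 + u q * v⁻¹ ^ 2) ^ a *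
          (Real.exp x - ∑ m ∈ range K, x ^ m / m.factorial) := by
      rw [mul_sub, Finset.mul_sum, mul_assoc]
      congr 1
      refine Finset.sum_congr rfl fun k _ => ?_
      rw [hxdef]; simp only [mul_pow]; ring
    rw [e2, abs_mul, abs_of_nonneg (by positivity)]
    calc _ ≤ wt q * (1 + u q) ^ A * ((b * (1 + u q) * v⁻¹) ^ K *
          Real.exp (b * Real.sqrt (u q))) := by
          gcongr ?_ * ?_ * ?_
          · exact one_add_mul_inv_sq_rpow_le hA hq.le hv
          · refine hexp.trans ?_
            gcongr
      _ = _ := by rw [mul_pow, mul_pow]; ring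

/-- Expansion of the averaged Puiseux-type integrand. -/
lemma hasExp_expMoment (a : ℝ) :
    HasExp (fun v => ∫ q, wt q * ((1 + u q * v⁻¹ ^ 2) ^ a *
      Real.exp (b * (u q * v⁻¹ * sqrtQuot (u q * v⁻¹ ^ 2)))) ∂χ)
      fun p => ∑ i ∈ Icc ((p + 1) / 2) p, puiseuxG a b i p * ∫ q, wt q * u q ^ i ∂χ := by
  have h := hasExp_expMoment_aux hb hwm hum hw hu hint a
  have e := sum_quotCoef_eq_sum_puiseuxG a b (fun i => ∫ q, wt q * u q ^ i ∂χ)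
  simpa only [e] using h

end Laplace

lemma poch_pos {v : ℝ} (hv : 0 < v) (j : ℕ) : 0 < poch v j :=
  Finset.prod_pos fun t _ => by positivity

lemma Gamma_add_nat_eq {d : ℝ} (hd : 0 < d) (j : ℕ) :
    Real.Gamma (d + j) = Real.Gamma d * poch d j := by
  induction j with
  | zero => simp [poch]
  | succ j ih =>
    rw [poch_succ, ← mul_assoc, ← ih, Nat.cast_add, Nat.cast_one, ← add_assoc,
      Real.Gamma_add_one (by positivity), mul_comm]

lemma poch_add (v : ℝ) (i j : ℕ) : poch v (i + j) = poch v i * poch (v + i) j := by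
  rw [poch, poch, poch, Finset.prod_range_add]
  simp [add_assoc]

lemma poch_le {v : ℝ} (hv : 0 ≤ v) (i : ℕ) : poch v i ≤ i.factorial * Real.exp (v + i) := by
  have h1 : poch v i ≤ (v + i) ^ i := by
    have := Finset.prod_le_prod (s := range i) (f := fun t : ℕ => v + t) (g := fun _ => v + i)
      (fun t _ => by positivity) fun t ht => by
        have : (t : ℝ) ≤ i := by exact_mod_cast (Finset.mem_range.1 ht).le
        simpa using this
    rwa [Finset.prod_const, Finset.card_range] at this
  have h2 := Real.pow_div_factorial_le_exp (v + i) (by positivity) i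
  rw [div_le_iff₀ (by positivity)] at h2
  linarith

lemma half_le_poch {d : ℝ} (hd : 1 / 2 ≤ d) (j : ℕ) : 1 / 2 ≤ poch d j := by
  cases j with
  | zero => simp [poch]; norm_num
  | succ j =>
    rw [poch_succ_left]
    have : 1 ≤ poch (d + 1) j := by
      have := Finset.prod_le_prod (s := range j) (f := fun _ => (1 : ℝ))
        (g := fun t : ℕ => d + 1 + t) (fun _ _ => zero_le_one) fun t _ => by
          have : (0 : ℝ) ≤ t := t.cast_nonneg
          linarith
      rwa [Finset.prod_const_one] at this
    nlinarith

lemma summable_hypM_add_nat {d : ℝ} (hd : 0 < d) (i : ℕ) (x : ℝ) :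
    Summable fun j : ℕ => poch (d + i) j / poch d j * x ^ j / j.factorial := by
  refine Summable.of_norm_bounded (g := fun j : ℕ =>
    i.factorial * Real.exp (d + i) / poch d i * ((Real.exp 1 * |x|) ^ j / j.factorial))
    ((Real.summable_pow_div_factorial _).mul_left _) fun j => ?_
  have h1 := poch_pos hd i
  have h2 := poch_pos hd j
  have h3 : 0 < poch (d + i) j := poch_pos (by positivity) j
  have e : poch (d + i) j / poch d j = poch (d + j) i / poch d i := by
    rw [div_eq_div_iff h2.ne' h1.ne', mul_comm, ← poch_add, mul_comm, ← poch_add, add_comm]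
  have h4 := poch_le (v := d + j) (by positivity) i
  have e2 : Real.exp (d + j + i) = Real.exp (d + i) * Real.exp 1 ^ j := by
    rw [← Real.exp_nat_mul, ← Real.exp_add]; congr 1; ring
  rw [Real.norm_eq_abs, abs_div, abs_mul, abs_of_pos (by positivity), abs_pow, e,
    abs_of_pos (by positivity : (0 : ℝ) < j.factorial), mul_pow]
  calc poch (d + j) i / poch d i * |x| ^ j / j.factorial
      ≤ i.factorial * (Real.exp (d + i) * Real.exp 1 ^ j) / poch d i * |x| ^ j / j.factorial := by
        rw [← e2]; gcongr
    _ = _ := by ring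

lemma hypM_self {d : ℝ} (hd : 0 < d) (x : ℝ) : hypM d d x = Real.exp x := by
  rw [Real.exp_eq_exp_ℝ, NormedSpace.exp_eq_tsum_div, hypM]
  refine tsum_congr fun j => ?_
  rw [div_self (poch_pos hd j).ne', one_mul]

/-- `∑ (w/4)^j/(j! Γ(d+j))`, a normalised modified Bessel function. -/
def besselSum (d w : ℝ) : ℝ := ∑' j : ℕ, (w / 4) ^ j / (j.factorial * Real.Gamma (d + j))

lemma summable_besselSum {d : ℝ} (hd : 1 / 2 ≤ d) (w : ℝ) :
    Summable fun j : ℕ => (w / 4) ^ j / (j.factorial * Real.Gamma (d + j)) := by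
  have hd0 : 0 < d := by linarith
  have hG := Real.Gamma_pos_of_pos hd0
  refine Summable.of_norm_bounded (g := fun j : ℕ =>
    2 / Real.Gamma d * (|w / 4| ^ j / j.factorial))
    ((Real.summable_pow_div_factorial _).mul_left _) fun j => ?_
  rw [Gamma_add_nat_eq hd0, Real.norm_eq_abs, abs_div, abs_pow,
    abs_of_pos (mul_pos (by positivity) (mul_pos hG (poch_pos hd0 j)))]
  have := half_le_poch hd j
  have hp := poch_pos hd0 j
  rw [div_mul_div_comm, div_le_div_iff₀ (by positivity) (by positivity)]
  have h0 : 0 ≤ |w / 4| ^ j * (j.factorial * Real.Gamma d) := by positivity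
  nlinarith

lemma besselSum_nonneg {d : ℝ} (hd : 1 / 2 ≤ d) {w : ℝ} (hw : 0 ≤ w) : 0 ≤ besselSum d w := by
  refine tsum_nonneg fun j => ?_
  have : 0 < Real.Gamma (d + j) := Real.Gamma_pos_of_pos (by positivity)
  positivity

lemma measurable_tsum_of_summable {α : Type*} [MeasurableSpace α] {F : ℕ → α → ℝ}
    (hF : ∀ j, Measurable (F j)) (hs : ∀ x, Summable fun j => F j x) :
    Measurable fun x => ∑' j, F j x := by
  refine measurable_of_tendsto_metrizable (f := fun N x => ∑ j ∈ range N, F j x) (fun N => ?_) ?_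
  · exact Finset.measurable_sum _ fun j _ => hF j
  · rw [tendsto_pi_nhds]
    exact fun x => (hs x).hasSum.tendsto_sum_nat

lemma measurable_besselSum {d : ℝ} (hd : 1 / 2 ≤ d) : Measurable (besselSum d) :=
  measurable_tsum_of_summable (fun j => by fun_prop) (summable_besselSum hd)

/-- Termwise integration of a pointwise convergent series of nonnegative functions. -/
lemma integrable_tsum_of_nonneg {α : Type*} [MeasurableSpace α] {μ : Measure α} {F : ℕ → α → ℝ}
    (hF : ∀ j, Measurable (F j)) (h0 : ∀ j, ∀ᵐ x ∂μ, 0 ≤ F j x) (hi : ∀ j, Integrable (F j) μ)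
    (hs : ∀ x, Summable fun j => F j x) (hsum : Summable fun j => ∫ x, F j x ∂μ) :
    Integrable (fun x => ∑' j, F j x) μ ∧ ∫ x, ∑' j, F j x ∂μ = ∑' j, ∫ x, F j x ∂μ := by
  have h0' : ∀ᵐ x ∂μ, ∀ j, 0 ≤ F j x := ae_all_iff.2 h0
  constructor
  · refine ⟨(measurable_tsum_of_summable hF hs).aestronglyMeasurable, ?_⟩
    rw [hasFiniteIntegral_iff_ofReal (h0'.mono fun x hx => tsum_nonneg hx)]
    have e : ∫⁻ x, ENNReal.ofReal (∑' j, F j x) ∂μ =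
        ∑' j, ENNReal.ofReal (∫ x, F j x ∂μ) := by
      rw [lintegral_congr_ae (h0'.mono fun x hx => ENNReal.ofReal_tsum_of_nonneg hx (hs x)),
        lintegral_tsum fun j => (hF j).ennreal_ofReal.aemeasurable]
      exact tsum_congr fun j => (ofReal_integral_eq_lintegral_ofReal (hi j) (h0 j)).symm
    rw [e, ← ENNReal.ofReal_tsum_of_nonneg (fun j => integral_nonneg_of_ae (h0 j)) hsum]
    exact ENNReal.ofReal_lt_top
  · refine (hasSum_integral_of_summable_integral_norm hi ?_).tsum_eq.symm
    refine hsum.congr fun j => integral_congr_ae ((h0 j).mono fun x hx => ?_)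
    simp [Real.norm_of_nonneg hx]

/-- Density on `(0,∞)` of the noncentral chi-squared law with `2d` degrees of freedom. -/
def ncChiPDF (d lam p : ℝ) : ℝ :=
  1 / 2 * Real.exp (-(lam + p) / 2) * (p / 2) ^ (d - 1) * besselSum d (lam * p)

lemma measurable_ncChiPDF {d : ℝ} (hd : 1 / 2 ≤ d) (lam : ℝ) : Measurable (ncChiPDF d lam) := by
  have := measurable_besselSum hd
  unfold ncChiPDF
  fun_prop

lemma ncChiPDF_nonneg {d lam p : ℝ} (hd : 1 / 2 ≤ d) (hl : 0 ≤ lam) (hp : 0 ≤ p) :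
    0 ≤ ncChiPDF d lam p := by
  have := besselSum_nonneg hd (mul_nonneg hl hp)
  unfold ncChiPDF
  positivity

lemma ncChiPDF_moment {d lam c : ℝ} (hd : 1 / 2 ≤ d) (hl : 0 ≤ lam) (hc : 0 < c) (i : ℕ) :
    IntegrableOn (fun p => p ^ i * Real.exp (-((c - 1 / 2) * p)) * ncChiPDF d lam p) (Set.Ioi 0) ∧
    ∫ p in Set.Ioi 0, p ^ i * Real.exp (-((c - 1 / 2) * p)) * ncChiPDF d lam p =
      Real.exp (-lam / 2) * (2 * c) ^ (-d) * (1 / c) ^ i * poch d i *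
        hypM (d + i) d (lam / (4 * c)) := by
  have hd0 : 0 < d := by linarith
  have hG := Real.Gamma_pos_of_pos hd0
  set T : ℕ → ℝ → ℝ := fun j p => Real.exp (-lam / 2) * 2 ^ (-d) *
    ((lam / 4) ^ j / (j.factorial * Real.Gamma (d + j))) *
      (p ^ (d + j + i - 1) * Real.exp (-(c * p))) with hT
  have hGj : ∀ j : ℕ, 0 < Real.Gamma (d + j) := fun j => Real.Gamma_pos_of_pos (by positivity)
  have hval : ∀ j, ∫ p in Set.Ioi 0, T j p = Real.exp (-lam / 2) * (2 * c) ^ (-d) * (1 / c) ^ i *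
      poch d i * (poch (d + i) j / poch d j * (lam / (4 * c)) ^ j / j.factorial) := by
    intro j
    have h1 : (1 / c) ^ (d + j + i) = c ^ (-d) * (1 / c) ^ j * (1 / c) ^ i := by
      rw [Real.rpow_add (by positivity), Real.rpow_add (by positivity), Real.rpow_natCast,
        Real.rpow_natCast, one_div, Real.inv_rpow hc.le, Real.rpow_neg hc.le]
    have h2 : Real.Gamma (d + j + i) = Real.Gamma d * (poch d i * poch (d + i) j) := by
      rw [← poch_add, ← Gamma_add_nat_eq hd0]; push_cast; ring_nf
    have hpj := poch_pos hd0 j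
    simp only [hT, integral_const_mul]
    rw [Real.integral_rpow_mul_exp_neg_mul_Ioi (by positivity) hc, h1, h2, Gamma_add_nat_eq hd0,
      Real.mul_rpow (by norm_num) hc.le, div_pow lam, div_pow lam, mul_pow (4 : ℝ), div_pow 1 c j, one_pow]
    field_simp
  have hint : ∀ j, IntegrableOn (T j) (Set.Ioi 0) := by
    intro j
    refine Integrable.const_mul ?_ _
    refine Integrable.of_integral_ne_zero ?_
    rw [Real.integral_rpow_mul_exp_neg_mul_Ioi (by positivity) hc]
    have : 0 < Real.Gamma (d + j + i) := Real.Gamma_pos_of_pos (by positivity)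
    positivity
  have hsT : ∀ p, Summable fun j => if 0 < p then T j p else 0 := by
    intro p
    by_cases hp : 0 < p
    · simp only [hp, if_true]
      refine ((summable_besselSum hd (lam * p)).mul_left (Real.exp (-lam / 2) * 2 ^ (-d) *
        (p ^ (d + i - 1) * Real.exp (-(c * p))))).congr fun j => ?_
      simp only [hT]
      rw [show d + j + i - 1 = (d + i - 1) + j by ring, Real.rpow_add hp, Real.rpow_natCast,
        mul_div_right_comm, mul_pow]
      ring
    · simp [hp]
  have hmain := integrable_tsum_of_nonneg (μ := volume.restrict (Set.Ioi (0 : ℝ)))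
    (F := fun j p => if 0 < p then T j p else 0) (fun j => ?_) (fun j => ?_) (fun j => ?_) hsT ?_
  · have hcongr : ∀ p ∈ Set.Ioi (0 : ℝ), (∑' j, if 0 < p then T j p else 0) =
        p ^ i * Real.exp (-((c - 1 / 2) * p)) * ncChiPDF d lam p := by
      intro p hp
      have hp' : 0 < p := hp
      simp only [hp', if_true, ncChiPDF, besselSum]
      rw [← tsum_mul_left, ← tsum_mul_left]
      refine tsum_congr fun j => ?_
      simp only [hT]
      have e1 : Real.exp (-((c - 1 / 2) * p)) * Real.exp (-(lam + p) / 2) =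
          Real.exp (-lam / 2) * Real.exp (-(c * p)) := by
        rw [← Real.exp_add, ← Real.exp_add]; congr 1; ring
      have e2 : p ^ (d + j + i - 1) = p ^ (d - 1) * p ^ j * p ^ i := by
        rw [show d + j + i - 1 = (d - 1) + j + i by ring, Real.rpow_add hp', Real.rpow_add hp',
          Real.rpow_natCast, Real.rpow_natCast]
      have e3 : (p / 2) ^ (d - 1) = p ^ (d - 1) * 2 ^ (-d) * 2 := by
        rw [Real.div_rpow hp'.le (by norm_num), Real.rpow_sub_one (two_ne_zero : (2 : ℝ) ≠ 0),
          Real.rpow_neg (by norm_num)]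
        have := (Real.rpow_pos_of_pos (two_pos : (0 : ℝ) < 2) d).ne'
        field_simp
      rw [e2, e3, mul_div_right_comm, mul_pow]
      linear_combination -(p ^ i * p ^ (d - 1) * 2 ^ (-d) * ((lam / 4) ^ j * p ^ j /
        (j.factorial * Real.Gamma (d + j)))) * e1
    refine ⟨hmain.1.congr (by
      filter_upwards [ae_restrict_mem measurableSet_Ioi] with p hp using hcongr p hp), ?_⟩
    rw [← setIntegral_congr_fun measurableSet_Ioi hcongr, hmain.2, hypM, ← tsum_mul_left]
    refine tsum_congr fun j => ?_
    rw [← hval j]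
    exact setIntegral_congr_fun measurableSet_Ioi fun p hp => if_pos hp
  · refine Measurable.ite measurableSet_Ioi ?_ measurable_const
    simp only [hT]; fun_prop
  · filter_upwards [ae_restrict_mem measurableSet_Ioi] with p hp
    have hp' : 0 < p := hp
    have := hGj j
    simp only [hp', if_true, hT]
    positivity
  · refine (hint j).congr ?_
    filter_upwards [ae_restrict_mem measurableSet_Ioi] with p hp
    exact (if_pos hp).symm
  · refine ((summable_hypM_add_nat hd0 i (lam / (4 * c))).mul_left (Real.exp (-lam / 2) *
      (2 * c) ^ (-d) * (1 / c) ^ i * poch d i)).congr fun j => ?_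
    rw [← hval j]
    exact (setIntegral_congr_fun measurableSet_Ioi fun p hp => if_pos hp).symm

lemma integral_rpow_mul_one_sub_rpow {a b : ℝ} (ha : 0 < a) (hb : 0 < b) :
    IntegrableOn (fun x : ℝ => x ^ (a - 1) * (1 - x) ^ (b - 1)) (Set.Ioo 0 1) ∧
    ∫ x in Set.Ioo (0 : ℝ) 1, x ^ (a - 1) * (1 - x) ^ (b - 1) =
      Real.Gamma a * Real.Gamma b / Real.Gamma (a + b) := by
  have hB := ProbabilityTheory.beta_pos ha hb
  have h1 := ProbabilityTheory.lintegral_betaPDF_eq_one ha hb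
  rw [ProbabilityTheory.lintegral_betaPDF] at h1
  have h2 : ∫ x in Set.Ioo (0 : ℝ) 1, 1 / ProbabilityTheory.beta a b * x ^ (a - 1) *
      (1 - x) ^ (b - 1) = 1 := by
    rw [integral_eq_lintegral_of_nonneg_ae, h1, ENNReal.toReal_one]
    · filter_upwards [ae_restrict_mem measurableSet_Ioo] with x hx
      have hx0 : 0 < x := hx.1
      have hx1 : 0 ≤ 1 - x := by linarith [hx.2]
      simp only [Pi.zero_apply]
      positivity
    · exact Measurable.aestronglyMeasurable (by fun_prop)
  simp_rw [mul_assoc] at h2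
  rw [integral_const_mul, one_div, inv_mul_eq_one₀ hB.ne'] at h2
  refine ⟨Integrable.of_integral_ne_zero (by rw [← h2]; exact hB.ne'), h2.symm⟩

lemma Gamma_half_mul_factorial (j : ℕ) :
    Real.Gamma (1 / 2 + j) * j.factorial * 4 ^ j = (2 * j).factorial * Real.sqrt Real.pi := by
  have h := Real.Gamma_mul_Gamma_add_half (1 / 2 + j)
  rw [show (1 / 2 + (j : ℝ) + 1 / 2) = j + 1 by ring, Real.Gamma_nat_eq_factorial,
    show 2 * (1 / 2 + (j : ℝ)) = ((2 * j : ℕ) : ℝ) + 1 by push_cast; ring,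
    Real.Gamma_nat_eq_factorial,
    show (1 : ℝ) - (((2 * j : ℕ) : ℝ) + 1) = -((2 * j : ℕ) : ℝ) by ring,
    Real.rpow_neg (by norm_num), Real.rpow_natCast, pow_mul] at h
  rw [h]
  norm_num
  field_simp

lemma besselSum_eq_integral_cosh {b : ℝ} (hb : 0 < b) (z : ℝ) :
    IntegrableOn (fun x : ℝ => x ^ ((1 / 2 : ℝ) - 1) * (1 - x) ^ (b - 1) *
      Real.cosh (z * Real.sqrt x)) (Set.Ioo 0 1) ∧
    ∫ x in Set.Ioo (0 : ℝ) 1, x ^ ((1 / 2 : ℝ) - 1) * (1 - x) ^ (b - 1) *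
      Real.cosh (z * Real.sqrt x) =
      Real.sqrt Real.pi * Real.Gamma b * besselSum (b + 1 / 2) (z ^ 2) := by
  have hval : ∀ j : ℕ, IntegrableOn (fun x : ℝ => x ^ ((1 / 2 : ℝ) - 1) * (1 - x) ^ (b - 1) *
      ((z * Real.sqrt x) ^ (2 * j) / (2 * j).factorial)) (Set.Ioo 0 1) ∧
      ∫ x in Set.Ioo (0 : ℝ) 1, x ^ ((1 / 2 : ℝ) - 1) * (1 - x) ^ (b - 1) *
        ((z * Real.sqrt x) ^ (2 * j) / (2 * j).factorial) = Real.sqrt Real.pi * Real.Gamma b *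
        ((z ^ 2 / 4) ^ j / (j.factorial * Real.Gamma (b + 1 / 2 + j))) := by
    intro j
    have hB := integral_rpow_mul_one_sub_rpow (a := 1 / 2 + j) (b := b) (by positivity) hb
    have e : ∀ x ∈ Set.Ioo (0 : ℝ) 1, z ^ (2 * j) / (2 * j).factorial *
        (x ^ (1 / 2 + (j : ℝ) - 1) * (1 - x) ^ (b - 1)) =
        x ^ ((1 / 2 : ℝ) - 1) * (1 - x) ^ (b - 1) *
        ((z * Real.sqrt x) ^ (2 * j) / (2 * j).factorial) := by
      intro x hx
      rw [show 1 / 2 + (j : ℝ) - 1 = (1 / 2 - 1) + j by ring, Real.rpow_add hx.1,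
        Real.rpow_natCast, mul_pow, pow_mul (Real.sqrt x), Real.sq_sqrt hx.1.le]
      ring
    refine ⟨(hB.1.const_mul _).congr (by
      filter_upwards [ae_restrict_mem measurableSet_Ioo] with x hx using e x hx), ?_⟩
    rw [← setIntegral_congr_fun measurableSet_Ioo e, integral_const_mul, hB.2,
      show 1 / 2 + (j : ℝ) + b = b + 1 / 2 + j by ring]
    have hG : 0 < Real.Gamma (b + 1 / 2 + j) := Real.Gamma_pos_of_pos (by positivity)
    have := Gamma_half_mul_factorial j
    rw [div_pow, ← pow_mul]
    generalize Real.Gamma (1 / 2 + (j : ℝ)) = G₁ at this ⊢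
    generalize Real.Gamma (b + 1 / 2 + j) = G₂ at hG ⊢
    field_simp
    linear_combination (z ^ (2 * j)) * this
  have hmain := integrable_tsum_of_nonneg (μ := volume.restrict (Set.Ioo (0 : ℝ) 1))
    (F := fun (j : ℕ) (x : ℝ) => x ^ ((1 / 2 : ℝ) - 1) * (1 - x) ^ (b - 1) *
      ((z * Real.sqrt x) ^ (2 * j) / (2 * j).factorial)) (fun j => by fun_prop) (fun j => ?_)
    (fun j => (hval j).1) (fun x => (Real.hasSum_cosh _).summable.mul_left _) ?_
  · simp only [tsum_mul_left, ← Real.cosh_eq_tsum] at hmain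
    refine ⟨hmain.1, ?_⟩
    rw [hmain.2, besselSum, ← tsum_mul_left]
    exact tsum_congr fun j => (hval j).2
  · filter_upwards [ae_restrict_mem measurableSet_Ioo] with x hx
    have hx0 : 0 < x := hx.1
    have hx1 : 0 ≤ 1 - x := by linarith [hx.2]
    rw [pow_mul]
    positivity
  · exact ((summable_besselSum (by linarith) (z ^ 2)).mul_left _).congr fun j => (hval j).2.symm

lemma besselSum_eq_integral_exp {b : ℝ} (hb : 0 < b) (z : ℝ) :
    IntegrableOn (fun r : ℝ => (r * (2 - r)) ^ (b - 1) * (Real.exp (z * (1 - r)) +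
      Real.exp (-(z * (1 - r))))) (Set.Ioo 0 1) ∧
    ∫ r in Set.Ioo (0 : ℝ) 1, (r * (2 - r)) ^ (b - 1) * (Real.exp (z * (1 - r)) +
      Real.exp (-(z * (1 - r)))) =
      Real.sqrt Real.pi * Real.Gamma b * besselSum (b + 1 / 2) (z ^ 2) := by
  have himg : (fun r : ℝ => (1 - r) ^ 2) '' Set.Ioo 0 1 = Set.Ioo 0 1 := by
    ext x
    constructor
    · rintro ⟨r, ⟨h0, h1⟩, rfl⟩
      exact ⟨by have : 0 < 1 - r := by linarith
                positivity, by simp only; nlinarith⟩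
    · rintro ⟨h0, h1⟩
      refine ⟨1 - Real.sqrt x, ⟨?_, ?_⟩, ?_⟩
      · have : Real.sqrt x < 1 := by rw [Real.sqrt_lt' one_pos]; simpa using h1
        linarith
      · linarith [Real.sqrt_pos.2 h0]
      · simp [Real.sq_sqrt h0.le]
  have hder : ∀ r ∈ Set.Ioo (0 : ℝ) 1,
      HasDerivWithinAt (fun r : ℝ => (1 - r) ^ 2) (-(2 * (1 - r))) (Set.Ioo 0 1) r := by
    intro r _
    have := (((hasDerivAt_id r).const_sub 1).pow 2).hasDerivWithinAt (s := Set.Ioo 0 1)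
    refine this.congr_deriv ?_
    simp
  have hinj : Set.InjOn (fun r : ℝ => (1 - r) ^ 2) (Set.Ioo 0 1) := by
    intro r hr q hq h
    have := (sq_eq_sq₀ (by linarith [hr.2]) (by linarith [hq.2])).1 h
    linarith
  set G : ℝ → ℝ := fun x => x ^ ((1 / 2 : ℝ) - 1) * (1 - x) ^ (b - 1) * Real.cosh (z * Real.sqrt x)
  have hcongr : ∀ r ∈ Set.Ioo (0 : ℝ) 1, |-(2 * (1 - r))| • G ((1 - r) ^ 2) =
      (r * (2 - r)) ^ (b - 1) * (Real.exp (z * (1 - r)) + Real.exp (-(z * (1 - r)))) := by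
    intro r hr
    have h1 : 0 < 1 - r := by linarith [hr.2]
    have h2 : ((1 - r) ^ 2) ^ ((1 / 2 : ℝ) - 1) = (1 - r)⁻¹ := by
      rw [← Real.rpow_natCast, ← Real.rpow_mul h1.le, ← Real.rpow_neg_one]; norm_num
    simp only [G, smul_eq_mul]
    rw [abs_neg, abs_of_pos (by positivity), h2, Real.sqrt_sq h1.le, Real.cosh_eq,
      show 1 - (1 - r) ^ 2 = r * (2 - r) by ring]
    field_simp
  obtain ⟨h1, h2⟩ := besselSum_eq_integral_cosh hb z
  constructor
  · rw [← himg] at h1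
    have := (integrableOn_image_iff_integrableOn_abs_deriv_smul measurableSet_Ioo hder hinj G).1 h1
    exact this.congr (by
      filter_upwards [ae_restrict_mem measurableSet_Ioo] with x hx using hcongr x hx)
  · rw [← setIntegral_congr_fun measurableSet_Ioo hcongr,
      ← integral_image_eq_integral_abs_deriv_smul measurableSet_Ioo hder hinj G, himg, h2]

/-- `(z/2)^(d-1) √(2πz) e^{-z}` times the Bessel sum at `z²`. -/
def besselNorm (d z : ℝ) : ℝ :=
  besselSum d (z ^ 2) * (z / 2) ^ (d - 1) * Real.sqrt (2 * Real.pi * z) * Real.exp (-z)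

/-- Coefficients of the Hankel expansion of `besselNorm`. -/
def besselCoef (d : ℝ) (k : ℕ) : ℝ :=
  poch (3 / 2 - d) k * poch (d - 1 / 2) k / (k.factorial * 2 ^ k)

lemma measurable_besselNorm {d : ℝ} (hd : 1 / 2 ≤ d) : Measurable (besselNorm d) := by
  have := measurable_besselSum hd
  unfold besselNorm
  fun_prop

lemma exists_one_sub_half_rpow_bound (c : ℝ) (N : ℕ) :
    ∃ C, 0 ≤ C ∧ ∀ r : ℝ, 0 < r → |(if r < 1 then (1 - r / 2) ^ c else 0) -
      ∑ k ∈ range N, genBinom c k * (-(r / 2)) ^ k| ≤ C * r ^ N := by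
  obtain ⟨C, hC0, hC⟩ := (isBigO_one_add_rpow_sub c N).exists_nonneg
  obtain ⟨ε, hε, hball⟩ := Metric.eventually_nhds_iff.1 hC.bound
  set δ := min ε (1 / 2) with hδ
  have hδ0 : 0 < δ := by positivity
  have hδ1 : δ ≤ 1 / 2 := min_le_right _ _
  refine ⟨C + (1 + (1 / 2) ^ c) * (δ⁻¹) ^ N + ∑ k ∈ range N, |genBinom c k| * δ⁻¹ ^ N,
    by positivity, fun r hr => ?_⟩
  have hrN : 0 < r ^ N := by positivity
  have hS0 : 0 ≤ ∑ k ∈ range N, |genBinom c k| * δ⁻¹ ^ N :=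
    Finset.sum_nonneg fun k _ => by positivity
  have hW0 : 0 ≤ (1 + (1 / 2 : ℝ) ^ c) * (δ⁻¹) ^ N := by positivity
  by_cases h : r / 2 < δ
  · have h1 : r < 1 := by linarith
    rw [if_pos h1]
    have := hball (y := -(r / 2)) (by
      rw [dist_zero_right, norm_neg, Real.norm_of_nonneg (by positivity)]
      exact h.trans_le (min_le_left _ _))
    rw [← sub_eq_add_neg] at this
    rw [← Real.norm_eq_abs]
    refine this.trans ?_
    rw [norm_pow, norm_neg, Real.norm_of_nonneg (by positivity)]
    calc C * (r / 2) ^ N ≤ C * r ^ N := by gcongr; linarith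
      _ ≤ _ := by gcongr; linarith
  · have hδr : 1 ≤ δ⁻¹ * r := by
      rw [inv_mul_eq_div, one_le_div hδ0]; linarith [not_lt.1 h]
    have hδi : 1 ≤ δ⁻¹ := by
      rw [one_le_inv₀ hδ0]; linarith
    have b1 : |if r < 1 then (1 - r / 2) ^ c else 0| ≤ (1 + (1 / 2) ^ c) * (δ⁻¹ * r) ^ N := by
      have h1N : 1 ≤ (δ⁻¹ * r) ^ N := one_le_pow₀ hδr
      refine le_trans ?_ (le_mul_of_one_le_right (by positivity) h1N)
      split_ifs with h1
      · have h0 : 0 < 1 - r / 2 := by linarith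
        rw [abs_of_nonneg (by positivity)]
        rcases le_total 0 c with hc | hc
        · have := Real.rpow_le_one h0.le (by linarith) hc
          have h2 : (0 : ℝ) ≤ (1 / 2) ^ c := by positivity
          linarith
        · have := Real.rpow_le_rpow_of_nonpos (by norm_num : (0 : ℝ) < 1 / 2)
            (by linarith : 1 / 2 ≤ 1 - r / 2) hc
          linarith
      · rw [abs_zero]; positivity
    have b2 : |∑ k ∈ range N, genBinom c k * (-(r / 2)) ^ k| ≤
        (∑ k ∈ range N, |genBinom c k| * δ⁻¹ ^ N) * r ^ N := by
      refine (Finset.abs_sum_le_sum_abs _ _).trans ?_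
      rw [Finset.sum_mul]
      refine Finset.sum_le_sum fun k hk => ?_
      rw [abs_mul, abs_pow, abs_neg, abs_of_pos (half_pos hr), mul_assoc, ← mul_pow]
      refine mul_le_mul_of_nonneg_left ?_ (abs_nonneg _)
      calc (r / 2) ^ k ≤ (δ⁻¹ * r) ^ k := by
            gcongr
            nlinarith
        _ ≤ _ := pow_le_pow_right₀ hδr (Finset.mem_range.1 hk).le
    refine (abs_sub _ _).trans ((add_le_add b1 b2).trans ?_)
    rw [mul_pow]
    have : 0 ≤ C * r ^ N := by positivity
    linarith

lemma genBinom_mul_neg_one_pow (b : ℝ) (k : ℕ) :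
    genBinom (b - 1) k * (-1) ^ k = poch (1 - b) k / k.factorial := by
  rw [genBinom, poch, div_mul_eq_mul_div]
  congr 1
  have : ((-1 : ℝ)) ^ k = ∏ _t ∈ range k, (-1 : ℝ) := by simp
  rw [this, ← Finset.prod_mul_distrib]
  exact Finset.prod_congr rfl fun t _ => by ring

lemma watson_isBigO {b : ℝ} (hb : 0 < b) (N : ℕ) :
    (fun z : ℝ => z ^ b / Real.Gamma b * (∫ r in Set.Ioi (0 : ℝ), r ^ (b - 1) *
      (if r < 1 then (1 - r / 2) ^ (b - 1) else 0) * Real.exp (-(z * r))) -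
      ∑ k ∈ range N, besselCoef (b + 1 / 2) k * z⁻¹ ^ k) =O[atTop] fun z => z⁻¹ ^ N := by
  obtain ⟨C, hC0, hC⟩ := exists_one_sub_half_rpow_bound (b - 1) N
  obtain ⟨C1, hC10, hC1⟩ := exists_one_sub_half_rpow_bound (b - 1) 0
  have hG := Real.Gamma_pos_of_pos hb
  have hpow : ∀ {z : ℝ}, 0 < z → ∀ k : ℕ,
      IntegrableOn (fun r : ℝ => r ^ (b + k - 1) * Real.exp (-(z * r))) (Set.Ioi 0) ∧
      ∫ r in Set.Ioi (0 : ℝ), r ^ (b + k - 1) * Real.exp (-(z * r)) =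
        z ^ (-b) * z⁻¹ ^ k * (Real.Gamma b * poch b k) := by
    intro z hz k
    have e := Real.integral_rpow_mul_exp_neg_mul_Ioi (a := b + k) (r := z) (by positivity) hz
    have hGk : 0 < Real.Gamma (b + k) := Real.Gamma_pos_of_pos (by positivity)
    refine ⟨Integrable.of_integral_ne_zero (by rw [e]; positivity), ?_⟩
    rw [e, Gamma_add_nat_eq hb, Real.rpow_add (by positivity), Real.rpow_natCast, one_div,
      Real.inv_rpow hz.le, Real.rpow_neg hz.le]
  have hsplit : ∀ {r : ℝ}, 0 < r → ∀ k : ℕ, r ^ (b + k - 1) = r ^ (b - 1) * r ^ k := by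
    intro r hr k
    rw [show b + k - 1 = b - 1 + k by ring, Real.rpow_add hr, Real.rpow_natCast]
  refine IsBigO.of_bound (C * poch b N) ?_
  filter_upwards [eventually_gt_atTop 0] with z hz
  rw [Real.norm_eq_abs, Real.norm_of_nonneg (by positivity)]
  have hiN : IntegrableOn (fun r : ℝ => r ^ (b - 1) *
      (if r < 1 then (1 - r / 2) ^ (b - 1) else 0) * Real.exp (-(z * r))) (Set.Ioi 0) := by
    refine (integrable_and_abs_integral_le (C := C1) ?_ (hpow hz 0).1 ?_).1
    · exact ((by fun_prop : Measurable fun r : ℝ => r ^ (b - 1)).mul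
        (Measurable.ite measurableSet_Iio (by fun_prop) measurable_const)).mul (by fun_prop)
    · filter_upwards [ae_restrict_mem measurableSet_Ioi] with r hr
      have hr0 : 0 < r := hr
      have := hC1 r hr0
      simp only [Finset.range_zero, Finset.sum_empty, sub_zero, pow_zero, mul_one] at this
      rw [abs_mul, abs_mul, abs_of_nonneg (by positivity : 0 ≤ r ^ (b - 1)), Real.abs_exp,
        hsplit hr0]
      calc _ ≤ r ^ (b - 1) * C1 * Real.exp (-(z * r)) := by gcongr
        _ = _ := by ring
  have hk : ∀ k, Integrable (fun r : ℝ => genBinom (b - 1) k * (-(1 / 2)) ^ k *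
      (r ^ (b + k - 1) * Real.exp (-(z * r)))) (volume.restrict (Set.Ioi 0)) :=
    fun k => (hpow hz k).1.const_mul _
  have e : z ^ b / Real.Gamma b * (∫ r in Set.Ioi (0 : ℝ), r ^ (b - 1) *
      (if r < 1 then (1 - r / 2) ^ (b - 1) else 0) * Real.exp (-(z * r))) -
      ∑ k ∈ range N, besselCoef (b + 1 / 2) k * z⁻¹ ^ k = z ^ b / Real.Gamma b *
      ∫ r in Set.Ioi (0 : ℝ), (r ^ (b - 1) *
        (if r < 1 then (1 - r / 2) ^ (b - 1) else 0) * Real.exp (-(z * r)) -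
        ∑ k ∈ range N, genBinom (b - 1) k * (-(1 / 2)) ^ k *
          (r ^ (b + k - 1) * Real.exp (-(z * r)))) := by
    rw [integral_sub hiN (integrable_finsetSum _ fun k _ => hk k),
      integral_finsetSum _ fun k _ => hk k, mul_sub, Finset.mul_sum]
    congr 1
    refine Finset.sum_congr rfl fun k _ => ?_
    rw [integral_const_mul, (hpow hz k).2, besselCoef,
      show (3 / 2 - (b + 1 / 2)) = 1 - b by ring, show b + 1 / 2 - 1 / 2 = b by ring]
    have h1 := genBinom_mul_neg_one_pow b k
    have h2 : (-(1 / 2) : ℝ) ^ k = (-1) ^ k * (2 ^ k)⁻¹ := by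
      rw [← inv_pow, ← mul_pow]; norm_num
    have hzb : z ^ b * z ^ (-b) = 1 := by rw [← Real.rpow_add hz]; simp
    calc _ = (poch (1 - b) k / k.factorial) * poch b k * (2 ^ k)⁻¹ * z⁻¹ ^ k := by
          field_simp
      _ = (genBinom (b - 1) k * (-1) ^ k) * poch b k * (2 ^ k)⁻¹ * z⁻¹ ^ k *
          (z ^ b * z ^ (-b)) := by rw [h1, hzb, mul_one]
      _ = _ := by rw [h2]; field_simp
  rw [e, abs_mul, abs_of_pos (by positivity)]
  have key := (integrable_and_abs_integral_le (C := C) (χ := volume.restrict (Set.Ioi (0 : ℝ)))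
    (F := fun r => r ^ (b - 1) *
        (if r < 1 then (1 - r / 2) ^ (b - 1) else 0) * Real.exp (-(z * r)) -
        ∑ k ∈ range N, genBinom (b - 1) k * (-(1 / 2)) ^ k *
          (r ^ (b + k - 1) * Real.exp (-(z * r)))) ?_ (hpow hz N).1 ?_).2
  · rw [(hpow hz N).2] at key
    have hzb : z ^ b * z ^ (-b) = 1 := by rw [← Real.rpow_add hz]; simp
    calc _ ≤ z ^ b / Real.Gamma b *
          (C * (z ^ (-b) * z⁻¹ ^ N * (Real.Gamma b * poch b N))) := by gcongr
      _ = C * poch b N * z⁻¹ ^ N * (z ^ b * z ^ (-b)) := by field_simp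
      _ = _ := by rw [hzb, mul_one]
  · refine Measurable.sub ?_ (by fun_prop)
    exact ((by fun_prop : Measurable fun r : ℝ => r ^ (b - 1)).mul
        (Measurable.ite measurableSet_Iio (by fun_prop) measurable_const)).mul (by fun_prop)
  · filter_upwards [ae_restrict_mem measurableSet_Ioi] with r hr
    have hr0 : 0 < r := hr
    have e3 : r ^ (b - 1) *
        (if r < 1 then (1 - r / 2) ^ (b - 1) else 0) * Real.exp (-(z * r)) -
        ∑ k ∈ range N, genBinom (b - 1) k * (-(1 / 2)) ^ k *
          (r ^ (b + k - 1) * Real.exp (-(z * r))) =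
        r ^ (b - 1) * Real.exp (-(z * r)) * ((if r < 1 then (1 - r / 2) ^ (b - 1) else 0) -
          ∑ k ∈ range N, genBinom (b - 1) k * (-(r / 2)) ^ k) := by
      rw [mul_sub, Finset.mul_sum]
      congr 1
      · ring
      · refine Finset.sum_congr rfl fun k _ => ?_
        rw [hsplit hr0, show -(r / 2) = -(1 / 2) * r by ring, mul_pow]
        ring
    rw [e3, abs_mul, abs_of_nonneg (by positivity), hsplit hr0]
    calc _ ≤ r ^ (b - 1) * Real.exp (-(z * r)) * (C * r ^ N) := by
          gcongr
          exact hC r hr0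
      _ = _ := by ring

lemma mul_two_sub_rpow {r : ℝ} (hr : r ∈ Set.Ioo (0 : ℝ) 1) (c : ℝ) :
    (r * (2 - r)) ^ c = 2 ^ c * (r ^ c * (1 - r / 2) ^ c) := by
  have h1 : 0 ≤ 1 - r / 2 := by linarith [hr.2]
  rw [show r * (2 - r) = 2 * (r * (1 - r / 2)) by ring,
    Real.mul_rpow (by norm_num) (mul_nonneg hr.1.le h1), Real.mul_rpow hr.1.le h1]

lemma integrableOn_rpow_mul_one_sub_half_rpow {b : ℝ} (hb : 0 < b) :
    IntegrableOn (fun r : ℝ => r ^ (b - 1) * (1 - r / 2) ^ (b - 1)) (Set.Ioo 0 1) := by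
  refine ((besselSum_eq_integral_exp hb 0).1.const_mul (2 * 2 ^ (b - 1))⁻¹).congr ?_
  filter_upwards [ae_restrict_mem measurableSet_Ioo] with r hr
  have h2 : (0 : ℝ) < 2 ^ (b - 1) := by positivity
  rw [mul_two_sub_rpow hr]
  simp
  field_simp
  ring

lemma integrableOn_rpow_mul_exp_of_le_one {b : ℝ} (hb : 0 < b) {g : ℝ → ℝ} (hg : Measurable g)
    (hg1 : ∀ r ∈ Set.Ioo (0 : ℝ) 1, g r ≤ 1) (hg0 : ∀ r ∈ Set.Ioo (0 : ℝ) 1, 0 ≤ g r) :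
    IntegrableOn (fun r : ℝ => r ^ (b - 1) * (1 - r / 2) ^ (b - 1) * g r) (Set.Ioo 0 1) := by
  refine (integrable_and_abs_integral_le (C := 1) (by fun_prop)
    (integrableOn_rpow_mul_one_sub_half_rpow hb) ?_).1
  filter_upwards [ae_restrict_mem measurableSet_Ioo] with r hr
  have hr0 : 0 < r := hr.1
  have h1 : 0 ≤ 1 - r / 2 := by linarith [hr.2]
  have := hg0 r hr
  rw [abs_of_nonneg (by positivity), one_mul]
  exact mul_le_of_le_one_right (by positivity) (hg1 r hr)

lemma besselNorm_eq {b z : ℝ} (hb : 0 < b) (hz : 0 < z) :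
    besselNorm (b + 1 / 2) z = z ^ b / Real.Gamma b * (∫ r in Set.Ioi (0 : ℝ), r ^ (b - 1) *
      (if r < 1 then (1 - r / 2) ^ (b - 1) else 0) * Real.exp (-(z * r))) +
      z ^ b / Real.Gamma b * ∫ r in Set.Ioo (0 : ℝ) 1, r ^ (b - 1) * (1 - r / 2) ^ (b - 1) *
        Real.exp (-(z * (2 - r))) := by
  have hG := Real.Gamma_pos_of_pos hb
  have h1 : ∫ r in Set.Ioi (0 : ℝ), r ^ (b - 1) *
      (if r < 1 then (1 - r / 2) ^ (b - 1) else 0) * Real.exp (-(z * r)) =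
      ∫ r in Set.Ioo (0 : ℝ) 1, r ^ (b - 1) * (1 - r / 2) ^ (b - 1) * Real.exp (-(z * r)) := by
    rw [← integral_indicator measurableSet_Ioi, ← integral_indicator measurableSet_Ioo]
    congr 1
    ext r
    by_cases h0 : 0 < r <;> by_cases h1 : r < 1 <;> simp [Set.indicator, h0, h1]
  rw [h1, ← mul_add, ← integral_add]
  · have h2 := (besselSum_eq_integral_exp hb z).2
    have h3 : ∀ r ∈ Set.Ioo (0 : ℝ) 1, (r * (2 - r)) ^ (b - 1) * (Real.exp (z * (1 - r)) +
        Real.exp (-(z * (1 - r)))) = 2 ^ (b - 1) * Real.exp z *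
        (r ^ (b - 1) * (1 - r / 2) ^ (b - 1) * Real.exp (-(z * r)) +
          r ^ (b - 1) * (1 - r / 2) ^ (b - 1) * Real.exp (-(z * (2 - r)))) := by
      intro r hr
      rw [mul_two_sub_rpow hr, show z * (1 - r) = z + -(z * r) by ring,
        show -(z + -(z * r)) = z + -(z * (2 - r)) by ring, Real.exp_add, Real.exp_add]
      ring
    rw [setIntegral_congr_fun measurableSet_Ioo h3, integral_const_mul] at h2
    generalize (∫ r in Set.Ioo (0 : ℝ) 1, (r ^ (b - 1) * (1 - r / 2) ^ (b - 1) *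
      Real.exp (-(z * r)) + r ^ (b - 1) * (1 - r / 2) ^ (b - 1) *
      Real.exp (-(z * (2 - r))))) = J at h2 ⊢
    have h4 : besselSum (b + 1 / 2) (z ^ 2) = (Real.sqrt Real.pi * Real.Gamma b)⁻¹ *
        (Real.sqrt Real.pi * Real.Gamma b * besselSum (b + 1 / 2) (z ^ 2)) := by
      field_simp
    rw [besselNorm, h4, ← h2, show b + 1 / 2 - 1 = b - 1 / 2 by ring,
      Real.div_rpow hz.le (by norm_num), Real.rpow_sub hz, Real.rpow_sub two_pos,
      Real.rpow_sub two_pos, Real.rpow_one, ← Real.sqrt_eq_rpow, ← Real.sqrt_eq_rpow,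
      Real.sqrt_mul (by positivity), Real.sqrt_mul (by norm_num), Real.exp_neg]
    have hs2 : Real.sqrt 2 ^ 2 = 2 := Real.sq_sqrt (by norm_num)
    field_simp
    rw [hs2]
    ring
  · refine integrableOn_rpow_mul_exp_of_le_one hb (by fun_prop) (fun r hr => ?_)
      fun r _ => (Real.exp_pos _).le
    exact Real.exp_le_one_iff.2 (by have := hr.1; nlinarith)
  · refine integrableOn_rpow_mul_exp_of_le_one hb (by fun_prop) (fun r hr => ?_)
      fun r _ => (Real.exp_pos _).le
    exact Real.exp_le_one_iff.2 (by have := hr.2; nlinarith)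

lemma hasExp_besselNorm_of_half_lt {b : ℝ} (hb : 0 < b) :
    HasExp (besselNorm (b + 1 / 2)) (besselCoef (b + 1 / 2)) := by
  intro N
  have hG := Real.Gamma_pos_of_pos hb
  set I := ∫ r in Set.Ioo (0 : ℝ) 1, r ^ (b - 1) * (1 - r / 2) ^ (b - 1) with hI
  have hI0 : 0 ≤ I := setIntegral_nonneg measurableSet_Ioo fun r hr => by
    have hr0 : 0 < r := hr.1
    have h1 : 0 ≤ 1 - r / 2 := by linarith [hr.2]
    positivity
  have hrem : (fun z : ℝ => z ^ b / Real.Gamma b * ∫ r in Set.Ioo (0 : ℝ) 1,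
      r ^ (b - 1) * (1 - r / 2) ^ (b - 1) * Real.exp (-(z * (2 - r)))) =O[atTop]
        fun z => z⁻¹ ^ N := by
    have h1 : (fun z : ℝ => z ^ b / Real.Gamma b * ∫ r in Set.Ioo (0 : ℝ) 1,
        r ^ (b - 1) * (1 - r / 2) ^ (b - 1) * Real.exp (-(z * (2 - r)))) =O[atTop]
          fun z => z ^ b * Real.exp (-1 * z) := by
      refine IsBigO.of_bound (I / Real.Gamma b) ?_
      filter_upwards [eventually_gt_atTop 0] with z hz
      have key := (integrable_and_abs_integral_le (C := Real.exp (-1 * z))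
        (χ := volume.restrict (Set.Ioo (0 : ℝ) 1))
        (F := fun r => r ^ (b - 1) * (1 - r / 2) ^ (b - 1) * Real.exp (-(z * (2 - r))))
        (by fun_prop) (integrableOn_rpow_mul_one_sub_half_rpow hb) ?_).2
      · rw [norm_mul, Real.norm_of_nonneg (by positivity), Real.norm_eq_abs,
          Real.norm_of_nonneg (by positivity)]
        calc _ ≤ z ^ b / Real.Gamma b * (Real.exp (-1 * z) * I) := by gcongr
          _ = _ := by ring
      · filter_upwards [ae_restrict_mem measurableSet_Ioo] with r hr
        have hr0 : 0 < r := hr.1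
        have h1 : 0 ≤ 1 - r / 2 := by linarith [hr.2]
        rw [abs_of_nonneg (by positivity), mul_comm (Real.exp _)]
        gcongr
        have := hr.2
        nlinarith
    refine h1.trans ?_
    have h2 := (isBigO_refl (fun z : ℝ => z ^ b) atTop).mul
      (isLittleO_exp_neg_mul_rpow_atTop one_pos (-(b + N))).isBigO
    refine h2.trans_eventuallyEq ?_
    filter_upwards [eventually_gt_atTop 0] with z hz
    rw [← Real.rpow_add hz, show b + -(b + N) = -(N : ℝ) by ring, Real.rpow_neg hz.le,
      Real.rpow_natCast, inv_pow]
  refine ((watson_isBigO hb N).add hrem).congr' ?_ EventuallyEq.rfl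
  filter_upwards [eventually_gt_atTop 0] with z hz
  rw [besselNorm_eq hb hz]
  ring

lemma hasExp_besselNorm_half : HasExp (besselNorm (1 / 2)) (besselCoef (1 / 2)) := by
  have hc : besselCoef (1 / 2) = fun k => if k = 0 then 1 else 0 := by
    ext k
    cases k with
    | zero => simp [besselCoef, poch]
    | succ k => rw [besselCoef, show (1 / 2 : ℝ) - 1 / 2 = 0 by norm_num, poch_succ_left 0]; simp
  have hB : ∀ z : ℝ, 0 < z → besselNorm (1 / 2) z = 1 + Real.exp (-2 * z) := by
    intro z hz
    have h1 : besselSum (1 / 2) (z ^ 2) = (Real.sqrt Real.pi)⁻¹ * Real.cosh z := by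
      rw [Real.cosh_eq_tsum, besselSum, ← tsum_mul_left]
      refine tsum_congr fun j => ?_
      have h := Gamma_half_mul_factorial j
      have hG : 0 < Real.Gamma (1 / 2 + j) := Real.Gamma_pos_of_pos (by positivity)
      rw [div_pow, ← pow_mul]
      generalize Real.Gamma (1 / 2 + (j : ℝ)) = G₁ at h hG ⊢
      field_simp
      linear_combination -h
    have h2 : (z / 2) ^ ((1 / 2 : ℝ) - 1) = (Real.sqrt (z / 2))⁻¹ := by
      rw [show (1 / 2 : ℝ) - 1 = -(1 / 2) by norm_num, Real.rpow_neg (by positivity),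
        Real.sqrt_eq_rpow]
    have h3 : Real.sqrt (2 * Real.pi * z) = 2 * Real.sqrt Real.pi * Real.sqrt (z / 2) := by
      rw [show 2 * Real.pi * z = 2 ^ 2 * Real.pi * (z / 2) by ring, Real.sqrt_mul (by positivity),
        Real.sqrt_mul (by positivity), Real.sqrt_sq (by norm_num)]
    have h4 : Real.exp (-2 * z) = Real.exp (-z) * Real.exp (-z) := by
      rw [← Real.exp_add]; congr 1; ring
    have h5 : Real.exp z * Real.exp (-z) = 1 := by rw [← Real.exp_add]; simp
    have h6 : 0 < Real.sqrt (z / 2) := Real.sqrt_pos.2 (by positivity)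
    rw [besselNorm, h1, h2, h3, h4, Real.cosh_eq]
    field_simp
    linear_combination h5
  rw [hc]
  intro N
  have hrem : (fun z : ℝ => Real.exp (-2 * z)) =O[atTop] fun z => z⁻¹ ^ N := by
    refine (isLittleO_exp_neg_mul_rpow_atTop two_pos (-(N : ℝ))).isBigO.trans_eventuallyEq ?_
    filter_upwards [eventually_gt_atTop 0] with z hz
    rw [Real.rpow_neg hz.le, Real.rpow_natCast, inv_pow]
  refine ((hasExp_one N).add hrem).congr' ?_ EventuallyEq.rfl
  filter_upwards [eventually_gt_atTop 0] with z hz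
  rw [hB z hz]
  ring

lemma hasExp_besselNorm {d : ℝ} (hd : 1 / 2 ≤ d) : HasExp (besselNorm d) (besselCoef d) := by
  rcases hd.eq_or_lt with rfl | h
  · exact hasExp_besselNorm_half
  · have := hasExp_besselNorm_of_half_lt (b := d - 1 / 2) (by linarith)
    rwa [sub_add_cancel] at this

lemma mul_inv_mul_sqrtQuot_le {x v : ℝ} (hx : 0 ≤ x) (hv : 0 < v) :
    x * v⁻¹ * sqrtQuot (x * v⁻¹ ^ 2) ≤ Real.sqrt x := by
  have h1 : Real.sqrt (x * v⁻¹ ^ 2) = Real.sqrt x * v⁻¹ := by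
    rw [Real.sqrt_mul hx, Real.sqrt_sq (by positivity)]
  have h2 : Real.sqrt (x * v⁻¹ ^ 2) ≤ Real.sqrt (1 + x * v⁻¹ ^ 2) :=
    Real.sqrt_le_sqrt (by linarith)
  have h3 := Real.sqrt_nonneg (1 + x * v⁻¹ ^ 2)
  have h4 : x * v⁻¹ = Real.sqrt x * (Real.sqrt x * v⁻¹) := by
    rw [← mul_assoc, Real.mul_self_sqrt hx]
  rw [sqrtQuot, h4, mul_assoc, ← div_eq_mul_inv, ← h1]
  refine mul_le_of_le_one_right (Real.sqrt_nonneg x) ?_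
  rw [div_le_one (by linarith)]
  linarith

section BesselMoment

variable {Ω : Type*} [MeasurableSpace Ω] {χ : Measure Ω} {wt u : Ω → ℝ} {b : ℝ}
variable (hb : 0 < b) (hwm : Measurable wt) (hum : Measurable u) (hw : ∀ q, 0 ≤ wt q)
  (hu : ∀ᵐ q ∂χ, 0 < u q)
  (hint : ∀ i : ℕ, Integrable (fun q => wt q * (1 + u q) ^ i * Real.exp (b * Real.sqrt (u q))) χ)
include hb hwm hum hw hu hint

lemma integrable_expMoment (a : ℝ) {v : ℝ} (hv : 1 ≤ v) :
    Integrable (fun q => wt q * ((1 + u q * v⁻¹ ^ 2) ^ a *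
      Real.exp (b * (u q * v⁻¹ * sqrtQuot (u q * v⁻¹ ^ 2))))) χ := by
  obtain ⟨A, hA⟩ := exists_nat_ge a
  refine (integrable_and_abs_integral_le (C := 1) (by fun_prop) (hint A) ?_).1
  filter_upwards [hu] with q hq
  have h0 := hw q
  have h1 : 0 ≤ (1 + u q * v⁻¹ ^ 2) ^ a := by positivity
  rw [abs_of_nonneg (by positivity), one_mul, mul_assoc (wt q)]
  refine mul_le_mul_of_nonneg_left (mul_le_mul (one_add_mul_inv_sq_rpow_le hA hq.le hv) ?_
    (Real.exp_pos _).le (by positivity)) h0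
  gcongr
  · exact mul_inv_mul_sqrtQuot_le hq.le (by linarith)

/-- Expansion of the Laplace type integral weighted by a normalized Bessel factor. -/
lemma hasExp_besselMoment {d : ℝ} (hd : 1 / 2 ≤ d) (a : ℝ) :
    HasExp (fun v => ∫ q, wt q * ((1 + u q * v⁻¹ ^ 2) ^ a *
      Real.exp (b * (u q * v⁻¹ * sqrtQuot (u q * v⁻¹ ^ 2))) *
      besselNorm d (b * v * Real.sqrt (1 + u q * v⁻¹ ^ 2))) ∂χ)
      fun p => ∑ k ∈ range (p + 1), if 1 * k ≤ p then besselCoef d k * b⁻¹ ^ k *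
        ∑ i ∈ Icc ((p - 1 * k + 1) / 2) (p - 1 * k),
          puiseuxG (a - k / 2) b i (p - 1 * k) * ∫ q, wt q * u q ^ i ∂χ else 0 := by
  set E : ℝ → ℝ → ℝ := fun a v => ∫ q, wt q * ((1 + u q * v⁻¹ ^ 2) ^ a *
      Real.exp (b * (u q * v⁻¹ * sqrtQuot (u q * v⁻¹ ^ 2)))) ∂χ with hE
  have hexp := fun a => hasExp_expMoment hb.le hwm hum hw hu hint a
  refine HasExp.of_shift (w := 1)
    (g := fun k v => besselCoef d k * b⁻¹ ^ k * E (a - k / 2) v)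
    (c := fun k p => besselCoef d k * b⁻¹ ^ k *
      ∑ i ∈ Icc ((p + 1) / 2) p, puiseuxG (a - k / 2) b i p * ∫ q, wt q * u q ^ i ∂χ)
    le_rfl (fun K => ?_) fun k => (hexp (a - k / 2)).const_mul _
  obtain ⟨C, hC0, hC⟩ := (hasExp_besselNorm hd K).exists_nonneg
  obtain ⟨Z, hZ⟩ := eventually_atTop.1 hC.bound
  have hO := (hexp (a - K / 2)).isBigO_one
  have hkey : (fun v => (∫ q, wt q * ((1 + u q * v⁻¹ ^ 2) ^ a *
      Real.exp (b * (u q * v⁻¹ * sqrtQuot (u q * v⁻¹ ^ 2))) *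
      besselNorm d (b * v * Real.sqrt (1 + u q * v⁻¹ ^ 2))) ∂χ) -
      ∑ k ∈ range K, v⁻¹ ^ (1 * k) * (besselCoef d k * b⁻¹ ^ k * E (a - k / 2) v))
      =O[atTop] fun v => v⁻¹ ^ K * E (a - K / 2) v := by
    refine IsBigO.of_bound (C * b⁻¹ ^ K) ?_
    filter_upwards [eventually_ge_atTop 1, eventually_ge_atTop (Z / b)] with v hv hvZ
    have hv0 : 0 < v := by linarith
    have hI := fun a => integrable_expMoment hb hwm hum hw hu hint a hv
    have hI' : Integrable (fun q => ∑ k ∈ range K, v⁻¹ ^ (1 * k) * (besselCoef d k * b⁻¹ ^ k *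
        (wt q * ((1 + u q * v⁻¹ ^ 2) ^ (a - k / 2) *
      Real.exp (b * (u q * v⁻¹ * sqrtQuot (u q * v⁻¹ ^ 2))))))) χ :=
      integrable_finsetSum _ fun k _ => ((hI _).const_mul _).const_mul _
    have hS : ∑ k ∈ range K, v⁻¹ ^ (1 * k) * (besselCoef d k * b⁻¹ ^ k * E (a - k / 2) v) =
        ∫ q, ∑ k ∈ range K, v⁻¹ ^ (1 * k) * (besselCoef d k * b⁻¹ ^ k *
        (wt q * ((1 + u q * v⁻¹ ^ 2) ^ (a - k / 2) *
      Real.exp (b * (u q * v⁻¹ * sqrtQuot (u q * v⁻¹ ^ 2)))))) ∂χ := by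
      rw [integral_finsetSum _ fun k _ => ((hI _).const_mul _).const_mul _]
      simp only [integral_const_mul, hE]
    have hBm := measurable_besselNorm hd
    have hR := integrable_and_abs_integral_le (C := C * b⁻¹ ^ K * v⁻¹ ^ K)
      (F := fun q => wt q * ((1 + u q * v⁻¹ ^ 2) ^ a *
      Real.exp (b * (u q * v⁻¹ * sqrtQuot (u q * v⁻¹ ^ 2))) *
      besselNorm d (b * v * Real.sqrt (1 + u q * v⁻¹ ^ 2))) -
      ∑ k ∈ range K, v⁻¹ ^ (1 * k) * (besselCoef d k * b⁻¹ ^ k *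
        (wt q * ((1 + u q * v⁻¹ ^ 2) ^ (a - k / 2) *
      Real.exp (b * (u q * v⁻¹ * sqrtQuot (u q * v⁻¹ ^ 2)))))))
      (by fun_prop) (hI (a - K / 2)) ?_
    · have hI0 : Integrable (fun q => wt q * ((1 + u q * v⁻¹ ^ 2) ^ a *
          Real.exp (b * (u q * v⁻¹ * sqrtQuot (u q * v⁻¹ ^ 2))) *
          besselNorm d (b * v * Real.sqrt (1 + u q * v⁻¹ ^ 2)))) χ := by
        refine (hR.1.add hI').congr (Eventually.of_forall fun q => ?_)
        simp
      rw [hS, ← integral_sub hI0 hI', Real.norm_eq_abs]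
      refine hR.2.trans ?_
      rw [norm_mul, Real.norm_of_nonneg (by positivity), mul_assoc (C * b⁻¹ ^ K)]
      gcongr
      exact Real.le_norm_self _
    · filter_upwards [hu] with q hq
      have h0 := hw q
      have hτ : 0 ≤ u q * v⁻¹ ^ 2 := by positivity
      set W := Real.sqrt (1 + u q * v⁻¹ ^ 2) with hW
      have hW1 : 1 ≤ W := by rw [hW]; exact Real.one_le_sqrt.2 (by linarith)
      have hzb : Z ≤ b * v * W := by
        have : Z ≤ b * v := by rwa [div_le_iff₀ hb, mul_comm] at hvZ
        nlinarith [mul_pos hb hv0]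
      have hz := hZ _ hzb
      have hpow : ∀ k : ℕ, (1 + u q * v⁻¹ ^ 2) ^ (a - k / 2) =
          (1 + u q * v⁻¹ ^ 2) ^ a * W⁻¹ ^ k := by
        intro k
        have h1 : W ^ k = (1 + u q * v⁻¹ ^ 2) ^ ((k : ℝ) / 2) := by
          rw [hW, Real.sqrt_eq_rpow, ← Real.rpow_mul_natCast (by linarith),
            show 1 / 2 * (k : ℝ) = k / 2 by ring]
        rw [Real.rpow_sub (by linarith), inv_pow W, h1, div_eq_mul_inv]
      have hinv : ∀ k : ℕ, (b * v * W)⁻¹ ^ k = b⁻¹ ^ k * v⁻¹ ^ k * W⁻¹ ^ k := by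
        intro k; rw [mul_inv, mul_inv, mul_pow, mul_pow]
      have hTa : 0 ≤ (1 + u q * v⁻¹ ^ 2) ^ a := by positivity
      rw [Real.norm_eq_abs, Real.norm_of_nonneg (by positivity), hinv] at hz
      simp only [hinv] at hz
      simp only [hpow]
      set e := Real.exp (b * (u q * v⁻¹ * sqrtQuot (u q * v⁻¹ ^ 2)))
      have he : 0 < e := Real.exp_pos _
      set T := (1 + u q * v⁻¹ ^ 2) ^ a
      have hfac : wt q * (T * e * besselNorm d (b * v * W)) -
          ∑ k ∈ range K, v⁻¹ ^ (1 * k) * (besselCoef d k * b⁻¹ ^ k *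
            (wt q * (T * W⁻¹ ^ k * e))) = (wt q * T * e) * (besselNorm d (b * v * W) -
          ∑ k ∈ range K, besselCoef d k * (b⁻¹ ^ k * v⁻¹ ^ k * W⁻¹ ^ k)) := by
        rw [mul_sub, Finset.mul_sum]
        congr 1
        · ring
        · refine Finset.sum_congr rfl fun k _ => ?_
          rw [one_mul]; ring
      rw [hfac, abs_mul, abs_of_nonneg (by positivity)]
      calc _ ≤ wt q * T * e * (C * (b⁻¹ ^ K * v⁻¹ ^ K * W⁻¹ ^ K)) := by gcongr
        _ = _ := by ring
  refine hkey.trans ?_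
  simpa only [mul_one] using (isBigO_refl (fun v : ℝ => v⁻¹ ^ K) atTop).mul hO

end BesselMoment

/-- The noncentral chi-squared law with `2 d` degrees of freedom and noncentrality `lam`. -/
def ncChi (d lam : ℝ) : Measure ℝ :=
  (volume.restrict (Set.Ioi 0)).withDensity fun p => ENNReal.ofReal (ncChiPDF d lam p)

lemma isProbabilityMeasure_ncChi {d lam : ℝ} (hd : 1 / 2 ≤ d) (hl : 0 ≤ lam) :
    IsProbabilityMeasure (ncChi d lam) := by
  have h := ncChiPDF_moment hd hl (c := 1 / 2) (by norm_num) 0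
  simp only [pow_zero, sub_self, zero_mul, neg_zero, Real.exp_zero, one_mul, Nat.cast_zero,
    add_zero, poch, Finset.range_zero, Finset.prod_empty, mul_one] at h
  constructor
  rw [ncChi, withDensity_apply _ MeasurableSet.univ, Measure.restrict_univ,
    ← ofReal_integral_eq_lintegral_ofReal h.1, h.2]
  · norm_num
    rw [hypM_self (by linarith), ← Real.exp_add, show -lam / 2 + lam / 2 = 0 by ring, Real.exp_zero]
  · filter_upwards [ae_restrict_mem measurableSet_Ioi] with p hp
    exact ncChiPDF_nonneg hd hl (le_of_lt hp)

lemma image_sq_add_div_Ioi {α : ℝ} (hα : 0 < α) {t e : ℝ} (ht : 0 ≤ t) :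
    (fun v : ℝ => (v ^ 2 + e) / α) '' Set.Ioi (Real.sqrt t) = Set.Ioi ((t + e) / α) := by
  ext p
  simp only [Set.mem_image, Set.mem_Ioi]
  constructor
  · rintro ⟨v, hv, rfl⟩
    have : t < v ^ 2 := (Real.sqrt_lt' ((Real.sqrt_nonneg t).trans_lt hv)).1 hv
    gcongr
  · intro hp
    rw [div_lt_iff₀ hα] at hp
    refine ⟨Real.sqrt (p * α - e), Real.sqrt_lt_sqrt ht (by linarith), ?_⟩
    rw [Real.sq_sqrt (by linarith)]
    field_simp
    ring

lemma lintegral_Ioi_sq_add_div {α : ℝ} (hα : 0 < α) {t e : ℝ} (ht : 0 ≤ t) (g : ℝ → ENNReal) :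
    ∫⁻ p in Set.Ioi ((t + e) / α), g p =
      ∫⁻ v in Set.Ioi (Real.sqrt t), ENNReal.ofReal (2 * v / α) * g ((v ^ 2 + e) / α) := by
  rw [← image_sq_add_div_Ioi hα ht, lintegral_image_eq_lintegral_abs_deriv_mul measurableSet_Ioi
    (f' := fun v => 2 * v / α)]
  · refine setLIntegral_congr_fun measurableSet_Ioi fun v hv => ?_
    have : 0 < v := (Real.sqrt_nonneg t).trans_lt hv
    rw [abs_of_nonneg (by positivity)]
  · intro v _
    have := (((hasDerivAt_pow 2 v).add_const e).div_const α).hasDerivWithinAt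
      (s := Set.Ioi (Real.sqrt t))
    simpa using this
  · intro v hv w hw h
    have hv0 : 0 < v := (Real.sqrt_nonneg t).trans_lt hv
    have hw0 : 0 < w := (Real.sqrt_nonneg t).trans_lt hw
    have h' : v ^ 2 = w ^ 2 := by
      simp only at h
      field_simp at h
      linarith
    exact (pow_left_inj₀ hv0.le hw0.le two_ne_zero).1 h'

lemma prod_ncChi_tail {d lam mu α β t : ℝ} (hd : 1 / 2 ≤ d) (hl : 0 ≤ lam) (hm : 0 ≤ mu)
    (hα : 0 < α) (hβ : 0 < β) (ht : 0 < t) :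
    ((ncChi d lam).prod (ncChi d mu) {z | t ≤ α * z.1 - β * z.2}).toReal =
      ∫ v in Set.Ioi (Real.sqrt t), ∫ q in Set.Ioi 0,
        2 * v / α * ncChiPDF d lam ((v ^ 2 + β * q) / α) * ncChiPDF d mu q := by
  have hfl := measurable_ncChiPDF hd lam
  have hfm := measurable_ncChiPDF hd mu
  have := isProbabilityMeasure_ncChi hd hl
  have := isProbabilityMeasure_ncChi hd hm
  set G : ℝ → ℝ → ℝ := fun v q =>
    2 * v / α * ncChiPDF d lam ((v ^ 2 + β * q) / α) * ncChiPDF d mu q with hG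
  have hGm : Measurable (Function.uncurry G) := by
    unfold Function.uncurry
    simp only [hG]
    fun_prop
  have hG0 : ∀ v ∈ Set.Ioi (Real.sqrt t), ∀ q ∈ Set.Ioi (0 : ℝ), 0 ≤ G v q := by
    intro v hv q hq
    have hv0 : 0 < v := (Real.sqrt_nonneg t).trans_lt hv
    have hq0 : 0 < q := hq
    have h1 := ncChiPDF_nonneg (p := (v ^ 2 + β * q) / α) hd hl (by positivity)
    have h2 := ncChiPDF_nonneg hd hm hq0.le
    simp only [hG]
    positivity
  have hms : MeasurableSet {z : ℝ × ℝ | t ≤ α * z.1 - β * z.2} :=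
    measurableSet_le measurable_const (by fun_prop)
  have hT : (ncChi d lam).prod (ncChi d mu) {z | t ≤ α * z.1 - β * z.2} =
      ∫⁻ v in Set.Ioi (Real.sqrt t), ∫⁻ q in Set.Ioi 0, ENNReal.ofReal (G v q) := by
    rw [Measure.prod_apply_symm hms, lintegral_lintegral_swap]
    · conv_lhs => rw [ncChi]
      rw [lintegral_withDensity_eq_lintegral_mul₀ (by fun_prop)
        (measurable_measure_prodMk_right hms).aemeasurable]
      refine setLIntegral_congr_fun measurableSet_Ioi fun q hq => ?_
      have hq0 : 0 < q := hq
      have h2 := ncChiPDF_nonneg hd hm hq0.le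
      have e1 : ((fun x => (x, q)) ⁻¹' {z : ℝ × ℝ | t ≤ α * z.1 - β * z.2}) =
          Set.Ici ((t + β * q) / α) := by
        ext p
        simp only [Set.mem_preimage, Set.mem_ofPred_eq, Set.mem_Ici, div_le_iff₀ hα]
        constructor <;> intro h <;> linarith
      have e2 : ncChi d lam (Set.Ici ((t + β * q) / α)) =
          ∫⁻ p in Set.Ioi ((t + β * q) / α), ENNReal.ofReal (ncChiPDF d lam p) := by
        rw [ncChi, withDensity_apply _ measurableSet_Ici, Measure.restrict_restrict
          measurableSet_Ici, Set.inter_eq_left.2, restrict_Ioi_eq_restrict_Ici]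
        intro p hp
        exact lt_of_lt_of_le (by positivity) (Set.mem_Ici.1 hp)
      simp only [Pi.mul_apply]
      rw [e1, e2, lintegral_Ioi_sq_add_div hα ht.le, ← lintegral_const_mul _ (by fun_prop)]
      refine setLIntegral_congr_fun measurableSet_Ioi fun v hv => ?_
      have hv0 : 0 < v := (Real.sqrt_nonneg t).trans_lt hv
      have h1 := ncChiPDF_nonneg (p := (v ^ 2 + β * q) / α) hd hl (by positivity)
      simp only [hG]
      rw [← ENNReal.ofReal_mul (by positivity), ← ENNReal.ofReal_mul (by positivity), mul_comm]
    · exact (ENNReal.measurable_ofReal.comp hGm).aemeasurable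
  have hT2 : (ncChi d lam).prod (ncChi d mu) {z | t ≤ α * z.1 - β * z.2} =
      ∫⁻ z, ENNReal.ofReal (Function.uncurry G z)
        ∂((volume.restrict (Set.Ioi (Real.sqrt t))).prod (volume.restrict (Set.Ioi 0))) := by
    rw [hT, lintegral_prod]
    · rfl
    · exact (ENNReal.measurable_ofReal.comp hGm).aemeasurable
  have hnn : 0 ≤ᵐ[(volume.restrict (Set.Ioi (Real.sqrt t))).prod (volume.restrict (Set.Ioi 0))]
      Function.uncurry G := by
    rw [Measure.prod_restrict]
    filter_upwards [ae_restrict_mem (measurableSet_Ioi.prod measurableSet_Ioi)] with z hz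
    exact hG0 _ hz.1 _ hz.2
  have hint : Integrable (Function.uncurry G)
      ((volume.restrict (Set.Ioi (Real.sqrt t))).prod (volume.restrict (Set.Ioi 0))) := by
    refine ⟨hGm.aestronglyMeasurable, ?_⟩
    rw [hasFiniteIntegral_iff_ofReal hnn, ← hT2]
    exact measure_lt_top _ _
  rw [hT2, ← integral_eq_lintegral_of_nonneg_ae hnn hGm.aestronglyMeasurable, integral_prod _ hint]
  rfl

/-- The constant in front of the Laplace type representation of the tail of `α P - β Q`. -/
def tailConst (d α b : ℝ) : ℝ :=
  Real.exp (-(α * b ^ 2) / 2) / α * (α * b) ^ (1 - d) * (Real.sqrt (2 * Real.pi * b))⁻¹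

lemma rpow_factor {d α b v W : ℝ} (hα : 0 < α) (hb : 0 < b) (hv : 0 < v) (hW : 0 < W) :
    v * ((v * W) ^ 2 / α / 2) ^ (d - 1) =
      (α * b) ^ (1 - d) * (Real.sqrt (2 * Real.pi * b))⁻¹ * v ^ (d - 1 / 2) * W ^ (d - 3 / 2) *
        ((b * v * W / 2) ^ (d - 1) * Real.sqrt (2 * Real.pi * (b * v * W))) := by
  have hx : 0 < v * W := by positivity
  have h1 : (α * b) ^ (1 - d) * (b * v * W / 2) ^ (d - 1) = (v * W / (2 * α)) ^ (d - 1) := by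
    rw [show 1 - d = -(d - 1) by ring, Real.rpow_neg (by positivity), mul_comm, ← div_eq_mul_inv,
      ← Real.div_rpow (by positivity) (by positivity)]
    congr 1
    field_simp
  have h2 : v ^ (d - 1 / 2) * W ^ (d - 3 / 2) = v * (v * W) ^ (d - 3 / 2) := by
    rw [Real.mul_rpow hv.le hW.le, show d - 1 / 2 = 1 + (d - 3 / 2) by ring, Real.rpow_add hv,
      Real.rpow_one]
    ring
  have h3 : Real.sqrt (2 * Real.pi * (b * v * W)) =
      Real.sqrt (2 * Real.pi * b) * Real.sqrt (v * W) := by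
    rw [← Real.sqrt_mul (by positivity)]
    congr 1
    ring
  have h4 : (v * W) ^ (d - 3 / 2) * Real.sqrt (v * W) = (v * W) ^ (d - 1) := by
    rw [Real.sqrt_eq_rpow, ← Real.rpow_add hx]
    congr 1
    ring
  have h5 : ((v * W) ^ 2 / α / 2) ^ (d - 1) = (v * W / (2 * α)) ^ (d - 1) * (v * W) ^ (d - 1) := by
    rw [← Real.mul_rpow (by positivity) (by positivity)]
    congr 1
    field_simp
  have hs : 0 < Real.sqrt (2 * Real.pi * b) := Real.sqrt_pos.2 (by positivity)
  calc v * ((v * W) ^ 2 / α / 2) ^ (d - 1)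
      = ((α * b) ^ (1 - d) * (b * v * W / 2) ^ (d - 1)) * (v *
          ((v * W) ^ (d - 3 / 2) * Real.sqrt (v * W))) := by rw [h5, h1, h4]; ring
    _ = ((α * b) ^ (1 - d) * (b * v * W / 2) ^ (d - 1)) * (v ^ (d - 1 / 2) * W ^ (d - 3 / 2)) *
          Real.sqrt (v * W) := by rw [h2]; ring
    _ = _ := by
      rw [h3]
      field_simp

lemma ncChiPDF_factor {d α β b v q : ℝ} (hα : 0 < α) (hβ : 0 < β) (hb : 0 < b) (hv : 0 < v)
    (hq : 0 < q) (g : ℝ) :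
    2 * v / α * ncChiPDF d (α * b ^ 2) ((v ^ 2 + β * q) / α) * g =
      tailConst d α b * (v ^ (d - 1 / 2) * Real.exp (b * v - v ^ 2 / (2 * α)) *
        (Real.exp (-(β / (2 * α) * q)) * g * ((1 + β * q * v⁻¹ ^ 2) ^ (d / 2 - 3 / 4) *
          Real.exp (b * (β * q * v⁻¹ * sqrtQuot (β * q * v⁻¹ ^ 2))) *
          besselNorm d (b * v * Real.sqrt (1 + β * q * v⁻¹ ^ 2))))) := by
  have hW2 : Real.sqrt (1 + β * q * v⁻¹ ^ 2) ^ 2 = 1 + β * q * v⁻¹ ^ 2 :=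
    Real.sq_sqrt (by positivity)
  have hW : 0 < Real.sqrt (1 + β * q * v⁻¹ ^ 2) := Real.sqrt_pos.2 (by positivity)
  have hWd : (1 + β * q * v⁻¹ ^ 2) ^ (d / 2 - 3 / 4) =
      Real.sqrt (1 + β * q * v⁻¹ ^ 2) ^ (d - 3 / 2) := by
    rw [Real.sqrt_eq_rpow, ← Real.rpow_mul (by positivity)]
    congr 1
    ring
  rw [hWd, sqrtQuot]
  set W := Real.sqrt (1 + β * q * v⁻¹ ^ 2)
  have hβq : β * q = v ^ 2 * (W ^ 2 - 1) := by rw [hW2]; field_simp; ring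
  have e1 : v ^ 2 + β * q = (v * W) ^ 2 := by rw [hβq]; ring
  have e2 : β * q * v⁻¹ * (1 + W)⁻¹ = v * (W - 1) := by
    rw [hβq]; field_simp; ring
  have e3 : α * b ^ 2 * ((v * W) ^ 2 / α) = (b * v * W) ^ 2 := by field_simp
  have hexp : Real.exp (-(α * b ^ 2 + (v * W) ^ 2 / α) / 2) = Real.exp (-(α * b ^ 2) / 2) *
      Real.exp (b * v - v ^ 2 / (2 * α)) * Real.exp (-(β / (2 * α) * q)) *
      Real.exp (b * (v * (W - 1))) * Real.exp (-(b * v * W)) := by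
    simp only [← Real.exp_add]
    congr 1
    rw [← e1]
    field_simp
    ring
  rw [e1, e2, ncChiPDF, e3, hexp, besselNorm, tailConst]
  have key := rpow_factor (d := d) hα hb hv hW
  generalize Real.exp (-(α * b ^ 2) / 2) = x1
  generalize Real.exp (b * v - v ^ 2 / (2 * α)) = x2
  generalize Real.exp (-(β / (2 * α) * q)) = x3
  generalize Real.exp (b * (v * (W - 1))) = x4
  generalize Real.exp (-(b * v * W)) = x5
  generalize besselSum d ((b * v * W) ^ 2) = S
  calc _ = (v * ((v * W) ^ 2 / α / 2) ^ (d - 1)) * (x1 * x2 * x3 * x4 * x5 * S * g / α) := by ring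
    _ = _ := by rw [key]; ring

lemma exists_pow_mul_exp_bound {b θ β : ℝ} (hθ : 0 < θ) (hβ : 0 < β) (i : ℕ) :
    ∃ C, ∀ q : ℝ, 0 < q →
      Real.exp (-(θ * q)) * (1 + β * q) ^ i * Real.exp (b * Real.sqrt (β * q)) ≤ C := by
  have hq : ∀ q : ℝ, 0 < q → b * Real.sqrt (β * q) ≤ θ / 2 * q + b ^ 2 * β / (2 * θ) := by
    intro q hq
    have hs : Real.sqrt (β * q) ^ 2 = β * q := Real.sq_sqrt (by positivity)
    have h3 : 0 ≤ (θ * Real.sqrt (β * q) - b * β) ^ 2 := sq_nonneg _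
    have h4 : (θ * Real.sqrt (β * q) - b * β) ^ 2 =
        θ ^ 2 * (β * q) - 2 * θ * b * β * Real.sqrt (β * q) + b ^ 2 * β ^ 2 := by
      rw [sub_sq, mul_pow, hs]; ring
    rw [h4] at h3
    have h5 : θ / 2 * q + b ^ 2 * β / (2 * θ) - b * Real.sqrt (β * q) =
        (θ ^ 2 * (β * q) - 2 * θ * b * β * Real.sqrt (β * q) + b ^ 2 * β ^ 2) / (2 * θ * β) := by
      field_simp
      ring
    have h6 := div_nonneg h3 (show 0 ≤ 2 * θ * β by positivity)
    linarith
  have hpow : ∀ q : ℝ, 0 < q → (1 + β * q) ^ i ≤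
      i.factorial * (2 * β / θ) ^ i * Real.exp (θ / 2 * (q + 1 / β)) := by
    intro q hq
    have h1 := Real.pow_div_factorial_le_exp (θ / 2 * (q + 1 / β)) (by positivity) i
    rw [div_le_iff₀ (by positivity)] at h1
    have h3 : (1 + β * q) ^ i = (2 * β / θ) ^ i * (θ / 2 * (q + 1 / β)) ^ i := by
      rw [← mul_pow]
      congr 1
      field_simp
      ring
    rw [h3]
    calc _ ≤ (2 * β / θ) ^ i * (Real.exp (θ / 2 * (q + 1 / β)) * i.factorial) := by gcongr
      _ = _ := by ring
  refine ⟨i.factorial * (2 * β / θ) ^ i * Real.exp (θ / (2 * β) + b ^ 2 * β / (2 * θ)),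
    fun q hq0 => ?_⟩
  calc _ ≤ Real.exp (-(θ * q)) * (i.factorial * (2 * β / θ) ^ i *
        Real.exp (θ / 2 * (q + 1 / β))) * Real.exp (θ / 2 * q + b ^ 2 * β / (2 * θ)) := by
        gcongr
        · exact hpow q hq0
        · exact hq q hq0
    _ = i.factorial * (2 * β / θ) ^ i * (Real.exp (-(θ * q)) * Real.exp (θ / 2 * (q + 1 / β)) *
          Real.exp (θ / 2 * q + b ^ 2 * β / (2 * θ))) := by ring
    _ = _ := by
        simp only [← Real.exp_add]
        congr 2
        field_simp
        ring

/-- Coefficients of the expansion of the inner integral in the tail of `α P - (1 - α) Q`. -/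
def innerCoef (d α b mu : ℝ) (p : ℕ) : ℝ :=
  ∑ k ∈ range (p + 1), if 1 * k ≤ p then besselCoef d k * b⁻¹ ^ k *
    ∑ i ∈ Icc ((p - 1 * k + 1) / 2) (p - 1 * k), puiseuxG (d / 2 - 3 / 4 - k / 2) b i (p - 1 * k) *
      (Real.exp (-mu / 2) * α ^ d * (2 * α * (1 - α)) ^ i * poch d i *
        hypM (d + i) d (α * mu / 2)) else 0

lemma hasExp_ncChi_tail {d α b mu : ℝ} (hd : 1 / 2 ≤ d) (hα : 0 < α) (hα1 : α < 1) (hb : 0 < b)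
    (hm : 0 ≤ mu) :
    HasExp (fun V => ((ncChi d (α * b ^ 2)).prod (ncChi d mu)
        {z | V ^ 2 ≤ α * z.1 - (1 - α) * z.2}).toReal /
        (tailConst d α b * (α * V ^ (d - 3 / 2) * Real.exp (b * V - V ^ 2 / (2 * α)))))
      fun p => ∑ l ∈ range (p + 1), if 1 * l ≤ p then
        innerCoef d α b mu l * tailCoef b (2 * α) (d - 1 / 2 - l) (p - 1 * l) else 0 := by
  set β := 1 - α with hβdef
  have hβ : 0 < β := by linarith
  have hθ : 0 < β / (2 * α) := by positivity
  have hfm := measurable_ncChiPDF hd mu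
  have hBm := measurable_besselNorm hd
  set wt : ℝ → ℝ := (Set.Ioi 0).indicator fun q =>
    Real.exp (-(β / (2 * α) * q)) * ncChiPDF d mu q with hwt
  have hwtm : Measurable wt := Measurable.indicator (by fun_prop) measurableSet_Ioi
  have hwt_eq : ∀ q : ℝ, 0 < q → wt q = Real.exp (-(β / (2 * α) * q)) * ncChiPDF d mu q :=
    fun q hq => Set.indicator_of_mem (Set.mem_Ioi.2 hq) _
  have hwt0 : ∀ q, 0 ≤ wt q := fun q => Set.indicator_nonneg
    (fun q hq => mul_nonneg (Real.exp_pos _).le (ncChiPDF_nonneg hd hm (le_of_lt hq))) q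
  have hf_int : IntegrableOn (ncChiPDF d mu) (Set.Ioi 0) := by
    simpa using (ncChiPDF_moment hd hm (c := 1 / 2) (by norm_num) 0).1
  have hint : ∀ i : ℕ, IntegrableOn (fun q => wt q * (1 + β * q) ^ i *
      Real.exp (b * Real.sqrt (β * q))) (Set.Ioi 0) := by
    intro i
    obtain ⟨C, hC⟩ := exists_pow_mul_exp_bound (b := b) hθ hβ i
    refine (integrable_and_abs_integral_le (C := C) (by fun_prop) hf_int ?_).1
    filter_upwards [ae_restrict_mem measurableSet_Ioi] with q hq
    have hq0 : 0 < q := hq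
    have h1 := ncChiPDF_nonneg hd hm hq0.le
    rw [hwt_eq q hq, abs_of_nonneg (by positivity)]
    calc _ = (Real.exp (-(β / (2 * α) * q)) * (1 + β * q) ^ i *
          Real.exp (b * Real.sqrt (β * q))) * ncChiPDF d mu q := by ring
      _ ≤ _ := mul_le_mul_of_nonneg_right (hC q hq0) h1
  set F : ℝ → ℝ := fun v => ∫ q in Set.Ioi 0, wt q * ((1 + β * q * v⁻¹ ^ 2) ^ (d / 2 - 3 / 4) *
      Real.exp (b * (β * q * v⁻¹ * sqrtQuot (β * q * v⁻¹ ^ 2))) *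
      besselNorm d (b * v * Real.sqrt (1 + β * q * v⁻¹ ^ 2))) with hF
  have hFm : Measurable F := by
    refine StronglyMeasurable.measurable (StronglyMeasurable.integral_prod_right
      (f := fun v q => wt q * ((1 + β * q * v⁻¹ ^ 2) ^ (d / 2 - 3 / 4) *
      Real.exp (b * (β * q * v⁻¹ * sqrtQuot (β * q * v⁻¹ ^ 2))) *
      besselNorm d (b * v * Real.sqrt (1 + β * q * v⁻¹ ^ 2)))) (Measurable.stronglyMeasurable ?_))
    unfold Function.uncurry
    fun_prop
  have hmom : ∀ i : ℕ, ∫ q in Set.Ioi 0, wt q * (β * q) ^ i =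
      Real.exp (-mu / 2) * α ^ d * (2 * α * β) ^ i * poch d i * hypM (d + i) d (α * mu / 2) := by
    intro i
    have h := (ncChiPDF_moment hd hm (c := 1 / (2 * α)) (by positivity) i).2
    have h1 : ∫ q in Set.Ioi 0, wt q * (β * q) ^ i = ∫ q in Set.Ioi 0, β ^ i *
        (q ^ i * Real.exp (-((1 / (2 * α) - 1 / 2) * q)) * ncChiPDF d mu q) := by
      refine setIntegral_congr_fun measurableSet_Ioi fun q hq => ?_
      rw [hwt_eq q hq, show 1 / (2 * α) - 1 / 2 = β / (2 * α) by rw [hβdef]; field_simp, mul_pow]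
      ring
    have h2 : (2 * (1 / (2 * α))) ^ (-d) = α ^ d := by
      rw [show 2 * (1 / (2 * α)) = α⁻¹ by field_simp, Real.inv_rpow hα.le, Real.rpow_neg hα.le,
        inv_inv]
    rw [h1, integral_const_mul, h, h2, show mu / (4 * (1 / (2 * α))) = α * mu / 2 by
      field_simp; norm_num, one_div_one_div, show 2 * α * β = β * (2 * α) by ring, mul_pow β]
    ring
  have hFexp : HasExp F (innerCoef d α b mu) := by
    have h := hasExp_besselMoment (χ := volume.restrict (Set.Ioi 0)) (u := fun q => β * q) hb hwtm
      (by fun_prop) hwt0 ?_ hint hd (d / 2 - 3 / 4)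
    · simp only [hmom] at h
      exact h
    · filter_upwards [ae_restrict_mem measurableSet_Ioi] with q hq
      exact mul_pos hβ hq
  refine (hasExp_integral b (κ := 2 * α) (by positivity) (d - 1 / 2) hFm hFexp).congr' ?_
  filter_upwards [eventually_gt_atTop 0] with V hV
  rw [prod_ncChi_tail hd (by positivity) hm hα hβ (by positivity), Real.sqrt_sq hV.le]
  have hK : tailConst d α b ≠ 0 := by
    have : 0 < tailConst d α b := by unfold tailConst; positivity
    exact this.ne'
  have h1 : ∫ v in Set.Ioi V, ∫ q in Set.Ioi 0,
        2 * v / α * ncChiPDF d (α * b ^ 2) ((v ^ 2 + β * q) / α) * ncChiPDF d mu q =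
      tailConst d α b * ∫ v in Set.Ioi V, v ^ (d - 1 / 2) * Real.exp (b * v - v ^ 2 / (2 * α)) *
        F v := by
    rw [← integral_const_mul]
    refine setIntegral_congr_fun measurableSet_Ioi fun v hv => ?_
    have hv0 : 0 < v := hV.trans hv
    simp only [hF]
    rw [← integral_const_mul, ← integral_const_mul]
    refine setIntegral_congr_fun measurableSet_Ioi fun q hq => ?_
    rw [ncChiPDF_factor hα hβ hb hv0 hq, hwt_eq q hq]
  rw [h1, mul_div_mul_left _ _ hK, show 2 * α / 2 = α by ring,
    show d - 1 / 2 - 1 = d - 3 / 2 by ring]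

lemma sum_range_ite_add_eq (p : ℕ) (f : ℕ → ℕ → ℕ → ℕ → ℝ) :
    (∑ i ∈ range (p + 1), ∑ j ∈ range (p + 1), ∑ k ∈ range (p + 1), ∑ l ∈ range (p + 1),
      if i + 2 * j + k + l = p then f i j k l else 0) =
    ∑ l ∈ range (p + 1), if 1 * l ≤ p then ∑ k ∈ range (p - 1 * l + 1),
      (if 1 * k ≤ p - 1 * l then ∑ j ∈ range (p - 1 * l - 1 * k + 1),
        (if 2 * j ≤ p - 1 * l - 1 * k then f (p - 1 * l - 1 * k - 2 * j) j k l else 0)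
          else 0) else 0 := by
  have hi : ∀ j k l, (∑ i ∈ range (p + 1), if i + 2 * j + k + l = p then f i j k l else 0) =
      if 2 * j + k + l ≤ p then f (p - 1 * l - 1 * k - 2 * j) j k l else 0 := by
    intro j k l
    split_ifs with h
    · rw [Finset.sum_eq_single (p - 1 * l - 1 * k - 2 * j)]
      · rw [if_pos (by omega)]
      · intro i _ hne
        rw [if_neg (by omega)]
      · intro hn
        exact absurd (Finset.mem_range.2 (by omega)) hn
    · exact Finset.sum_eq_zero fun i _ => if_neg (by omega)
  have hcomm : (∑ i ∈ range (p + 1), ∑ j ∈ range (p + 1), ∑ k ∈ range (p + 1),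
      ∑ l ∈ range (p + 1), if i + 2 * j + k + l = p then f i j k l else 0) =
      ∑ l ∈ range (p + 1), ∑ k ∈ range (p + 1), ∑ j ∈ range (p + 1), ∑ i ∈ range (p + 1),
        if i + 2 * j + k + l = p then f i j k l else 0 := by
    rw [Finset.sum_comm]
    simp_rw [Finset.sum_comm (s := range (p + 1)) (t := range (p + 1))
      (f := fun i k => ∑ l ∈ range (p + 1), if i + 2 * _ + k + l = p then f i _ k l else 0)]
    rw [Finset.sum_comm]
    simp_rw [Finset.sum_comm (s := range (p + 1)) (t := range (p + 1))
      (f := fun i l => if i + 2 * _ + _ + l = p then f i _ _ l else 0)]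
    simp_rw [Finset.sum_comm (s := range (p + 1)) (t := range (p + 1))
      (f := fun j l => ∑ i ∈ range (p + 1), if i + 2 * j + _ + l = p then f i j _ l else 0)]
    rw [Finset.sum_comm]
  rw [hcomm]
  simp_rw [hi]
  refine Finset.sum_congr rfl fun l hl => ?_
  have hl' := Finset.mem_range.1 hl
  rw [if_pos (by omega)]
  symm
  refine (Finset.sum_congr rfl fun k hk => ?_).trans
    (Finset.sum_subset (Finset.range_subset_range.2 (by omega)) fun k _ hk => ?_)
  · have hk' := Finset.mem_range.1 hk
    rw [if_pos (by omega)]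
    refine (Finset.sum_congr rfl fun j hj => ?_).trans
      (Finset.sum_subset (Finset.range_subset_range.2 (by omega)) fun j _ hj => ?_)
    · by_cases h : 2 * j + k + l ≤ p
      · rw [if_pos h, if_pos (by omega)]
      · rw [if_neg h, if_neg (by omega)]
    · rw [Finset.mem_range] at hj
      exact if_neg (by omega)
  · rw [Finset.mem_range] at hk
    exact Finset.sum_eq_zero fun j _ => if_neg (by omega)

lemma innerCoef_eq_cCoef {rX rY ρ : ℝ} {n : ℕ} (hn : 1 ≤ n) (hρ₁ : -1 < ρ) (hρ₂ : ρ < 1) (p : ℕ) :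
    innerCoef ((n : ℝ) / 2) ((1 + ρ) / 2) (|rX + rY| / (1 + ρ) * Real.sqrt n)
        ((n : ℝ) * (rX - rY) ^ 2 / (2 * (1 - ρ))) p =
      Real.exp ((n : ℝ) / 8 * ((1 + ρ) / (1 - ρ)) * (rX - rY) ^ 2 -
        (n : ℝ) * (rX - rY) ^ 2 / (2 * (1 - ρ)) / 2) * ((1 + ρ) / 2) ^ ((n : ℝ) / 2) *
        cCoef rX rY ρ n p := by
  have h1 : 0 < 1 + ρ := by linarith
  have h2 : 0 < 1 - ρ := by linarith
  have hn0 : (0 : ℝ) < n := by exact_mod_cast hn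
  have hx : (1 + ρ) / 2 * ((n : ℝ) * (rX - rY) ^ 2 / (2 * (1 - ρ))) / 2 =
      (n : ℝ) / 8 * ((1 + ρ) / (1 - ρ)) * (rX - rY) ^ 2 := by
    field_simp
    ring
  have hq : 2 * ((1 + ρ) / 2) * (1 - (1 + ρ) / 2) = (1 - ρ ^ 2) / 2 := by ring
  rw [innerCoef, hx, hq]
  set mu := (n : ℝ) * (rX - rY) ^ 2 / (2 * (1 - ρ))
  set x₀ := (n : ℝ) / 8 * ((1 + ρ) / (1 - ρ)) * (rX - rY) ^ 2 with hx0
  have hexp : Real.exp (x₀ - mu / 2) = Real.exp x₀ * Real.exp (-mu / 2) := by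
    rw [← Real.exp_add]; congr 1; ring
  rcases Nat.eq_zero_or_pos p with rfl | hp
  · rw [cCoef, if_pos rfl, hexp]
    simp [besselCoef, poch, puiseuxG, genBinom, compS, hypM_self (show 0 < (n : ℝ) / 2 by positivity)]
    ring
  · rw [cCoef, if_neg hp.ne', ← hx0, hexp, Real.exp_neg, Finset.mul_sum, Finset.mul_sum,
      ← Finset.sum_range_reflect]
    refine Finset.sum_congr rfl fun k hk => ?_
    have hk' := Finset.mem_range.1 hk
    rw [if_pos (by omega), hCoef, show p + 1 - 1 - k = p - k by omega,
      show p - 1 * (p - k) = k by omega, besselCoef]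
    simp only [Finset.mul_sum]
    refine Finset.sum_congr rfl fun i _ => ?_
    rw [show (3 : ℝ) / 2 - (n : ℝ) / 2 = (3 - n) / 2 by ring,
      show (n : ℝ) / 2 - 1 / 2 = (n - 1) / 2 by ring,
      show (n : ℝ) / 2 / 2 - 3 / 4 = (n - 3) / 4 by ring]
    have hb : (|rX + rY| / (1 + ρ) * Real.sqrt n)⁻¹ ^ (p - k) =
        ((1 + ρ) / |rX + rY|) ^ (p - k) / (n : ℝ) ^ (((p - k : ℕ) : ℝ) / 2) := by
      rw [mul_inv, inv_div, mul_pow, div_eq_mul_inv _ ((n : ℝ) ^ _), inv_pow (Real.sqrt n),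
        Real.sqrt_eq_rpow, ← Real.rpow_mul_natCast hn0.le]
      congr 3
      ring
    rw [hb]
    have he : Real.exp x₀ ≠ 0 := (Real.exp_pos _).ne'
    have hnp : (n : ℝ) ^ (((p - k : ℕ) : ℝ) / 2) ≠ 0 := by positivity
    generalize (n : ℝ) ^ (((p - k : ℕ) : ℝ) / 2) = w at *
    generalize hypM _ _ _ = H
    generalize puiseuxG _ _ _ _ = G
    generalize ((1 + ρ) / |rX + rY|) ^ (p - k) = z
    field_simp

lemma sum_innerCoef_mul_tailCoef {rX rY ρ : ℝ} {n : ℕ} (hn : 1 ≤ n) (hρ₁ : -1 < ρ) (hρ₂ : ρ < 1)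
    (hr : rX + rY ≠ 0) (p : ℕ) :
    (∑ l ∈ range (p + 1), if 1 * l ≤ p then
      innerCoef ((n : ℝ) / 2) ((1 + ρ) / 2) (|rX + rY| / (1 + ρ) * Real.sqrt n)
        ((n : ℝ) * (rX - rY) ^ 2 / (2 * (1 - ρ))) l *
      tailCoef (|rX + rY| / (1 + ρ) * Real.sqrt n) (2 * ((1 + ρ) / 2)) ((n : ℝ) / 2 - 1 / 2 - l)
        (p - 1 * l) else 0) =
      Real.exp ((n : ℝ) / 8 * ((1 + ρ) / (1 - ρ)) * (rX - rY) ^ 2 -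
        (n : ℝ) * (rX - rY) ^ 2 / (2 * (1 - ρ)) / 2) * ((1 + ρ) / 2) ^ ((n : ℝ) / 2) *
        gammaCoef rX rY ρ n p := by
  have h1 : 0 < 1 + ρ := by linarith
  have hδ : |rX + rY| / (1 + ρ) * Real.sqrt n * (1 + ρ) / 2 = |rX + rY| * Real.sqrt n / 2 := by
    field_simp
  have hg : gammaCoef rX rY ρ n p =
      ∑ i ∈ Finset.range (p + 1), ∑ j ∈ Finset.range (p + 1),
      ∑ k ∈ Finset.range (p + 1), ∑ ℓ ∈ Finset.range (p + 1),
        if i + 2 * j + k + ℓ = p then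
          (-1 : ℝ) ^ (j + i) * cCoef rX rY ρ n ℓ * genBinom (((n : ℝ) - 1) / 2 - ℓ) k *
            genBinom (((n : ℝ) - 3) / 2 - ℓ - k - 2 * j) i *
            poch (((ℓ : ℝ) + k) / 2 - ((n : ℝ) - 3) / 4) j * (1 + ρ) ^ j *
            (|rX + rY| * Real.sqrt n / 2) ^ (k + i)
        else 0 := by
    rcases Nat.eq_zero_or_pos p with rfl | hp
    · simp [gammaCoef, cCoef, genBinom, poch]
    · rw [gammaCoef, if_neg hp.ne']
  rw [hg, sum_range_ite_add_eq p fun i j k ℓ =>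
    (-1 : ℝ) ^ (j + i) * cCoef rX rY ρ n ℓ * genBinom (((n : ℝ) - 1) / 2 - ℓ) k *
            genBinom (((n : ℝ) - 3) / 2 - ℓ - k - 2 * j) i *
            poch (((ℓ : ℝ) + k) / 2 - ((n : ℝ) - 3) / 4) j * (1 + ρ) ^ j *
            (|rX + rY| * Real.sqrt n / 2) ^ (k + i), Finset.mul_sum,
    show 2 * ((1 + ρ) / 2) = 1 + ρ by ring]
  refine Finset.sum_congr rfl fun l hl => ?_
  have hl' := Finset.mem_range.1 hl
  rw [if_pos (by omega), if_pos (by omega), innerCoef_eq_cCoef hn hρ₁ hρ₂, tailCoef, hδ,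
    mul_assoc _ (cCoef rX rY ρ n l)]
  congr 1
  rw [Finset.mul_sum]
  refine Finset.sum_congr rfl fun k hk => ?_
  have hk' := Finset.mem_range.1 hk
  rw [if_pos (by omega), if_pos (by omega), shiftCoef, Finset.mul_sum, Finset.mul_sum]
  refine Finset.sum_congr rfl fun j _ => ?_
  split_ifs with hj
  · rw [show (1 - ((n : ℝ) / 2 - 1 / 2 - l - k)) / 2 = ((l : ℝ) + k) / 2 - ((n : ℝ) - 3) / 4 by ring,
      show (n : ℝ) / 2 - 1 / 2 - l - k - 1 - 2 * j = ((n : ℝ) - 3) / 2 - l - k - 2 * j by ring,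
      show (n : ℝ) / 2 - 1 / 2 - l = ((n : ℝ) - 1) / 2 - l by ring, neg_pow (1 + ρ) j,
      neg_pow (|rX + rY| * Real.sqrt n / 2), pow_add (-1 : ℝ), pow_add (|rX + rY| * Real.sqrt n / 2)]
    ring
  · simp

/-- The constant factor of the tail expansion. -/
def tailPrefactor (rX rY ρ : ℝ) (n : ℕ) : ℝ :=
  (1 + ρ) * Real.exp (-((n : ℝ) * (rX ^ 2 + rY ^ 2 - 2 * ρ * rX * rY)) / (2 * (1 - ρ ^ 2))) /
    (2 * Real.sqrt (2 * Real.pi)) * ((1 + ρ) / (|rX + rY| * Real.sqrt n)) ^ (((n : ℝ) - 1) / 2) *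
    Real.exp ((n : ℝ) / 8 * ((1 + ρ) / (1 - ρ)) * (rX - rY) ^ 2)

lemma tailConst_eq_tailPrefactor {rX rY ρ : ℝ} {n : ℕ} (hn : 1 ≤ n) (hρ₁ : -1 < ρ) (hρ₂ : ρ < 1)
    (hr : rX + rY ≠ 0) :
    tailConst ((n : ℝ) / 2) ((1 + ρ) / 2) (|rX + rY| / (1 + ρ) * Real.sqrt n) * ((1 + ρ) / 2) *
      (Real.exp ((n : ℝ) / 8 * ((1 + ρ) / (1 - ρ)) * (rX - rY) ^ 2 -
        (n : ℝ) * (rX - rY) ^ 2 / (2 * (1 - ρ)) / 2) * ((1 + ρ) / 2) ^ ((n : ℝ) / 2)) =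
      tailPrefactor rX rY ρ n := by
  have h1 : 0 < 1 + ρ := by linarith
  have h2 : 0 < 1 - ρ := by linarith
  have h3 : 0 < 1 - ρ ^ 2 := by nlinarith
  have hn0 : (0 : ℝ) < n := by exact_mod_cast hn
  have hr0 : 0 < |rX + rY| := abs_pos.2 hr
  have hbr : (1 + ρ) / (|rX + rY| * Real.sqrt n) = (|rX + rY| / (1 + ρ) * Real.sqrt n)⁻¹ := by
    field_simp
  have hb2 : (1 + ρ) / 2 * (|rX + rY| / (1 + ρ) * Real.sqrt n) ^ 2 =
      n * (rX + rY) ^ 2 / (2 * (1 + ρ)) := by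
    rw [mul_pow, div_pow, sq_abs, Real.sq_sqrt hn0.le]
    field_simp
  have hbpos : 0 < |rX + rY| / (1 + ρ) * Real.sqrt n := by positivity
  rw [tailConst, tailPrefactor, hb2, hbr]
  set b := |rX + rY| / (1 + ρ) * Real.sqrt n
  set α := (1 + ρ) / 2 with hα
  have hα0 : 0 < α := by positivity
  have hexp : Real.exp (-(n * (rX + rY) ^ 2 / (2 * (1 + ρ))) / 2) *
      Real.exp ((n : ℝ) / 8 * ((1 + ρ) / (1 - ρ)) * (rX - rY) ^ 2 -
        (n : ℝ) * (rX - rY) ^ 2 / (2 * (1 - ρ)) / 2) =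
      Real.exp (-((n : ℝ) * (rX ^ 2 + rY ^ 2 - 2 * ρ * rX * rY)) / (2 * (1 - ρ ^ 2))) *
      Real.exp ((n : ℝ) / 8 * ((1 + ρ) / (1 - ρ)) * (rX - rY) ^ 2) := by
    rw [← Real.exp_add, ← Real.exp_add]
    congr 1
    rw [show 1 - ρ ^ 2 = (1 + ρ) * (1 - ρ) by ring]
    field_simp
    ring
  have hpow : (α * b) ^ (1 - (n : ℝ) / 2) * (Real.sqrt (2 * Real.pi * b))⁻¹ * α ^ ((n : ℝ) / 2) =
      α * b⁻¹ ^ (((n : ℝ) - 1) / 2) / Real.sqrt (2 * Real.pi) := by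
    have e1 : b ^ (1 - (n : ℝ) / 2) = b⁻¹ ^ (((n : ℝ) - 1) / 2) * Real.sqrt b := by
      rw [Real.sqrt_eq_rpow, Real.inv_rpow hbpos.le, ← Real.rpow_neg hbpos.le,
        ← Real.rpow_add hbpos]
      congr 1
      ring
    have e2 : α ^ (1 - (n : ℝ) / 2) * α ^ ((n : ℝ) / 2) = α := by
      rw [← Real.rpow_add hα0, sub_add_cancel, Real.rpow_one]
    have hs : 0 < Real.sqrt b := Real.sqrt_pos.2 hbpos
    rw [Real.mul_rpow hα0.le hbpos.le, e1, Real.sqrt_mul (by positivity) b]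
    calc _ = (α ^ (1 - (n : ℝ) / 2) * α ^ ((n : ℝ) / 2)) * b⁻¹ ^ (((n : ℝ) - 1) / 2) *
          (Real.sqrt b * (Real.sqrt (2 * Real.pi) * Real.sqrt b)⁻¹) := by ring
      _ = _ := by rw [e2]; field_simp
  calc _ = (Real.exp (-(n * (rX + rY) ^ 2 / (2 * (1 + ρ))) / 2) *
      Real.exp ((n : ℝ) / 8 * ((1 + ρ) / (1 - ρ)) * (rX - rY) ^ 2 -
        (n : ℝ) * (rX - rY) ^ 2 / (2 * (1 - ρ)) / 2)) * ((α * b) ^ (1 - (n : ℝ) / 2) *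
        (Real.sqrt (2 * Real.pi * b))⁻¹ * α ^ ((n : ℝ) / 2)) := by
        field_simp
    _ = _ := by
        rw [hexp, hpow, hα]
        ring

lemma tailPrefactor_pos {rX rY ρ : ℝ} {n : ℕ} (hn : 1 ≤ n) (hρ₁ : -1 < ρ)
    (hr : rX + rY ≠ 0) : 0 < tailPrefactor rX rY ρ n := by
  have h1 : 0 < 1 + ρ := by linarith
  have hn0 : (0 : ℝ) < n := by exact_mod_cast hn
  have hr0 : 0 < |rX + rY| := abs_pos.2 hr
  unfold tailPrefactor
  positivity

/-- Tail expansion for the difference of two independent scaled noncentral chi-squared variables. -/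
lemma hasExp_ncChi_tail_gammaCoef {rX rY ρ : ℝ} {n : ℕ} (hn : 1 ≤ n) (hρ₁ : -1 < ρ) (hρ₂ : ρ < 1)
    (hr : rX + rY ≠ 0) :
    HasExp (fun V => ((ncChi ((n : ℝ) / 2) ((n : ℝ) * (rX + rY) ^ 2 / (2 * (1 + ρ)))).prod
        (ncChi ((n : ℝ) / 2) ((n : ℝ) * (rX - rY) ^ 2 / (2 * (1 - ρ))))
        {z | V ^ 2 ≤ (1 + ρ) / 2 * z.1 - (1 - ρ) / 2 * z.2}).toReal /
        (tailPrefactor rX rY ρ n * (V ^ (((n : ℝ) - 3) / 2) *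
          Real.exp (|rX + rY| / (1 + ρ) * Real.sqrt n * V - V ^ 2 / (1 + ρ)))))
      (gammaCoef rX rY ρ n) := by
  have h1 : 0 < 1 + ρ := by linarith
  have h2 : 0 < 1 - ρ := by linarith
  have hn1 : (1 : ℝ) ≤ n := by exact_mod_cast hn
  have hn0 : (0 : ℝ) < n := by linarith
  have hr0 : 0 < |rX + rY| := abs_pos.2 hr
  have hb2 : (1 + ρ) / 2 * (|rX + rY| / (1 + ρ) * Real.sqrt n) ^ 2 =
      n * (rX + rY) ^ 2 / (2 * (1 + ρ)) := by
    rw [mul_pow, div_pow, sq_abs, Real.sq_sqrt hn0.le]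
    field_simp
  have h := hasExp_ncChi_tail (d := (n : ℝ) / 2) (α := (1 + ρ) / 2)
    (b := |rX + rY| / (1 + ρ) * Real.sqrt n) (mu := (n : ℝ) * (rX - rY) ^ 2 / (2 * (1 - ρ)))
    (by linarith) (by linarith) (by linarith) (by positivity) (by positivity)
  simp only [sum_innerCoef_mul_tailCoef hn hρ₁ hρ₂ hr] at h
  set w := Real.exp ((n : ℝ) / 8 * ((1 + ρ) / (1 - ρ)) * (rX - rY) ^ 2 -
        (n : ℝ) * (rX - rY) ^ 2 / (2 * (1 - ρ)) / 2) * ((1 + ρ) / 2) ^ ((n : ℝ) / 2) with hw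
  have hw0 : w ≠ 0 := by have : 0 < w := by positivity
                         exact this.ne'
  have h' := h.const_mul w⁻¹
  simp only [← mul_assoc, inv_mul_cancel₀ hw0, one_mul] at h'
  refine h'.congr' (Eventually.of_forall fun V => ?_)
  simp only
  rw [← tailConst_eq_tailPrefactor hn hρ₁ hρ₂ hr, ← hw, hb2,
    show 1 - (1 + ρ) / 2 = (1 - ρ) / 2 by ring, show 2 * ((1 + ρ) / 2) = 1 + ρ by ring,
    show (n : ℝ) / 2 - 3 / 2 = (n - 3) / 2 by ring]
  field_simp

lemma measure_ext_of_lintegral_exp_eq {μ ν : Measure ℝ} [IsFiniteMeasure μ] [IsFiniteMeasure ν]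
    {ε : ℝ} (hε : 0 < ε)
    (h : ∀ t ∈ Set.Ioo (-ε) ε, ∫⁻ x, ENNReal.ofReal (Real.exp (t * x)) ∂μ =
      ∫⁻ x, ENNReal.ofReal (Real.exp (t * x)) ∂ν)
    (hfin : ∀ t ∈ Set.Ioo (-ε) ε, ∫⁻ x, ENNReal.ofReal (Real.exp (t * x)) ∂ν ≠ ⊤) :
    μ = ν := by
  have key : ∀ (κ : Measure ℝ), (∀ t ∈ Set.Ioo (-ε) ε,
      ∫⁻ x, ENNReal.ofReal (Real.exp (t * x)) ∂κ ≠ ⊤) →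
      AnalyticOnNhd ℂ (ProbabilityTheory.complexMGF id κ) {z | z.re ∈ Set.Ioo (-ε) ε} := by
    intro κ hκ
    refine ProbabilityTheory.analyticOnNhd_complexMGF.mono fun z hz => ?_
    refine interior_maximal (t := Set.Ioo (-ε) ε) (fun t ht => ?_) isOpen_Ioo hz
    have hm : AEStronglyMeasurable (fun x : ℝ => Real.exp (t * id x)) κ := by fun_prop
    refine ⟨hm, ?_⟩
    rw [hasFiniteIntegral_iff_ofReal (Eventually.of_forall fun x => (Real.exp_pos _).le)]
    exact lt_top_iff_ne_top.2 (hκ t ht)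
  have hμ := key μ fun t ht => by rw [h t ht]; exact hfin t ht
  have hν := key ν hfin
  have heq : Set.EqOn (ProbabilityTheory.complexMGF id μ) (ProbabilityTheory.complexMGF id ν)
      {z | z.re ∈ Set.Ioo (-ε) ε} := by
    refine AnalyticOnNhd.eqOn_of_preconnected_of_frequently_eq hμ hν
      (((convex_Ioo (-ε) ε).linear_preimage Complex.reLm).isPreconnected)
      (z₀ := ((0 : ℝ) : ℂ)) (by simp [hε]) ?_
    have h_real : ∃ᶠ x : ℝ in 𝓝[≠] 0,
        ProbabilityTheory.complexMGF id μ x = ProbabilityTheory.complexMGF id ν x := by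
      refine Eventually.frequently ?_
      filter_upwards [nhdsWithin_le_nhds (Ioo_mem_nhds (neg_lt_zero.2 hε) hε)] with t ht
      rw [ProbabilityTheory.complexMGF_ofReal, ProbabilityTheory.complexMGF_ofReal,
        ProbabilityTheory.mgf, ProbabilityTheory.mgf,
        integral_eq_lintegral_of_nonneg_ae (Eventually.of_forall fun x => (Real.exp_pos _).le)
          (by fun_prop),
        integral_eq_lintegral_of_nonneg_ae (Eventually.of_forall fun x => (Real.exp_pos _).le)
          (by fun_prop)]
      simp only [id]
      rw [h t ht]
    rw [frequently_iff_seq_forall] at h_real ⊢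
    obtain ⟨xs, hx_tendsto, hx_eq⟩ := h_real
    refine ⟨fun n => xs n, ?_, hx_eq⟩
    rw [tendsto_nhdsWithin_iff] at hx_tendsto ⊢
    exact ⟨(Complex.continuous_ofReal.tendsto 0).comp hx_tendsto.1, by simpa using hx_tendsto.2⟩
  refine Measure.ext_of_charFun (funext fun t => ?_)
  rw [← ProbabilityTheory.complexMGF_id_mul_I, ← ProbabilityTheory.complexMGF_id_mul_I]
  exact heq (by simp [hε])

lemma lintegral_exp_quadratic {a : ℝ} (ha : 0 < a) (b c : ℝ) :
    ∫⁻ x : ℝ, ENNReal.ofReal (Real.exp (-(a * x ^ 2) + b * x + c)) =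
      ENNReal.ofReal (Real.sqrt (Real.pi / a) * Real.exp (b ^ 2 / (4 * a) + c)) := by
  have h : ∀ x : ℝ, Real.exp (-(a * x ^ 2) + b * x + c) =
      Real.exp (-a * (x - b / (2 * a)) ^ 2) * Real.exp (b ^ 2 / (4 * a) + c) := by
    intro x
    rw [← Real.exp_add]
    congr 1
    field_simp
    ring
  have hi : Integrable fun x : ℝ =>
      Real.exp (-a * (x - b / (2 * a)) ^ 2) * Real.exp (b ^ 2 / (4 * a) + c) :=
    ((integrable_exp_neg_mul_sq ha).comp_sub_right (b / (2 * a))).mul_const _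
  simp only [h]
  rw [← ofReal_integral_eq_lintegral_ofReal hi (Eventually.of_forall fun x => by positivity),
    integral_mul_const, integral_sub_right_eq_self (fun x : ℝ => Real.exp (-a * x ^ 2)),
    integral_gaussian]

lemma lintegral_exp_quadratic_prod {a b h : ℝ} (ha : 0 < a) (hab : 0 < a * b - h ^ 2)
    (c d e : ℝ) :
    ∫⁻ z : ℝ × ℝ, ENNReal.ofReal (Real.exp (-(a * z.1 ^ 2 - 2 * h * z.1 * z.2 + b * z.2 ^ 2) +
        c * z.1 + d * z.2 + e)) =
      ENNReal.ofReal (Real.pi / Real.sqrt (a * b - h ^ 2) *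
        Real.exp ((b * c ^ 2 + 2 * h * c * d + a * d ^ 2) / (4 * (a * b - h ^ 2)) + e)) := by
  have hb : 0 < (a * b - h ^ 2) / a := by positivity
  rw [Measure.volume_eq_prod, lintegral_prod_symm _ (by fun_prop)]
  have h1 : ∀ y : ℝ, ∫⁻ x : ℝ, ENNReal.ofReal (Real.exp
      (-(a * x ^ 2 - 2 * h * x * y + b * y ^ 2) + c * x + d * y + e)) =
      ENNReal.ofReal (Real.sqrt (Real.pi / a)) * ENNReal.ofReal (Real.exp
        (-((a * b - h ^ 2) / a * y ^ 2) + (d + c * h / a) * y + (e + c ^ 2 / (4 * a)))) := by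
    intro y
    rw [← ENNReal.ofReal_mul (Real.sqrt_nonneg _)]
    have := lintegral_exp_quadratic ha (2 * h * y + c) (-(b * y ^ 2) + d * y + e)
    convert this using 2
    · ext x; congr 2; ring
    · congr 2; field_simp; ring
  simp only [h1]
  rw [lintegral_const_mul _ (by fun_prop), lintegral_exp_quadratic hb,
    ← ENNReal.ofReal_mul (Real.sqrt_nonneg _), ← mul_assoc,
    ← Real.sqrt_mul (by positivity)]
  congr 2
  · rw [show Real.pi / a * (Real.pi / ((a * b - h ^ 2) / a)) =
      Real.pi ^ 2 / (a * b - h ^ 2) by field_simp, Real.sqrt_div (by positivity),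
      Real.sqrt_sq Real.pi_pos.le]
  · congr 1
    have := hab.ne'
    field_simp
    ring

/-- The moment generating function of the product of the coordinates of a bivariate normal vector
with unit variances, means `rX`, `rY` and correlation `ρ`. -/
def productNormalMGF (rX rY ρ τ : ℝ) : ℝ :=
  (Real.sqrt ((1 - (1 + ρ) * τ) * (1 + (1 - ρ) * τ)))⁻¹ *
    Real.exp ((rX + rY) ^ 2 * τ / (4 * (1 - (1 + ρ) * τ)) -
      (rX - rY) ^ 2 * τ / (4 * (1 + (1 - ρ) * τ)))

lemma measurable_biNormPDF (μX μY σX σY ρ : ℝ) : Measurable (biNormPDF μX μY σX σY ρ) := by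
  unfold biNormPDF
  fun_prop

lemma one_sub_mul_pos {ρ τ : ℝ} (hρ₁ : -1 < ρ) (hρ₂ : ρ < 1) (hτ : τ ∈ Set.Ioo (-(1 / 2)) (1 / 2)) :
    0 < 1 - (1 + ρ) * τ ∧ 0 < 1 + (1 - ρ) * τ := by
  obtain ⟨h1, h2⟩ := hτ
  constructor <;> nlinarith

lemma lintegral_exp_mul_biNormPDF {μX μY σX σY ρ τ : ℝ} (hσX : 0 < σX) (hσY : 0 < σY)
    (hρ₁ : -1 < ρ) (hρ₂ : ρ < 1) (hτ : τ ∈ Set.Ioo (-(1 / 2) : ℝ) (1 / 2)) :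
    ∫⁻ v, ENNReal.ofReal (Real.exp (τ / (σX * σY) * (v.1 * v.2)))
      ∂((volume : Measure (ℝ × ℝ)).withDensity fun v => ENNReal.ofReal (biNormPDF μX μY σX σY ρ v)) =
    ENNReal.ofReal (productNormalMGF (μX / σX) (μY / σY) ρ τ) := by
  obtain ⟨hp, hm⟩ := one_sub_mul_pos hρ₁ hρ₂ hτ
  have hρ : 0 < 1 - ρ ^ 2 := by nlinarith
  have hK : 0 ≤ (2 * Real.pi * σX * σY * Real.sqrt (1 - ρ ^ 2))⁻¹ := by
    have := Real.pi_pos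
    positivity
  obtain ⟨rX, rfl⟩ : ∃ rX, μX = rX * σX := ⟨μX / σX, by field_simp⟩
  obtain ⟨rY, rfl⟩ : ∃ rY, μY = rY * σY := ⟨μY / σY, by field_simp⟩
  have hdet : 1 / (2 * (1 - ρ ^ 2) * σX ^ 2) * (1 / (2 * (1 - ρ ^ 2) * σY ^ 2)) -
      ((ρ / (1 - ρ ^ 2) + τ) / (2 * (σX * σY))) ^ 2 =
      (1 - (1 + ρ) * τ) * (1 + (1 - ρ) * τ) / ((2 * (σX * σY)) ^ 2 * (1 - ρ ^ 2)) := by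
    field_simp
    ring
  have hquad := lintegral_exp_quadratic_prod (a := 1 / (2 * (1 - ρ ^ 2) * σX ^ 2))
    (b := 1 / (2 * (1 - ρ ^ 2) * σY ^ 2))
    (h := (ρ / (1 - ρ ^ 2) + τ) / (2 * (σX * σY))) (by positivity) (by rw [hdet]; positivity)
    ((rX - ρ * rY) / ((1 - ρ ^ 2) * σX)) ((rY - ρ * rX) / ((1 - ρ ^ 2) * σY))
    (-(rX ^ 2 - 2 * ρ * rX * rY + rY ^ 2) / (2 * (1 - ρ ^ 2)))
  rw [hdet] at hquad
  rw [lintegral_withDensity_eq_lintegral_mul _ (measurable_biNormPDF _ _ _ _ _).ennreal_ofReal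
    (by fun_prop)]
  have hpt : ∀ v : ℝ × ℝ, ((fun v => ENNReal.ofReal (biNormPDF (rX * σX) (rY * σY) σX σY ρ v)) *
      fun v : ℝ × ℝ => ENNReal.ofReal (Real.exp (τ / (σX * σY) * (v.1 * v.2)))) v =
      ENNReal.ofReal (2 * Real.pi * σX * σY * Real.sqrt (1 - ρ ^ 2))⁻¹ *
      ENNReal.ofReal (Real.exp (-(1 / (2 * (1 - ρ ^ 2) * σX ^ 2) * v.1 ^ 2 -
        2 * ((ρ / (1 - ρ ^ 2) + τ) / (2 * (σX * σY))) * v.1 * v.2 +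
        1 / (2 * (1 - ρ ^ 2) * σY ^ 2) * v.2 ^ 2) +
        (rX - ρ * rY) / ((1 - ρ ^ 2) * σX) * v.1 + (rY - ρ * rX) / ((1 - ρ ^ 2) * σY) * v.2 +
        -(rX ^ 2 - 2 * ρ * rX * rY + rY ^ 2) / (2 * (1 - ρ ^ 2)))) := by
    intro v
    rw [Pi.mul_apply, ← ENNReal.ofReal_mul' (Real.exp_pos _).le, ← ENNReal.ofReal_mul hK,
      biNormPDF, mul_assoc _ (Real.exp _), ← Real.exp_add]
    congr 3
    field_simp
    ring
  simp only [hpt]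
  rw [lintegral_const_mul _ (by fun_prop), hquad, ← ENNReal.ofReal_mul hK, ← mul_assoc,
    productNormalMGF]
  congr 2
  · rw [Real.sqrt_div (by positivity), Real.sqrt_mul (sq_nonneg (2 * (σX * σY))),
      Real.sqrt_sq (by positivity)]
    have h1 : 0 < Real.sqrt (1 - ρ ^ 2) := Real.sqrt_pos.2 hρ
    have h2 : 0 < Real.sqrt ((1 - (1 + ρ) * τ) * (1 + (1 - ρ) * τ)) :=
      Real.sqrt_pos.2 (by positivity)
    have := Real.pi_pos
    field_simp
  · congr 1
    have := hp.ne'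
    have := hm.ne'
    have := hρ.ne'
    rw [mul_div_cancel_right₀ _ hσX.ne', mul_div_cancel_right₀ _ hσY.ne']
    generalize hP : 1 - (1 + ρ) * τ = P at *
    generalize hM : 1 + (1 - ρ) * τ = M at *
    generalize hR : 1 - ρ ^ 2 = R at *
    field_simp
    subst hP hM hR
    ring

lemma lintegral_exp_mul_ncChi {d lam η : ℝ} (hd : 1 / 2 ≤ d) (hl : 0 ≤ lam) (hη : η < 1 / 2) :
    ∫⁻ p, ENNReal.ofReal (Real.exp (η * p)) ∂(ncChi d lam) =
      ENNReal.ofReal ((1 - 2 * η) ^ (-d) * Real.exp (lam * η / (1 - 2 * η))) := by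
  have h := ncChiPDF_moment hd hl (c := 1 / 2 - η) (by linarith) 0
  simp only [pow_zero, one_mul, Nat.cast_zero, add_zero, poch, Finset.range_zero,
    Finset.prod_empty, mul_one] at h
  rw [ncChi, lintegral_withDensity_eq_lintegral_mul _ (measurable_ncChiPDF hd lam).ennreal_ofReal
    (by fun_prop)]
  have : ∫⁻ p in Set.Ioi 0, ENNReal.ofReal (Real.exp (-((1 / 2 - η - 1 / 2) * p)) *
      ncChiPDF d lam p) =
      ENNReal.ofReal ((1 - 2 * η) ^ (-d) * Real.exp (lam * η / (1 - 2 * η))) := by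
    rw [← ofReal_integral_eq_lintegral_ofReal h.1, h.2, hypM_self (by linarith)]
    · congr 1
      rw [mul_right_comm, ← Real.exp_add, mul_comm]
      have : 1 - 2 * η ≠ 0 := by linarith
      congr 2
      · ring
      · rw [show 4 * (1 / 2 - η) = 2 * (1 - 2 * η) by ring]
        field_simp
        ring
    · filter_upwards [ae_restrict_mem measurableSet_Ioi] with p hp
      exact mul_nonneg (Real.exp_pos _).le (ncChiPDF_nonneg hd hl (le_of_lt hp))
  rw [← this]
  refine lintegral_congr fun p => ?_
  rw [Pi.mul_apply, ← ENNReal.ofReal_mul' (Real.exp_pos _).le, mul_comm]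
  congr 3
  ring

lemma lintegral_exp_mul_prod_ncChi {rX rY ρ τ : ℝ} {n : ℕ} (hn : 1 ≤ n)
    (hρ₁ : -1 < ρ) (hρ₂ : ρ < 1) (hτ : τ ∈ Set.Ioo (-(1 / 2) : ℝ) (1 / 2)) :
    ∫⁻ z, ENNReal.ofReal (Real.exp (τ * ((1 + ρ) / 2 * z.1 - (1 - ρ) / 2 * z.2)))
      ∂((ncChi ((n : ℝ) / 2) ((n : ℝ) * (rX + rY) ^ 2 / (2 * (1 + ρ)))).prod
        (ncChi ((n : ℝ) / 2) ((n : ℝ) * (rX - rY) ^ 2 / (2 * (1 - ρ))))) =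
    ENNReal.ofReal (productNormalMGF rX rY ρ τ) ^ n := by
  obtain ⟨hp, hm⟩ := one_sub_mul_pos hρ₁ hρ₂ hτ
  have hn' : (1 : ℝ) ≤ n := by exact_mod_cast hn
  have hd : (1 : ℝ) / 2 ≤ (n : ℝ) / 2 := by linarith
  have hρ₁' : 0 < 1 + ρ := by linarith
  have hρ₂' : 0 < 1 - ρ := by linarith
  have hl : 0 ≤ (n : ℝ) * (rX + rY) ^ 2 / (2 * (1 + ρ)) := by positivity
  have hl' : 0 ≤ (n : ℝ) * (rX - rY) ^ 2 / (2 * (1 - ρ)) := by positivity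
  have := isProbabilityMeasure_ncChi hd hl
  have := isProbabilityMeasure_ncChi hd hl'
  have h : ∀ z : ℝ × ℝ, ENNReal.ofReal (Real.exp (τ * ((1 + ρ) / 2 * z.1 - (1 - ρ) / 2 * z.2))) =
      ENNReal.ofReal (Real.exp ((1 + ρ) * τ / 2 * z.1)) *
        ENNReal.ofReal (Real.exp (-((1 - ρ) * τ / 2) * z.2)) := by
    intro z
    rw [← ENNReal.ofReal_mul (Real.exp_pos _).le, ← Real.exp_add]
    congr 2
    ring
  simp only [h]
  rw [lintegral_prod_mul (f := fun x => ENNReal.ofReal (Real.exp ((1 + ρ) * τ / 2 * x)))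
      (g := fun y => ENNReal.ofReal (Real.exp (-((1 - ρ) * τ / 2) * y))) (by fun_prop) (by fun_prop),
    lintegral_exp_mul_ncChi hd hl (by linarith), lintegral_exp_mul_ncChi hd hl' (by linarith),
    ← ENNReal.ofReal_mul (by rw [show 1 - 2 * ((1 + ρ) * τ / 2) = 1 - (1 + ρ) * τ by ring]; positivity),
    ← ENNReal.ofReal_pow (by unfold productNormalMGF; positivity)]
  congr 1
  rw [productNormalMGF, mul_pow, ← Real.exp_nat_mul, mul_mul_mul_comm, ← Real.exp_add,
    show 1 - 2 * ((1 + ρ) * τ / 2) = 1 - (1 + ρ) * τ by ring,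
    show 1 - 2 * -((1 - ρ) * τ / 2) = 1 + (1 - ρ) * τ by ring]
  congr 1
  · rw [← Real.mul_rpow hp.le hm.le, Real.sqrt_eq_rpow, ← Real.rpow_neg (by positivity),
      ← Real.rpow_natCast, ← Real.rpow_mul (by positivity)]
    congr 1
    ring
  · congr 1
    have := hp.ne'
    have := hm.ne'
    field_simp
    ring

lemma isProbabilityMeasure_biNorm {μX μY σX σY ρ : ℝ} (hσX : 0 < σX) (hσY : 0 < σY)
    (hρ₁ : -1 < ρ) (hρ₂ : ρ < 1) :
    IsProbabilityMeasure ((volume : Measure (ℝ × ℝ)).withDensity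
      fun v => ENNReal.ofReal (biNormPDF μX μY σX σY ρ v)) := by
  have h := lintegral_exp_mul_biNormPDF (μX := μX) (μY := μY) hσX hσY hρ₁ hρ₂ (τ := 0)
    (by norm_num)
  constructor
  simpa [productNormalMGF] using h

lemma lintegral_pi_prod_eq_pow {α : Type*} [MeasurableSpace α] (μ : Measure α)
    [IsProbabilityMeasure μ] (n : ℕ) {f : α → ENNReal} (hf : Measurable f) :
    ∫⁻ v : Fin n → α, ∏ i, f (v i) ∂(Measure.pi fun _ => μ) = (∫⁻ x, f x ∂μ) ^ n := by
  have hind : ProbabilityTheory.iIndepFun (fun (i : Fin n) (v : Fin n → α) => f (v i))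
      (Measure.pi fun _ => μ) :=
    ProbabilityTheory.iIndepFun_pi (X := fun _ => f) fun _ => hf.aemeasurable
  rw [ProbabilityTheory.lintegral_prod_eq_prod_lintegral_of_indepFun Finset.univ _ hind
    fun i => hf.comp (measurable_pi_apply i)]
  have : ∀ i : Fin n, ∫⁻ v : Fin n → α, f (v i) ∂(Measure.pi fun _ => μ) = ∫⁻ x, f x ∂μ :=
    fun i => (measurePreserving_eval (fun _ : Fin n => μ) i).lintegral_comp hf
  simp [this]

lemma prodLaw_eq_map_ncChi {μX μY σX σY ρ : ℝ} {n : ℕ} (hn : 1 ≤ n)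
    (hσX : 0 < σX) (hσY : 0 < σY) (hρ₁ : -1 < ρ) (hρ₂ : ρ < 1) :
    prodLaw μX μY σX σY ρ n =
      Measure.map (fun z : ℝ × ℝ => σX * σY * ((1 + ρ) / 2 * z.1 - (1 - ρ) / 2 * z.2))
        ((ncChi ((n : ℝ) / 2) ((n : ℝ) * (μX / σX + μY / σY) ^ 2 / (2 * (1 + ρ)))).prod
          (ncChi ((n : ℝ) / 2) ((n : ℝ) * (μX / σX - μY / σY) ^ 2 / (2 * (1 - ρ))))) := by
  have hn' : (1 : ℝ) ≤ n := by exact_mod_cast hn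
  have hd : (1 : ℝ) / 2 ≤ (n : ℝ) / 2 := by linarith
  have hρ₁' : 0 < 1 + ρ := by linarith
  have hρ₂' : 0 < 1 - ρ := by linarith
  have := isProbabilityMeasure_biNorm (μX := μX) (μY := μY) hσX hσY hρ₁ hρ₂
  have := isProbabilityMeasure_ncChi hd
    (show 0 ≤ (n : ℝ) * (μX / σX + μY / σY) ^ 2 / (2 * (1 + ρ)) by positivity)
  have := isProbabilityMeasure_ncChi hd
    (show 0 ≤ (n : ℝ) * (μX / σX - μY / σY) ^ 2 / (2 * (1 - ρ)) by positivity)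
  have hs : 0 < σX * σY := mul_pos hσX hσY
  have hτ : ∀ t ∈ Set.Ioo (-(1 / (2 * (σX * σY)))) (1 / (2 * (σX * σY))),
      t * (σX * σY) ∈ Set.Ioo (-(1 / 2) : ℝ) (1 / 2) := by
    rintro t ⟨h1, h2⟩
    have h3 : 1 / (2 * (σX * σY)) * (σX * σY) = 1 / 2 := by field_simp
    constructor <;> nlinarith
  have hR : ∀ t ∈ Set.Ioo (-(1 / (2 * (σX * σY)))) (1 / (2 * (σX * σY))),
      ∫⁻ x, ENNReal.ofReal (Real.exp (t * x)) ∂(Measure.map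
        (fun z : ℝ × ℝ => σX * σY * ((1 + ρ) / 2 * z.1 - (1 - ρ) / 2 * z.2))
        ((ncChi ((n : ℝ) / 2) ((n : ℝ) * (μX / σX + μY / σY) ^ 2 / (2 * (1 + ρ)))).prod
          (ncChi ((n : ℝ) / 2) ((n : ℝ) * (μX / σX - μY / σY) ^ 2 / (2 * (1 - ρ)))))) =
      ENNReal.ofReal (productNormalMGF (μX / σX) (μY / σY) ρ (t * (σX * σY))) ^ n := by
    intro t ht
    rw [lintegral_map (by fun_prop) (by fun_prop), ← lintegral_exp_mul_prod_ncChi hn hρ₁ hρ₂ (hτ t ht)]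
    simp only [mul_assoc]
  have : IsProbabilityMeasure (prodLaw μX μY σX σY ρ n) :=
    Measure.isProbabilityMeasure_map (by fun_prop)
  have : IsProbabilityMeasure (Measure.map
        (fun z : ℝ × ℝ => σX * σY * ((1 + ρ) / 2 * z.1 - (1 - ρ) / 2 * z.2))
        ((ncChi ((n : ℝ) / 2) ((n : ℝ) * (μX / σX + μY / σY) ^ 2 / (2 * (1 + ρ)))).prod
          (ncChi ((n : ℝ) / 2) ((n : ℝ) * (μX / σX - μY / σY) ^ 2 / (2 * (1 - ρ)))))) :=
    Measure.isProbabilityMeasure_map (by fun_prop)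
  refine measure_ext_of_lintegral_exp_eq (ε := 1 / (2 * (σX * σY))) (by positivity)
    (fun t ht => ?_) fun t ht => ?_
  · rw [hR t ht, prodLaw, lintegral_map (by fun_prop) (by fun_prop),
      ← lintegral_exp_mul_biNormPDF hσX hσY hρ₁ hρ₂ (hτ t ht),
      ← lintegral_pi_prod_eq_pow _ _ (by fun_prop)]
    refine lintegral_congr fun v => ?_
    rw [mul_div_cancel_right₀ _ hs.ne', Finset.mul_sum, Real.exp_sum,
      ENNReal.ofReal_prod_of_nonneg fun i _ => (Real.exp_pos _).le]
  · rw [hR t ht]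
    exact ENNReal.pow_ne_top ENNReal.ofReal_ne_top

lemma prodLaw_Iic {μX μY σX σY ρ : ℝ} {n : ℕ} (hn : 1 ≤ n)
    (hσX : 0 < σX) (hσY : 0 < σY) (hρ₁ : -1 < ρ) (hρ₂ : ρ < 1) (V : ℝ) :
    prodLaw μX μY σX σY ρ n (Set.Iic (-(σX * σY * V ^ 2))) =
      (ncChi ((n : ℝ) / 2) ((n : ℝ) * (μX / σX + -(μY / σY)) ^ 2 / (2 * (1 + -ρ)))).prod
        (ncChi ((n : ℝ) / 2) ((n : ℝ) * (μX / σX - -(μY / σY)) ^ 2 / (2 * (1 - -ρ))))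
        {z | V ^ 2 ≤ (1 + -ρ) / 2 * z.1 - (1 - -ρ) / 2 * z.2} := by
  have hn' : (1 : ℝ) ≤ n := by exact_mod_cast hn
  have hd : (1 : ℝ) / 2 ≤ (n : ℝ) / 2 := by linarith
  have hρ₁' : 0 < 1 + ρ := by linarith
  have hρ₂' : 0 < 1 - ρ := by linarith
  have := isProbabilityMeasure_ncChi hd
    (show 0 ≤ (n : ℝ) * (μX / σX + μY / σY) ^ 2 / (2 * (1 + ρ)) by positivity)
  have := isProbabilityMeasure_ncChi hd
    (show 0 ≤ (n : ℝ) * (μX / σX - μY / σY) ^ 2 / (2 * (1 - ρ)) by positivity)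
  have hs : 0 < σX * σY := mul_pos hσX hσY
  rw [prodLaw_eq_map_ncChi hn hσX hσY hρ₁ hρ₂, Measure.map_apply (by fun_prop) measurableSet_Iic,
    ← Measure.prod_swap, Measure.map_apply measurable_swap
      ((by fun_prop : Measurable fun z : ℝ × ℝ =>
        σX * σY * ((1 + ρ) / 2 * z.1 - (1 - ρ) / 2 * z.2)) measurableSet_Iic),
    ← sub_eq_add_neg, ← sub_eq_add_neg, sub_neg_eq_add, sub_neg_eq_add]
  congr 1
  ext z
  simp only [Set.mem_preimage, Set.mem_Iic, Set.mem_ofPred_eq, Prod.fst_swap, Prod.snd_swap]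
  rw [← mul_neg, mul_le_mul_iff_right₀ hs]
  constructor <;> intro h <;> linarith

lemma HasExp.isLittleO_sub_sum {f : ℝ → ℝ} {c : ℕ → ℝ} (h : HasExp f c) (N : ℕ) :
    (fun v => f v - ∑ k ∈ range (N + 1), c k * v⁻¹ ^ k) =o[atTop] fun v => v⁻¹ ^ N := by
  refine (h (N + 1)).trans_isLittleO ?_
  have : (fun v : ℝ => v⁻¹ ^ N * v⁻¹) =o[atTop] fun v : ℝ => v⁻¹ ^ N * 1 :=
    (isBigO_refl _ _).mul_isLittleO ((isLittleO_one_iff ℝ).2 tendsto_inv_atTop_zero)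
  simpa only [pow_succ, mul_one] using this

lemma sqrt_div_inv_pow {t s : ℝ} (ht : 0 < t) (hs : 0 < s) (p : ℕ) :
    (Real.sqrt (t / s))⁻¹ ^ p = s ^ ((p : ℝ) / 2) * t ^ (-(p : ℝ) / 2) := by
  rw [← Real.sqrt_inv, inv_div, Real.sqrt_eq_rpow, ← Real.rpow_natCast, ← Real.rpow_mul (by positivity),
    Real.div_rpow hs.le ht.le, neg_div, Real.rpow_neg ht.le, div_eq_mul_inv]
  ring_nf

theorem product_normal_lower_tail_expansion (μX μY σX σY ρ : ℝ) (n : ℕ) (hn : 1 ≤ n)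
    (hσX : 0 < σX) (hσY : 0 < σY) (hρ₁ : -1 < ρ) (hρ₂ : ρ < 1)
    (rX rY s Cn : ℝ) (hrX : rX = μX / σX) (hrY : rY = μY / σY) (hs : s = σX * σY)
    (hCn : Cn = Real.exp (-((n : ℝ) * (rX ^ 2 + rY ^ 2 - 2 * ρ * rX * rY)) / (2 * (1 - ρ ^ 2))))
    (hdiff : rX - rY ≠ 0) (N : ℕ) :
    (fun x : ℝ => (prodLaw μX μY σX σY ρ n (Set.Iic x)).toReal -
        ((1 - ρ) * Cn / (2 * Real.sqrt (2 * Real.pi)) *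
        ((1 - ρ) / (|rX - rY| * Real.sqrt n)) ^ (((n : ℝ) - 1) / 2) *
        Real.exp ((n : ℝ) / 8 * ((1 - ρ) / (1 + ρ)) * (rX + rY) ^ 2) *
        (|x| / s) ^ (((n : ℝ) - 3) / 4) *
        Real.exp (|rX - rY| / (1 - ρ) * Real.sqrt ((n : ℝ) * |x| / s) + x / (s * (1 - ρ)))) *
        ∑ p ∈ Finset.range (N + 1), gammaCoef rX (-rY) (-ρ) n p * s ^ ((p : ℝ) / 2) * |x| ^ (-(p : ℝ) / 2))
      =o[atBot] fun x : ℝ =>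
        ((1 - ρ) * Cn / (2 * Real.sqrt (2 * Real.pi)) *
        ((1 - ρ) / (|rX - rY| * Real.sqrt n)) ^ (((n : ℝ) - 1) / 2) *
        Real.exp ((n : ℝ) / 8 * ((1 - ρ) / (1 + ρ)) * (rX + rY) ^ 2) *
        (|x| / s) ^ (((n : ℝ) - 3) / 4) *
        Real.exp (|rX - rY| / (1 - ρ) * Real.sqrt ((n : ℝ) * |x| / s) + x / (s * (1 - ρ)))) * |x| ^ (-(N : ℝ) / 2) := by
  have hs0 : 0 < s := hs ▸ mul_pos hσX hσY
  have hr : rX + -rY ≠ 0 := by rwa [← sub_eq_add_neg]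
  have hA := tailPrefactor_pos hn (ρ := -ρ) (by linarith) hr
  have hAeq : tailPrefactor rX (-rY) (-ρ) n = (1 - ρ) * Cn / (2 * Real.sqrt (2 * Real.pi)) *
      ((1 - ρ) / (|rX - rY| * Real.sqrt n)) ^ (((n : ℝ) - 1) / 2) *
      Real.exp ((n : ℝ) / 8 * ((1 - ρ) / (1 + ρ)) * (rX + rY) ^ 2) := by
    rw [tailPrefactor, hCn]
    simp only [← sub_eq_add_neg, sub_neg_eq_add, neg_sq, mul_neg, neg_mul, neg_neg]
  rw [← hAeq]
  have hexp := (hasExp_ncChi_tail_gammaCoef hn (ρ := -ρ) (by linarith) (by linarith)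
    hr).isLittleO_sub_sum N
  have hV : Tendsto (fun x : ℝ => Real.sqrt (|x| / s)) atBot atTop :=
    Real.tendsto_sqrt_atTop.comp (tendsto_abs_atBot_atTop.atTop_div_const hs0)
  have hscale : ((fun v : ℝ => v⁻¹ ^ N) ∘ fun x : ℝ => Real.sqrt (|x| / s)) =O[atBot]
      fun x : ℝ => |x| ^ (-(N : ℝ) / 2) := by
    have : (fun x : ℝ => s ^ ((N : ℝ) / 2) * |x| ^ (-(N : ℝ) / 2)) =O[atBot]
        fun x : ℝ => |x| ^ (-(N : ℝ) / 2) := isBigO_const_mul_self _ _ _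
    refine this.congr' ?_ EventuallyEq.rfl
    filter_upwards [eventually_lt_atBot 0] with x hx
    exact (sqrt_div_inv_pow (abs_pos.2 hx.ne) hs0 N).symm
  have hmul := (isBigO_refl (fun x : ℝ => tailPrefactor rX (-rY) (-ρ) n *
    (|x| / s) ^ (((n : ℝ) - 3) / 4) * Real.exp (|rX - rY| / (1 - ρ) *
      Real.sqrt ((n : ℝ) * |x| / s) + x / (s * (1 - ρ)))) atBot).mul_isLittleO
    (hexp.comp_tendsto hV)
  have hmul' := hmul.trans_isBigO ((isBigO_refl _ _).mul hscale)
  refine hmul'.congr' ?_ EventuallyEq.rfl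
  filter_upwards [eventually_lt_atBot 0] with x hx
  have hx' : 0 < |x| := abs_pos.2 hx.ne
  have hn0 : (0 : ℝ) ≤ n := Nat.cast_nonneg n
  have hV0 : 0 < Real.sqrt (|x| / s) := Real.sqrt_pos.2 (by positivity)
  have hVsq : Real.sqrt (|x| / s) ^ 2 = |x| / s := Real.sq_sqrt (by positivity)
  have hprob := prodLaw_Iic (μX := μX) (μY := μY) hn hσX hσY hρ₁ hρ₂ (Real.sqrt (|x| / s))
  rw [← hrX, ← hrY, ← hs, show -(s * Real.sqrt (|x| / s) ^ 2) = x by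
    rw [hVsq, mul_div_cancel₀ _ hs0.ne', abs_of_neg hx, neg_neg]] at hprob
  have hpow : Real.sqrt (|x| / s) ^ (((n : ℝ) - 3) / 2) = (|x| / s) ^ (((n : ℝ) - 3) / 4) := by
    rw [Real.sqrt_eq_rpow, ← Real.rpow_mul (by positivity)]
    ring_nf
  have hexpo : |rX + -rY| / (1 + -ρ) * Real.sqrt n * Real.sqrt (|x| / s) -
      Real.sqrt (|x| / s) ^ 2 / (1 + -ρ) =
      |rX - rY| / (1 - ρ) * Real.sqrt ((n : ℝ) * |x| / s) + x / (s * (1 - ρ)) := by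
    rw [mul_div_assoc (n : ℝ), Real.sqrt_mul hn0, hVsq, abs_of_neg hx, ← sub_eq_add_neg,
      ← sub_eq_add_neg, div_div]
    ring
  simp only [Function.comp_apply]
  rw [← hprob, hpow, hexpo, mul_sub]
  congr 1
  · rw [← mul_assoc, mul_div_cancel₀]
    positivity
  · congr 1
    refine Finset.sum_congr rfl fun p _ => ?_
    rw [sqrt_div_inv_pow hx' hs0, mul_assoc]

end
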